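/- arXiv:2304.05598 — 3 statements merged into one kernel-verified Lean document; each statement's English description precedes it below -/
import Mathlib

section
/- Let n ≥ s + t. A function f : F_q^n → F_q satisfies ⟨f∘T, H_e⟩ = 0 for every affine map T ∈ T_{n,s+t} and every valid e (i.e., f passes the sparse (s+t)-flat test with probability 1) if and only if f has degree at most d. -/
noncomputable section

open Finset

/-- Affine maps `F^ℓ → F^n`, given as a pair (linear part matrix, translation). -/
abbrev Aff (F : Type) (n ℓ : ℕ) := Matrix (Fin n) (Fin ℓ) F × (Fin n → F)

/-- Application of an affine map `T = (M, c)`: `x ↦ Mx + c`. -/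
def affApp {F : Type} [Field F] {n ℓ : ℕ} (T : Aff F n ℓ) (x : Fin ℓ → F) : Fin n → F :=
  T.1.mulVec x + T.2

/-- Inner product of two functions `F^m → F`. -/
def ip {F : Type} [Field F] [Fintype F] {m : ℕ} (u v : (Fin m → F) → F) : F :=
  ∑ z : Fin m → F, u z * v z

/-- `g` has degree at most `d` as a function. -/
def fDegLE {F : Type} [Field F] {m : ℕ} (g : (Fin m → F) → F) (d : ℕ) : Prop :=
  ∃ Q : MvPolynomial (Fin m) F, Q.totalDegree ≤ d ∧ ∀ x, MvPolynomial.eval x Q = g x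

/-- The defining equation of the polynomial `P`:
`x_1 ⋯ x_{p-1} · P = ∑_{I ⊆ [p-1]} (-1)^{|I|+1} (x_I + x_p)^{q-1}`. -/
def Pdef {F : Type} [Field F] (p q : ℕ) (hp : 0 < p) (P : MvPolynomial (Fin p) F) : Prop :=
  (∏ i : Fin (p - 1), MvPolynomial.X (Fin.castLE (Nat.sub_le p 1) i)) * P =
    ∑ I : Finset (Fin (p - 1)),
      MvPolynomial.C ((-1 : F) ^ (I.card + 1)) *
        ((∑ i ∈ I, MvPolynomial.X (Fin.castLE (Nat.sub_le p 1) i)) +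
          MvPolynomial.X (⟨p - 1, Nat.sub_lt hp one_pos⟩ : Fin p)) ^ (q - 1)

/-- The test polynomial `H_e` as a function on `F^{s+t}`. -/
def Hfun {F : Type} [Field F] {p : ℕ} (P : MvPolynomial (Fin p) F)
    (s t : ℕ) (e : Fin t → ℕ) (x : Fin (s + t) → F) : F :=
  (∏ i ∈ Finset.range (s / p),
    MvPolynomial.eval (fun l : Fin p =>
      if h : p * i + (l : ℕ) < s + t then x ⟨p * i + (l : ℕ), h⟩ else 0) P) *
  ∏ j : Fin t, x (Fin.natAdd s j) ^ e j

/-- A degree sequence `e ∈ {0, …, q-1}^t` is valid if `∑ e_j ≤ t(q-1) - r`. -/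
def validE (q r t : ℕ) (e : Fin t → ℕ) : Prop :=
  (∀ j, e j ≤ q - 1) ∧ ∑ j, e j ≤ t * (q - 1) - r

/-- `T` rejects `f` in the sparse `(s+t)`-flat test. -/
def rejects {F : Type} [Field F] [Fintype F] {p : ℕ} (P : MvPolynomial (Fin p) F)
    (q s r t n : ℕ) (f : (Fin n → F) → F) (T : Aff F n (s + t)) : Prop :=
  ∃ e : Fin t → ℕ, validE q r t e ∧ ip (fun x => f (affApp T x)) (Hfun P s t e) ≠ 0

/-- Density of `A` inside `C`. -/
def dens {α : Type} (A C : Set α) : ℝ :=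
  (Nat.card ↥(A ∩ C) : ℝ) / (Nat.card ↥C : ℝ)

/-- Fractional measure of a set in a (finite) type. -/
def mu {α : Type} (A : Set α) : ℝ :=
  (Nat.card ↥A : ℝ) / (Nat.card α : ℝ)

/-- The union of the supports of the test polynomials `H_e`. -/
def suppH {F : Type} [Field F] [Fintype F] {p : ℕ} (P : MvPolynomial (Fin p) F)
    (q s t : ℕ) : Set (Fin (s + t) → F) :=
  {x | ∃ e : Fin t → ℕ, (∀ j, e j ≤ q - 1) ∧ Hfun P s t e x ≠ 0}

/-- Edge expansion of a set `S` in the (regular) graph with adjacency `adj`: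
the probability that a uniformly random step started in `S` escapes `S`. -/
def expans {α : Type} (adj : α → α → Prop) (S : Set α) : ℝ :=
  (Nat.card {x : α × α // x.1 ∈ S ∧ adj x.1 x.2 ∧ x.2 ∉ S} : ℝ) /
  (Nat.card {x : α × α // x.1 ∈ S ∧ adj x.1 x.2} : ℝ)

/-- Adjacency in the affine bi-linear scheme graph: two distinct affine maps are adjacent
iff their agreement set is an affine subspace of dimension `ℓ - 1`. -/
def adjBilin {F : Type} [Field F] {n ℓ : ℕ} (T₁ T₂ : Aff F n ℓ) : Prop :=
  T₁ ≠ T₂ ∧ ∃ W : AffineSubspace F (Fin ℓ → F),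
    (W : Set (Fin ℓ → F)).Nonempty ∧
    (W : Set (Fin ℓ → F)) = {x | affApp T₁ x = affApp T₂ x} ∧
    Module.finrank F W.direction = ℓ - 1

/-- `W` is an `ℓ`-flat: a nonempty affine subspace of dimension `ℓ`. -/
def IsFlat {F : Type} [Field F] {N : ℕ} (ℓ : ℕ) (W : AffineSubspace F (Fin N → F)) : Prop :=
  (W : Set (Fin N → F)).Nonempty ∧ Module.finrank F W.direction = ℓ

/-- Adjacency in the affine Grassmann graph `AffGras(N, ℓ)`: two distinct `ℓ`-flats are
adjacent iff their intersection is an `(ℓ-1)`-flat. -/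
def adjGras {F : Type} [Field F] {N : ℕ} (ℓ : ℕ) (U V : AffineSubspace F (Fin N → F)) : Prop :=
  U ≠ V ∧ IsFlat ℓ U ∧ IsFlat ℓ V ∧ IsFlat (ℓ - 1) (U ⊓ V)

/-- The minimal fractional Hamming distance from `f` to a function of degree at most `d`. -/
def deltaDist {F : Type} [Field F] [Fintype F] {n : ℕ} (f : (Fin n → F) → F) (d : ℕ) : ℝ :=
  sInf {x : ℝ | ∃ g : (Fin n → F) → F, fDegLE g d ∧
    x = (Nat.card {y : Fin n → F // f y ≠ g y} : ℝ) / (Fintype.card (Fin n → F) : ℝ)}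

/-! ### Binomial and multinomial coefficients modulo a prime -/

lemma choose_prime_pow_modEq {p : ℕ} [Fact p.Prime] (w a : ℕ) :
    a.choose (p ^ w) ≡ a / p ^ w [MOD p] := by
  induction w generalizing a with
  | zero => simp [Nat.ModEq]
  | succ w ih =>
    have hp := (Fact.out : p.Prime).pos
    have h := Choose.choose_modEq_choose_mod_mul_choose_div_nat (n := a) (k := p ^ (w + 1)) (p := p)
    have h1 : p ^ (w + 1) % p = 0 := by simp [pow_succ]
    have h2 : p ^ (w + 1) / p = p ^ w := by rw [pow_succ, Nat.mul_div_cancel _ hp]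
    rw [h1, h2, Nat.choose_zero_right, one_mul] at h
    refine h.trans ((ih (a / p)).trans ?_)
    rw [Nat.div_div_eq_div_mul, pow_succ, mul_comm p]

lemma not_dvd_choose_prime_pow {p : ℕ} (hp : p.Prime) {w a : ℕ} (h1 : p ^ w ≤ a)
    (h2 : a < p ^ (w + 1)) : ¬ p ∣ a.choose (p ^ w) := by
  have := Fact.mk hp
  rw [(choose_prime_pow_modEq w a).dvd_iff dvd_rfl]
  refine Nat.not_dvd_of_pos_of_lt (Nat.div_pos h1 (pow_pos hp.pos w)) ?_
  rw [Nat.div_lt_iff_lt_mul (pow_pos hp.pos w)]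
  rwa [pow_succ, mul_comm] at h2

lemma multinomial_univ_cons {m : ℕ} (a : ℕ) (w : Fin m → ℕ) :
    Nat.multinomial univ (Fin.cons a w : Fin (m + 1) → ℕ) =
      (a + ∑ i, w i).choose a * Nat.multinomial univ w := by
  have h1 := Nat.multinomial_spec univ (Fin.cons a w : Fin (m + 1) → ℕ)
  have h2 := Nat.multinomial_spec univ w
  have h3 := Nat.add_choose_mul_factorial_mul_factorial a (∑ i, w i)
  rw [Fin.prod_univ_succ, Fin.sum_univ_succ] at h1
  simp only [Fin.cons_zero, Fin.cons_succ] at h1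
  have h4 : 0 < a.factorial * ∏ i, (w i).factorial :=
    Nat.mul_pos a.factorial_pos (Finset.prod_pos fun i _ => (w i).factorial_pos)
  refine Nat.eq_of_mul_eq_mul_left h4 ?_
  rw [h1, ← h3, ← h2, ← Nat.choose_symm_add]
  ring

/-- Every natural number is a sum of powers of `p` with multinomial coefficient prime to `p`. -/
lemma exists_prime_pow_parts {p : ℕ} (hp : p.Prime) (a : ℕ) :
    ∃ (m : ℕ) (w : Fin m → ℕ), (∀ i, ∃ l, w i = p ^ l) ∧ ∑ i, w i = a ∧
      ¬ p ∣ Nat.multinomial univ w := by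
  induction a using Nat.strong_induction_on with
  | _ a ih =>
    rcases Nat.eq_zero_or_pos a with rfl | ha
    · exact ⟨0, Fin.elim0, fun i => i.elim0, by simp, by simpa using hp.one_lt.ne'⟩
    have h1 := Nat.pow_log_le_self p ha.ne'
    have h2 := Nat.lt_pow_succ_log_self hp.one_lt a
    have h3 : 0 < p ^ Nat.log p a := pow_pos hp.pos _
    obtain ⟨m, w, hw, hs, hm⟩ := ih (a - p ^ Nat.log p a) (by omega)
    have hs' : p ^ Nat.log p a + ∑ i, w i = a := by omega
    refine ⟨m + 1, Fin.cons (p ^ Nat.log p a) w, ?_, ?_, ?_⟩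
    · intro i
      refine Fin.cases ⟨Nat.log p a, rfl⟩ (fun i => ?_) i
      simpa using hw i
    · simpa [Fin.sum_univ_succ] using hs'
    · rw [multinomial_univ_cons, hp.dvd_mul, hs', not_or]
      exact ⟨not_dvd_choose_prime_pow hp h1 h2, hm⟩

lemma not_dvd_multinomial_insert_const {p : ℕ} (hp : p.Prime) {ι : Type*} [DecidableEq ι]
    (w : ℕ) (b : ι → ℕ) (i₀ : ι) (h₀ : b i₀ < p ^ w) (S : Finset ι) (hS : i₀ ∉ S)
    (hb : ∀ i ∈ S, b i = p ^ w) (hc : S.card < p) :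
    ¬ p ∣ Nat.multinomial (insert i₀ S) b := by
  induction S using Finset.induction_on with
  | empty => simpa using hp.one_lt.ne'
  | insert a S ha ih =>
    simp only [mem_insert, not_or] at hS
    rw [card_insert_of_notMem ha] at hc
    have ha' : a ∉ insert i₀ S := by simp [ha, Ne.symm hS.1]
    have hsum : b a + ∑ i ∈ insert i₀ S, b i = (S.card + 1) * p ^ w + b i₀ := by
      rw [sum_insert hS.2, sum_congr rfl (fun i hi => hb i (mem_insert_of_mem hi)),
        hb a (mem_insert_self a S)]
      simp
      ring
    rw [Finset.insert_comm, Nat.multinomial_insert ha', hp.dvd_mul, not_or, hsum,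
      hb a (mem_insert_self a S)]
    refine ⟨not_dvd_choose_prime_pow hp ?_ ?_,
      ih hS.2 (fun i hi => hb i (mem_insert_of_mem hi)) (by omega)⟩
    · nlinarith [Nat.zero_le (S.card * p ^ w)]
    · rw [pow_succ]
      nlinarith [Nat.mul_le_mul_left (p ^ w) (show S.card + 1 + 1 ≤ p by omega)]

/-! ### Packing weights which form a divisibility chain -/

lemma exists_subset_sum_eq {ι : Type*} [DecidableEq ι] (W : ι → ℕ)
    (hW : ∀ i j, W i ≤ W j → W i ∣ W j) (S : Finset ι) (Q : ℕ) (hQ : ∀ i ∈ S, W i ∣ Q)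
    (hS : Q ≤ ∑ i ∈ S, W i) : ∃ U ⊆ S, ∑ i ∈ U, W i = Q := by
  induction S using Finset.induction_on_max_value W generalizing Q with
  | empty => exact ⟨∅, subset_rfl, by simpa [eq_comm] using hS⟩
  | insert a S ha hmax ih =>
    rcases Nat.eq_zero_or_pos Q with rfl | hQ0
    · exact ⟨∅, empty_subset _, by simp⟩
    have haQ := hQ a (mem_insert_self a S)
    have hle := Nat.le_of_dvd hQ0 haQ
    rw [sum_insert ha] at hS
    obtain ⟨U, hU, hsum⟩ := ih (Q - W a)
      (fun i hi => Nat.dvd_sub (hQ i (mem_insert_of_mem hi)) (hW i a (hmax i hi))) (by omega)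
    refine ⟨insert a U, insert_subset_insert a hU, ?_⟩
    rw [sum_insert (fun h => ha (hU h)), hsum]
    omega

/-- Weights forming a divisibility chain, each dividing `Q`, fill successive bins of capacity `Q`
without waste. -/
lemma exists_bin_packing {ι : Type*} [DecidableEq ι] [Fintype ι] (W : ι → ℕ)
    (hW : ∀ i j, W i ≤ W j → W i ∣ W j) (Q : ℕ) (hQ : ∀ i, W i ∣ Q) (N : ℕ) :
    ∃ g : ι → ℕ, (∀ j < N, ∑ i with g i = j, W i = min Q (∑ i, W i - j * Q)) ∧
      ∑ i with N ≤ g i, W i = ∑ i, W i - N * Q := by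
  induction N with
  | zero => exact ⟨fun _ => 0, by simp, by simp⟩
  | succ N ih =>
    obtain ⟨g, hg, hN⟩ := ih
    obtain ⟨U, hU, hsum⟩ : ∃ U ⊆ univ.filter (fun i => N ≤ g i),
        ∑ i ∈ U, W i = min Q (∑ i, W i - N * Q) := by
      rcases le_total Q (∑ i, W i - N * Q) with h | h
      · rw [min_eq_left h]
        exact exists_subset_sum_eq W hW _ Q (fun i _ => hQ i) (hN ▸ h)
      · rw [min_eq_right h]
        exact ⟨_, subset_rfl, hN⟩
    have hUg : ∀ i ∈ U, N ≤ g i := fun i hi => (mem_filter.1 (hU hi)).2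
    refine ⟨fun i => if i ∈ U then N else if g i < N then g i else N + 1, ?_, ?_⟩
    · intro j hj
      rcases Nat.lt_succ_iff_lt_or_eq.1 hj with hj' | rfl
      · rw [← hg j hj']
        refine sum_congr (filter_congr fun i _ => ?_) fun _ _ => rfl
        by_cases hi : i ∈ U
        · have := hUg i hi
          simp only [hi, if_true]
          omega
        · simp only [hi, if_false]
          split_ifs <;> omega
      · rw [← hsum]
        refine sum_congr ?_ fun _ _ => rfl
        ext i
        by_cases hi : i ∈ U
        · simp [hi]
        · simp only [mem_filter, mem_univ, true_and, hi, if_false, iff_false]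
          split_ifs <;> omega
    · have h : univ.filter (fun i => N + 1 ≤ if i ∈ U then N else if g i < N then g i else N + 1)
          = univ.filter (fun i => N ≤ g i) \ U := by
        ext i
        by_cases hi : i ∈ U
        · simp [hi]
        · simp only [mem_filter, mem_univ, true_and, hi, if_false, mem_sdiff, not_false_eq_true,
            and_true]
          split_ifs <;> omega
      have h2 := sum_sdiff (f := W) hU
      rw [h]
      rw [hN, hsum] at h2
      rw [add_mul, one_mul]
      omega

/-! ### Power sums over a finite field -/

lemma sum_pow_card_sub_one {F : Type*} [Field F] [Fintype F] :
    ∑ x : F, x ^ (Fintype.card F - 1) = -1 := by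
  classical
  have h : Fintype.card F - 1 ≠ 0 := (Nat.sub_pos_of_lt Fintype.one_lt_card).ne'
  have h1 : ∀ x : F, x ^ (Fintype.card F - 1) = 1 - if x = 0 then 1 else 0 := by
    intro x
    split_ifs with hx
    · simp [hx, h]
    · simpa using FiniteField.pow_card_sub_one_eq_one x hx
  simp [h1]

lemma sum_pow_shift_eq_zero {F : Type*} [Field F] [Fintype F] {w b : ℕ} (hw0 : 1 ≤ w)
    (hw : w ≤ Fintype.card F - 1) (hb : b ≤ Fintype.card F - 1) (h : b ≠ w) :
    ∑ x : F, x ^ (Fintype.card F - 1 - w + b) = 0 := by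
  rcases lt_or_gt_of_ne h with h | h
  · exact FiniteField.sum_pow_lt_card_sub_one F _ (by omega)
  · have h1 : ∀ x : F, x ^ (Fintype.card F - 1 - w + b) = x ^ (b - w) := by
      intro x
      rw [show Fintype.card F - 1 - w + b = (Fintype.card F - 1) + (b - w) by omega, pow_add]
      by_cases hx : x = 0
      · simp [hx, show b - w ≠ 0 by omega]
      · rw [FiniteField.pow_card_sub_one_eq_one x hx, one_mul]
    simp only [h1]
    exact FiniteField.sum_pow_lt_card_sub_one F _ (by omega)

/-- Averaging against a character of the torus extracts one multinomial coefficient of a power of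
a linear form. -/
lemma sum_torus_mul_pow {F : Type*} [Field F] [Fintype F] {ι : Type*} [Fintype ι]
    [DecidableEq ι] {w : ι → ℕ} {a : ℕ} (hw : ∀ i, w i ≤ Fintype.card F - 1)
    (ha : a ≤ Fintype.card F - 1)
    (hsep : ∀ b : ι → ℕ, ∑ i, b i = a → b ≠ w → ∃ i, 1 ≤ w i ∧ b i ≠ w i) (y : ι → F) :
    ∑ l : ι → F, (∏ i, l i ^ (Fintype.card F - 1 - w i)) * (∑ i, l i * y i) ^ a =
      if ∑ i, w i = a then
        (-1) ^ Fintype.card ι * (Nat.multinomial univ w : F) * ∏ i, y i ^ w i else 0 := by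
  have h1 : ∀ l : ι → F, (∏ i, l i ^ (Fintype.card F - 1 - w i)) * (∑ i, l i * y i) ^ a =
      ∑ b ∈ piAntidiag univ a, (Nat.multinomial univ b * ∏ i, y i ^ b i) *
        ∏ i, l i ^ (Fintype.card F - 1 - w i + b i) := by
    intro l
    rw [sum_pow_eq_sum_piAntidiag, mul_sum]
    refine sum_congr rfl fun b _ => ?_
    simp only [mul_pow, prod_mul_distrib, pow_add]
    ring
  have h2 : ∀ b : ι → ℕ, ∑ l : ι → F, ∏ i, l i ^ (Fintype.card F - 1 - w i + b i) =
      ∏ i, ∑ x : F, x ^ (Fintype.card F - 1 - w i + b i) := by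
    intro b
    rw [prod_univ_sum, Fintype.piFinset_univ]
  have h3 : ∏ i, ∑ x : F, x ^ (Fintype.card F - 1 - w i + w i) = (-1) ^ Fintype.card ι := by
    rw [prod_congr rfl fun i _ => by rw [Nat.sub_add_cancel (hw i), sum_pow_card_sub_one]]
    simp
  simp only [h1]
  rw [sum_comm]
  simp only [← mul_sum, h2]
  have h4 : ∀ b ∈ piAntidiag (univ : Finset ι) a, b ≠ w →
      (Nat.multinomial univ b * ∏ i, y i ^ b i) *
        ∏ i, ∑ x : F, x ^ (Fintype.card F - 1 - w i + b i) = 0 := by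
    intro b hb hbw
    have hb' : ∑ i, b i = a := (mem_piAntidiag.1 hb).1
    obtain ⟨i, hi, hi'⟩ := hsep b hb' hbw
    have hbi : b i ≤ a := hb' ▸ single_le_sum (f := b) (fun _ _ => Nat.zero_le _) (mem_univ i)
    rw [prod_eq_zero (f := fun i => ∑ x : F, x ^ (Fintype.card F - 1 - w i + b i)) (mem_univ i)
      (sum_pow_shift_eq_zero hi (hw i) (hbi.trans ha) hi'), mul_zero]
  split_ifs with h
  · rw [sum_eq_single_of_mem w (by simp [mem_piAntidiag, h]) h4, h3]
    ring
  · exact sum_eq_zero fun b hb => h4 b hb fun hbw => h (hbw ▸ (mem_piAntidiag.1 hb).1)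

lemma natCast_ne_zero_of_not_dvd {F : Type*} [Field F] [Fintype F] {p k : ℕ} (hp : p.Prime)
    (hcard : Fintype.card F = p ^ k) {m : ℕ} (hm : ¬ p ∣ m) : (m : F) ≠ 0 := by
  have := Fact.mk hp
  have := charP_of_card_eq_prime_pow hcard
  rwa [Ne, CharP.cast_eq_zero_iff F p]

/-! ### Pairing the test functions with the canonical monomials -/

lemma Pdef.eval_eq {F : Type} [Field F] {m q : ℕ} {P : MvPolynomial (Fin (m + 1)) F}
    (hP : Pdef (m + 1) q m.succ_pos P) (y : Fin (m + 1) → F) :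
    (∏ i : Fin m, y i.castSucc) * MvPolynomial.eval y P =
      ∑ I : Finset (Fin m), (-1) ^ (I.card + 1) *
        ((∑ i ∈ I, y i.castSucc) + y (Fin.last m)) ^ (q - 1) := by
  have h := congrArg (MvPolynomial.eval y) hP
  simp only [map_mul, map_prod, map_sum, map_pow, map_add, map_neg, map_one,
    MvPolynomial.eval_X] at h
  exact h

lemma sum_pow_mul_eval_ne_zero {F : Type} [Field F] [Fintype F] {p k q : ℕ} (hp : p.Prime)
    (hk : 1 ≤ k) (hq : q = p ^ k) (hcard : Fintype.card F = q) {P : MvPolynomial (Fin p) F}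
    (hP : Pdef p q hp.pos P) :
    ∑ y : Fin p → F, (∏ l, y l ^ (q - q / p)) * MvPolynomial.eval y P ≠ 0 := by
  obtain ⟨m, rfl⟩ : ∃ m, p = m + 1 := ⟨p - 1, (Nat.sub_add_cancel hp.pos).symm⟩
  obtain ⟨k, rfl⟩ : ∃ k', k = k' + 1 := ⟨k - 1, (Nat.sub_add_cancel hk).symm⟩
  have hdiv : q / (m + 1) = (m + 1) ^ k := by
    rw [hq, pow_succ, Nat.mul_div_cancel _ m.succ_pos]
  have hqu : q = m * (m + 1) ^ k + (m + 1) ^ k := by rw [hq, pow_succ]; ring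
  rw [hdiv]
  have hu : 0 < (m + 1) ^ k := pow_pos hp.pos k
  have hcF : Fintype.card F = (m + 1) ^ (k + 1) := hcard.trans hq
  generalize hU : (m + 1) ^ k = u at *
  have hm : 1 ≤ m := by have := hp.two_le; omega
  have hmu : u ≤ m * u := Nat.le_mul_of_pos_left u hm
  let w : Fin (m + 1) → ℕ := Fin.snoc (fun _ : Fin m => u) (u - 1)
  let c : Finset (Fin m) → Fin (m + 1) → F :=
    fun I => Fin.snoc (fun i : Fin m => if i ∈ I then (1 : F) else 0) 1
  have hwc : ∀ i : Fin m, w i.castSucc = u := fun i => by simp [w]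
  have hwl : w (Fin.last m) = u - 1 := by simp [w]
  have hsum : ∑ i, w i = q - 1 := by
    rw [Fin.sum_univ_castSucc, hwl, sum_congr rfl fun i _ => hwc i]
    simp
    omega
  have hmult : (Nat.multinomial univ w : F) ≠ 0 := by
    refine natCast_ne_zero_of_not_dvd hp hcF ?_
    rw [← insert_erase (mem_univ (Fin.last m))]
    refine not_dvd_multinomial_insert_const hp k w _ ?_ _ (notMem_erase _ _) ?_ ?_
    · rw [hwl, hU]; omega
    · intro i hi
      refine Fin.lastCases (fun h => absurd rfl (ne_of_mem_erase h)) (fun i _ => ?_) i hi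
      rw [hwc, hU]
    · rw [card_erase_of_mem (mem_univ _)]
      simp
  have hterm : ∀ y : Fin (m + 1) → F,
      (∏ l, y l ^ (q - u)) * MvPolynomial.eval y P =
        ∑ I : Finset (Fin m), (-1) ^ (I.card + 1) *
          ((∏ i, y i ^ (Fintype.card F - 1 - w i)) * (∑ i, y i * c I i) ^ (q - 1)) := by
    intro y
    have h1 : ∀ I, ∑ i, y i * c I i = (∑ i ∈ I, y i.castSucc) + y (Fin.last m) := by
      intro I
      simp [Fin.sum_univ_castSucc, c]
    have h2 : ∏ l, y l ^ (q - u) =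
        (∏ i, y i ^ (Fintype.card F - 1 - w i)) * ∏ i : Fin m, y i.castSucc := by
      rw [Fin.prod_univ_castSucc, Fin.prod_univ_castSucc, hwl, mul_right_comm, ← prod_mul_distrib]
      congr 1
      · refine prod_congr rfl fun i _ => ?_
        rw [hwc, ← pow_succ]
        congr 1
        omega
      · congr 1
        omega
    rw [h2, mul_assoc, hP.eval_eq, mul_sum]
    refine sum_congr rfl fun I _ => ?_
    rw [h1]
    ring
  have hsep : ∀ b : Fin (m + 1) → ℕ, ∑ i, b i = q - 1 → b ≠ w →
      ∃ i, 1 ≤ w i ∧ b i ≠ w i := by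
    intro b hb hbw
    by_contra! hcon
    have h1 : ∀ i : Fin m, b i.castSucc = w i.castSucc :=
      fun i => hcon _ (by rw [hwc]; exact hu)
    refine hbw (funext fun i => Fin.lastCases ?_ h1 i)
    rw [← hsum, Fin.sum_univ_castSucc, Fin.sum_univ_castSucc, sum_congr rfl fun i _ => h1 i] at hb
    exact Nat.add_left_cancel hb
  have hwle : ∀ i, w i ≤ Fintype.card F - 1 := by
    intro i
    rw [hcard, ← hsum]
    exact single_le_sum (f := w) (fun _ _ => Nat.zero_le _) (mem_univ i)
  simp only [hterm]
  rw [sum_comm]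
  simp only [← mul_sum, sum_torus_mul_pow hwle (hcard ▸ le_rfl) hsep, if_pos hsum]
  rw [sum_eq_single_of_mem univ (mem_univ _)]
  · simp [Fin.prod_univ_castSucc, c, hmult]
  · intro I _ hI
    obtain ⟨i, hi⟩ : ∃ i, i ∉ I := by simpa [Finset.eq_univ_iff_forall] using hI
    rw [prod_eq_zero (mem_univ i.castSucc), mul_zero, mul_zero]
    rw [hwc]
    simp [c, hi, hu.ne']

/-- Splitting a vector of length `m * p + t` into `m` blocks of length `p` and a tail. -/
def blockEquiv (F : Type) (m p t : ℕ) :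
    (Fin m → Fin p → F) × (Fin t → F) ≃ (Fin (m * p + t) → F) :=
  ((Equiv.curry (Fin m) (Fin p) F).symm.prodCongr (Equiv.refl _)).trans
    ((Equiv.sumArrowEquivProdArrow (Fin m × Fin p) (Fin t) F).symm.trans
      (((finProdFinEquiv.sumCongr (Equiv.refl _)).trans finSumFinEquiv).arrowCongr (Equiv.refl F)))

lemma blockEquiv_castAdd {F : Type} {m p t : ℕ} (u : Fin m → Fin p → F) (v : Fin t → F)
    (i : Fin m) (l : Fin p) :
    blockEquiv F m p t (u, v) (Fin.castAdd t (finProdFinEquiv (i, l))) = u i l := by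
  simp [blockEquiv, Equiv.arrowCongr]

lemma blockEquiv_natAdd {F : Type} {m p t : ℕ} (u : Fin m → Fin p → F) (v : Fin t → F)
    (j : Fin t) : blockEquiv F m p t (u, v) (Fin.natAdd (m * p) j) = v j := by
  simp [blockEquiv, Equiv.arrowCongr]

lemma Hfun_eq {F : Type} [Field F] {p : ℕ} (hp : 0 < p) (P : MvPolynomial (Fin p) F)
    (m t : ℕ) (e : Fin t → ℕ) (x : Fin (m * p + t) → F) :
    Hfun P (m * p) t e x =
      (∏ i : Fin m, MvPolynomial.eval
        (fun l => x (Fin.castAdd t (finProdFinEquiv (i, l)))) P) *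
      ∏ j : Fin t, x (Fin.natAdd (m * p) j) ^ e j := by
  unfold Hfun
  rw [Nat.mul_div_cancel _ hp, Finset.prod_range]
  congr 1
  refine prod_congr rfl fun i _ => ?_
  congr 2
  funext l
  have h := (Fin.castAdd t (finProdFinEquiv (i, l))).2
  have hv : (Fin.castAdd t (finProdFinEquiv (i, l)) : ℕ) = p * i + l := by
    simp [finProdFinEquiv, add_comm]
  rw [dif_pos (hv ▸ h)]
  exact congrArg x (Fin.ext hv.symm)

lemma sum_canonical_monomial_mul_Hfun_ne_zero {F : Type} [Field F] [Fintype F] {p k q : ℕ}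
    (hp : p.Prime) (hk : 1 ≤ k) (hq : q = p ^ k) (hcard : Fintype.card F = q)
    {P : MvPolynomial (Fin p) F} (hP : Pdef p q hp.pos P) (m t : ℕ) (e : Fin t → ℕ)
    (b : Fin (m * p + t) → ℕ) (hb1 : ∀ i, b (Fin.castAdd t i) = q - q / p)
    (hb2 : ∀ j, b (Fin.natAdd (m * p) j) + e j = q - 1) :
    ∑ z : Fin (m * p + t) → F, (∏ j, z j ^ b j) * Hfun P (m * p) t e z ≠ 0 := by
  have hterm : ∀ u : (Fin m → Fin p → F) × (Fin t → F),
      (∏ j, blockEquiv F m p t u j ^ b j) * Hfun P (m * p) t e (blockEquiv F m p t u) =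
        (∏ i, ((∏ l, u.1 i l ^ (q - q / p)) * MvPolynomial.eval (u.1 i) P)) *
          ∏ j, u.2 j ^ (Fintype.card F - 1) := by
    rintro ⟨u, v⟩
    rw [Hfun_eq hp.pos, Fin.prod_univ_add]
    simp only [blockEquiv_castAdd, blockEquiv_natAdd, hb1]
    rw [← finProdFinEquiv.prod_comp, Fintype.prod_prod_type]
    simp only [blockEquiv_castAdd, prod_mul_distrib]
    have hv : ∏ j, v j ^ (Fintype.card F - 1) =
        (∏ j, v j ^ b (Fin.natAdd (m * p) j)) * ∏ j, v j ^ e j := by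
      rw [← prod_mul_distrib]
      exact prod_congr rfl fun j _ => by rw [hcard, ← hb2 j, pow_add]
    rw [hv]
    ring
  rw [← (blockEquiv F m p t).sum_comp]
  simp only [hterm]
  rw [Fintype.sum_prod_type]
  simp only [← mul_sum, ← sum_mul]
  rw [← Fintype.prod_sum (fun (_ : Fin m) (y : Fin p → F) =>
      (∏ l, y l ^ (q - q / p)) * MvPolynomial.eval y P),
    ← Fintype.prod_sum (fun (_ : Fin t) (x : F) => x ^ (Fintype.card F - 1))]
  simp [sum_pow_card_sub_one, sum_pow_mul_eval_ne_zero hp hk hq hcard hP]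

/-! ### Functions of low degree pass the test -/

lemma totalDegree_bind₁_le {R σ τ : Type*} [CommSemiring R] (g : σ → MvPolynomial τ R)
    (hg : ∀ i, (g i).totalDegree ≤ 1) (Q : MvPolynomial σ R) :
    (MvPolynomial.bind₁ g Q).totalDegree ≤ Q.totalDegree := by
  rw [MvPolynomial.bind₁, MvPolynomial.aeval_def, MvPolynomial.eval₂_eq]
  refine MvPolynomial.totalDegree_finsetSum_le fun s hs => ?_
  refine (MvPolynomial.totalDegree_mul _ _).trans ?_
  rw [MvPolynomial.algebraMap_eq, MvPolynomial.totalDegree_C, zero_add]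
  refine (MvPolynomial.totalDegree_finsetProd _ _).trans
    (le_trans ?_ (MvPolynomial.le_totalDegree hs))
  refine sum_le_sum fun i _ => (MvPolynomial.totalDegree_pow _ _).trans ?_
  simpa using Nat.mul_le_mul_left (s i) (hg i)

lemma fDegLE.comp_affApp {F : Type} [Field F] {n ℓ d : ℕ} {f : (Fin n → F) → F}
    (hf : fDegLE f d) (T : Aff F n ℓ) : fDegLE (fun x => f (affApp T x)) d := by
  obtain ⟨Q, hQ, hQf⟩ := hf
  refine ⟨MvPolynomial.bind₁ (fun i => ∑ j, MvPolynomial.C (T.1 i j) * MvPolynomial.X j +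
    MvPolynomial.C (T.2 i)) Q, (totalDegree_bind₁_le _ (fun i => ?_) Q).trans hQ, fun x => ?_⟩
  · refine (MvPolynomial.totalDegree_add _ _).trans (max_le ?_ (by simp))
    refine MvPolynomial.totalDegree_finsetSum_le fun j _ => ?_
    refine (MvPolynomial.totalDegree_mul _ _).trans ?_
    simp
  · refine (MvPolynomial.eval₂Hom_bind₁ _ _ _ _).trans ((hQf _).trans (congrArg f ?_))
    funext i
    simp [affApp, Matrix.mulVec, dotProduct]

lemma Pdef.totalDegree_add_le {F : Type} [Field F] {p q : ℕ} {hp : 0 < p} (hpq : p ≤ q)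
    {P : MvPolynomial (Fin p) F} (hP : Pdef p q hp P) : P.totalDegree + (p - 1) ≤ q - 1 := by
  rcases eq_or_ne P 0 with rfl | h0
  · simp only [MvPolynomial.totalDegree_zero]
    omega
  have hX : (∏ i : Fin (p - 1), (MvPolynomial.X (Fin.castLE (Nat.sub_le p 1) i) :
      MvPolynomial (Fin p) F)).totalDegree = p - 1 := by
    have h : (∏ i : Fin (p - 1), (MvPolynomial.X (Fin.castLE (Nat.sub_le p 1) i) :
      MvPolynomial (Fin p) F)).IsHomogeneous (∑ _i : Fin (p - 1), 1) :=
      MvPolynomial.IsHomogeneous.prod _ _ _ fun i _ => MvPolynomial.isHomogeneous_X _ _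
    rw [h.totalDegree (prod_ne_zero_iff.2 fun i _ => MvPolynomial.X_ne_zero _)]
    simp
  have hdeg := congrArg MvPolynomial.totalDegree hP
  rw [MvPolynomial.totalDegree_mul_of_isDomain
    (prod_ne_zero_iff.2 fun i _ => MvPolynomial.X_ne_zero _) h0, hX, add_comm] at hdeg
  rw [hdeg]
  refine MvPolynomial.totalDegree_finsetSum_le fun I _ => ?_
  refine (MvPolynomial.totalDegree_mul _ _).trans ?_
  rw [MvPolynomial.totalDegree_C, zero_add]
  refine (MvPolynomial.totalDegree_pow _ _).trans ?_
  refine (Nat.mul_le_mul_left (q - 1) ?_).trans (mul_one _).le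
  refine (MvPolynomial.totalDegree_add _ _).trans (max_le ?_ (by simp))
  exact MvPolynomial.totalDegree_finsetSum_le fun i _ => by simp

lemma fDegLE_Hfun {F : Type} [Field F] {p : ℕ} (hp : 0 < p) (P : MvPolynomial (Fin p) F)
    (m t : ℕ) (e : Fin t → ℕ) :
    fDegLE (Hfun P (m * p) t e) (m * P.totalDegree + ∑ j, e j) := by
  refine ⟨(∏ i : Fin m, MvPolynomial.rename
    (fun l => Fin.castAdd t (finProdFinEquiv (i, l))) P) *
      ∏ j, MvPolynomial.X (Fin.natAdd (m * p) j) ^ e j, ?_, fun x => ?_⟩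
  · refine (MvPolynomial.totalDegree_mul _ _).trans (add_le_add ?_ ?_)
    · refine (MvPolynomial.totalDegree_finsetProd _ _).trans ?_
      refine (sum_le_sum fun i _ => MvPolynomial.totalDegree_rename_le _ P).trans ?_
      simp
    · refine (MvPolynomial.totalDegree_finsetProd _ _).trans (sum_le_sum fun j _ => ?_)
      simp
  · simp [Hfun_eq hp, MvPolynomial.eval_rename, Function.comp_def]

lemma ip_eq_zero_of_fDegLE {F : Type} [Field F] [Fintype F] {N a b : ℕ}
    {u v : (Fin N → F) → F} (hu : fDegLE u a) (hv : fDegLE v b)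
    (hab : a + b < (Fintype.card F - 1) * N) : ip u v = 0 := by
  obtain ⟨U, hU, hUu⟩ := hu
  obtain ⟨V, hV, hVv⟩ := hv
  have h := MvPolynomial.sum_eval_eq_zero (U * V) (by
    rw [Fintype.card_fin]
    have := MvPolynomial.totalDegree_mul U V
    omega)
  simpa [ip, hUu, hVv] using h

/-! ### Extracting a canonical monomial -/

lemma exists_reduced_monomial_of_not_fDegLE {F : Type} [Field F] [Fintype F] {n d : ℕ}
    {f : (Fin n → F) → F} (hf : ¬ fDegLE f d) :
    ∃ Q : MvPolynomial (Fin n) F, (∀ x, MvPolynomial.eval x Q = f x) ∧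
      (∀ b ∈ Q.support, ∀ i, b i ≤ Fintype.card F - 1) ∧ ∃ a ∈ Q.support, d < ∑ i, a i := by
  have hmem : f ∈ (MvPolynomial.restrictDegree (Fin n) F (Fintype.card F - 1)).map
      (MvPolynomial.evalₗ F (Fin n)) := by
    rw [MvPolynomial.map_restrict_dom_evalₗ]
    exact Submodule.mem_top
  obtain ⟨Q, hQ, hQf⟩ := hmem
  have hQf' : ∀ x, MvPolynomial.eval x Q = f x := fun x => congrFun hQf x
  refine ⟨Q, hQf', (MvPolynomial.mem_restrictDegree _ _ _).1 hQ, ?_⟩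
  by_contra! hcon
  refine hf ⟨Q, Finset.sup_le fun b hb => ?_, hQf'⟩
  rw [Finsupp.sum_fintype _ _ fun _ => rfl]
  exact hcon b hb

lemma prod_dite_pow_eq {M ι : Type*} [CommMonoid M] [Fintype ι] {N : ℕ} (g W : ι → ℕ)
    (z : Fin N → M) :
    ∏ α, (if h : g α < N then z ⟨g α, h⟩ else 1) ^ W α =
      ∏ j : Fin N, z j ^ ∑ α with g α = j, W α := by
  simp only [← prod_pow_eq_pow_sum, prod_filter]
  rw [prod_comm]
  refine prod_congr rfl fun α _ => ?_
  split_ifs with h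
  · rw [prod_eq_single_of_mem (⟨g α, h⟩ : Fin N) (mem_univ _)]
    · simp
    · exact fun j _ hj => if_neg fun h' => hj (Fin.ext h'.symm)
  · rw [one_pow, prod_eq_one]
    exact fun j _ => if_neg fun h' => h (by omega)

/-- From a function of degree more than `d` one obtains, as a linear combination of affine
restrictions, a monomial whose exponents fill the variables greedily up to capacity `Q`. -/
lemma exists_sum_affine_eq_monomial {F : Type} [Field F] [Fintype F] {p k n d : ℕ}
    (hp : p.Prime) (hcard : Fintype.card F = p ^ k) {f : (Fin n → F) → F}
    (hf : ¬ fDegLE f d) {Q : ℕ} (hQ : ∀ l < k, p ^ l ∣ Q) (N : ℕ) :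
    ∃ D, d < D ∧ ∃ (Λ : Type) (_ : Fintype Λ) (κ : Λ → F) (T : Λ → Aff F n N) (C : F), C ≠ 0 ∧
      ∀ z, ∑ l, κ l * f (affApp (T l) z) = C * ∏ j : Fin N, z j ^ min Q (D - j * Q) := by
  classical
  obtain ⟨R, hRf, hRdeg, a, ha, had⟩ := exists_reduced_monomial_of_not_fDegLE hf
  choose m w hw hws hwm using fun i => exists_prime_pow_parts hp (a i)
  let W : (Σ i, Fin (m i)) → ℕ := fun α => w α.1 α.2
  have hW1 : ∀ i α, 1 ≤ w i α := by
    intro i α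
    obtain ⟨l, hl⟩ := hw i α
    rw [hl]
    exact pow_pos hp.pos l
  have hWle : ∀ i α, w i α ≤ Fintype.card F - 1 := fun i α =>
    ((hws i) ▸ single_le_sum (f := w i) (fun _ _ => Nat.zero_le _) (mem_univ α)).trans
      (hRdeg a ha i)
  have hWchain : ∀ α β, W α ≤ W β → W α ∣ W β := by
    intro α β h
    obtain ⟨l, hl⟩ := hw α.1 α.2
    obtain ⟨l', hl'⟩ := hw β.1 β.2
    simp only [W, hl, hl'] at h ⊢
    exact pow_dvd_pow p ((Nat.pow_le_pow_iff_right hp.one_lt).1 h)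
  have hWQ : ∀ α, W α ∣ Q := by
    intro α
    obtain ⟨l, hl⟩ := hw α.1 α.2
    have h := hWle α.1 α.2
    have hpos := pow_pos hp.pos k
    simp only [W]
    rw [hl]
    rw [hl, hcard] at h
    exact hQ l ((Nat.pow_lt_pow_iff_right hp.one_lt).1 (by omega))
  have hWsum : ∑ α, W α = ∑ i, a i := by
    rw [Fintype.sum_sigma]
    exact sum_congr rfl fun i _ => hws i
  obtain ⟨g, hg, -⟩ := exists_bin_packing W hWchain Q hWQ N
  let y : (Fin N → F) → (Σ i, Fin (m i)) → F :=
    fun z α => if h : g α < N then z ⟨g α, h⟩ else 1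
  let T : (∀ i, Fin (m i) → F) → Aff F n N := fun l =>
    (Matrix.of fun i (j : Fin N) => ∑ α, if g ⟨i, α⟩ = j then l i α else 0,
      fun i => ∑ α, if g ⟨i, α⟩ < N then 0 else l i α)
  have hT : ∀ l z, affApp (T l) z = fun i => ∑ α, l i α * y z ⟨i, α⟩ := by
    intro l z
    funext i
    simp only [affApp, T, y, Matrix.mulVec, dotProduct, Pi.add_apply, Matrix.of_apply, sum_mul]
    rw [sum_comm, ← sum_add_distrib]
    refine sum_congr rfl fun α _ => ?_
    split_ifs with h
    · rw [sum_eq_single_of_mem (⟨g ⟨i, α⟩, h⟩ : Fin N) (mem_univ _)]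
      · simp
      · intro j _ hj
        rw [if_neg fun h' => hj (Fin.ext h'.symm), zero_mul]
    · rw [sum_eq_zero, mul_one, zero_add]
      intro j _
      rw [if_neg fun h' => h (by omega), zero_mul]
  refine ⟨∑ i, a i, had, ∀ i, Fin (m i) → F, inferInstance,
    fun l => ∏ i, ∏ α, l i α ^ (Fintype.card F - 1 - w i α), T,
    R.coeff a * ∏ i, ((-1) ^ m i * (Nat.multinomial univ (w i) : F)), ?_, fun z => ?_⟩
  · refine mul_ne_zero (MvPolynomial.mem_support_iff.1 ha) (prod_ne_zero_iff.2 fun i _ => ?_)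
    exact mul_ne_zero (by simp) (natCast_ne_zero_of_not_dvd hp hcard (hwm i))
  have hfactor : ∀ b ∈ R.support, ∀ i, ∑ l : Fin (m i) → F,
      (∏ α, l α ^ (Fintype.card F - 1 - w i α)) * (∑ α, l α * y z ⟨i, α⟩) ^ b i =
        if a i = b i then (-1) ^ m i * (Nat.multinomial univ (w i) : F) *
          ∏ α, y z ⟨i, α⟩ ^ w i α else 0 := by
    intro b hb i
    rw [sum_torus_mul_pow (hWle i) (hRdeg b hb i) ?_ fun α => y z ⟨i, α⟩, hws, Fintype.card_fin]
    intro c _ hc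
    obtain ⟨α, hα⟩ := Function.ne_iff.1 hc
    exact ⟨α, hW1 i α, hα⟩
  calc ∑ l : ∀ i, Fin (m i) → F, (∏ i, ∏ α, l i α ^ (Fintype.card F - 1 - w i α)) *
        f (affApp (T l) z)
      = ∑ b ∈ R.support, R.coeff b * ∏ i, ∑ l : Fin (m i) → F,
          (∏ α, l α ^ (Fintype.card F - 1 - w i α)) * (∑ α, l α * y z ⟨i, α⟩) ^ b i := by
        simp only [hT, ← hRf, MvPolynomial.eval_eq', mul_sum]
        rw [sum_comm]
        refine sum_congr rfl fun b _ => ?_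
        rw [Fintype.prod_sum, mul_sum]
        refine sum_congr rfl fun l _ => ?_
        rw [prod_mul_distrib]
        ring
    _ = R.coeff a * ∏ i, ((-1) ^ m i * (Nat.multinomial univ (w i) : F) *
          ∏ α, y z ⟨i, α⟩ ^ w i α) := by
        rw [sum_eq_single_of_mem a ha]
        · rw [prod_congr rfl fun i _ => (hfactor a ha i).trans (if_pos rfl)]
        · intro b hb hba
          obtain ⟨i, hi⟩ := DFunLike.ne_iff.1 hba
          rw [prod_eq_zero (mem_univ i) ((hfactor b hb i).trans (if_neg (Ne.symm hi))), mul_zero]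
    _ = _ := by
        have hz : ∏ i, ∏ α, y z ⟨i, α⟩ ^ w i α =
            ∏ j : Fin N, z j ^ min Q (∑ i, a i - j * Q) := by
          rw [← hWsum]
          refine (Fintype.prod_sigma fun α => y z α ^ W α).symm.trans ?_
          refine (prod_dite_pow_eq g W z).trans (prod_congr rfl fun j _ => ?_)
          rw [hg j j.2]
        rw [prod_mul_distrib, hz, mul_assoc]


/-! ### Perfect completeness and soundness -/

lemma sum_min_sub_mul (Q E t : ℕ) :
    ∑ j ∈ range t, min Q (E - j * Q) = min (t * Q) E := by
  induction t with
  | zero => simp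
  | succ t ih =>
    rw [sum_range_succ, ih, add_mul, one_mul]
    omega

/-- A function `f : F_q^n → F_q` passes the sparse `(s+t)`-flat test with
probability 1 (i.e. `⟨f∘T, H_e⟩ = 0` for every affine `T` and every valid `e`) iff
`f` has degree at most `d`. -/
theorem sparse_test_prob_one_iff_degree_le
    (p k : ℕ) (hp : p.Prime) (hk : 1 ≤ k)
    (F : Type) [Field F] [Fintype F]
    (q : ℕ) (hq : q = p ^ k) (hcard : Fintype.card F = q)
    (d s r : ℕ) (hsp : p ∣ s) (hr0 : 0 < r) (hr1 : r ≤ p * (q - q / p))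
    (hd : d + 1 = s * (q - q / p) + r)
    (t : ℕ) (ht : t = max (p + 2) 10)
    (P : MvPolynomial (Fin p) F) (hP : Pdef p q hp.pos P)
    (n : ℕ) (hn : s + t ≤ n) (f : (Fin n → F) → F) :
    (∀ T : Aff F n (s + t), ∀ e : Fin t → ℕ, validE q r t e →
        ip (fun x => f (affApp T x)) (Hfun P s t e) = 0) ↔ fDegLE f d := by
  obtain ⟨m, rfl⟩ := hsp
  rw [mul_comm p m] at *
  have htp : p + 2 ≤ t := ht ▸ le_max_left _ _
  obtain ⟨k, rfl⟩ : ∃ k', k = k' + 1 := ⟨k - 1, (Nat.sub_add_cancel hk).symm⟩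
  have hdiv : q / p = p ^ k := by rw [hq, pow_succ, Nat.mul_div_cancel _ hp.pos]
  have hqp : q = p * (q / p) := by rw [hdiv, hq, pow_succ, mul_comm]
  have hu : 1 ≤ q / p := hdiv ▸ Nat.one_le_pow _ _ hp.pos
  have hpq : p ≤ q := hqp ▸ Nat.le_mul_of_pos_right p hu
  have hQ : p * (q - q / p) + (q - p) = p * (q - 1) := by
    have h1 : p ≤ p * q := Nat.le_mul_of_pos_right p (hp.pos.trans_le hpq)
    rw [Nat.mul_sub, Nat.mul_sub, ← hqp]
    have h2 : q ≤ p * q := Nat.le_mul_of_pos_left q hp.pos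
    omega
  have hrt : r ≤ t * (q - q / p) :=
    hr1.trans (Nat.mul_le_mul_right _ (by omega))
  have hQ1 : q - q / p ≤ q - 1 := by omega
  have hrq : r ≤ t * (q - 1) := hrt.trans (Nat.mul_le_mul_left _ hQ1)
  refine ⟨fun h => ?_, fun hf T e he => ?_⟩
  · by_contra hf
    have hdvd : ∀ l < k + 1, p ^ l ∣ q - q / p := fun l hl =>
      Nat.dvd_sub (hq ▸ pow_dvd_pow p hl.le) (hdiv ▸ pow_dvd_pow p (Nat.le_of_lt_succ hl))
    obtain ⟨D, hD, Λ, _, κ, T, C, hC, hT⟩ :=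
      exists_sum_affine_eq_monomial hp (hcard.trans hq) hf hdvd (m * p + t)
    set Q := q - q / p
    let b : Fin (m * p + t) → ℕ := fun j => min Q (D - j * Q)
    have hb : ∀ j : Fin t, b (Fin.natAdd (m * p) j) = min Q (D - m * p * Q - j * Q) := fun j => by
      simp only [b, Fin.val_natAdd, add_mul, Nat.sub_sub]
    have hbq : ∀ j, b j ≤ q - 1 := fun j => (min_le_left _ _).trans hQ1
    have hval : validE q r t fun j => q - 1 - b (Fin.natAdd (m * p) j) := by
      refine ⟨fun j => Nat.sub_le _ _, ?_⟩
      have h1 : ∑ j : Fin t, (q - 1 - b (Fin.natAdd (m * p) j)) +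
          ∑ j : Fin t, b (Fin.natAdd (m * p) j) = t * (q - 1) := by
        rw [← sum_add_distrib, sum_congr rfl fun j _ => Nat.sub_add_cancel (hbq _)]
        simp
      have h2 : ∑ j : Fin t, b (Fin.natAdd (m * p) j) = min (t * Q) (D - m * p * Q) := by
        rw [← sum_min_sub_mul, sum_range]
        exact sum_congr rfl fun j _ => hb j
      beta_reduce
      omega
    refine mul_ne_zero hC (sum_canonical_monomial_mul_Hfun_ne_zero hp hk hq hcard hP m t _ b
      (fun i => min_eq_left ?_) fun j => Nat.add_sub_cancel' (hbq _)) ?_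
    · have h1 : ((i : ℕ) + 1) * Q ≤ m * p * Q := Nat.mul_le_mul_right _ i.2
      rw [add_mul, one_mul] at h1
      simp only [Fin.val_castAdd]
      omega
    · have h1 : ∑ l, κ l * ip (fun x => f (affApp (T l) x)) (Hfun P (m * p) t _) = 0 :=
        sum_eq_zero fun l _ => by rw [h (T l) _ hval, mul_zero]
      rw [← h1, mul_sum]
      simp only [ip, mul_sum, ← mul_assoc]
      rw [sum_comm]
      refine sum_congr rfl fun z _ => ?_
      rw [← sum_mul, hT]
  · refine ip_eq_zero_of_fDegLE (hf.comp_affApp T) (fDegLE_Hfun hp.pos P m t e) ?_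
    have hdeg := hP.totalDegree_add_le hpq
    have he2 := he.2
    have h1 : m * P.totalDegree ≤ m * (q - p) := Nat.mul_le_mul_left _ (by
      have := hp.pos
      omega)
    have h2 := congrArg (m * ·) hQ
    simp only [mul_add, ← mul_assoc] at h2
    rw [hcard, mul_comm (q - 1), add_mul]
    omega

end
end

section
/- Let ξ ∈ [0,1], δ ≥ 0, ℓ ≥ 1, n ≥ 1, and let A be a nonempty set of ℓ-flats in F_q^{n+ℓ} satisfying: (1) μ(A) ≤ ξ; (2) for every affine hyperplane W ⊆ F_q^{n+ℓ}, the density of A among the ℓ-flats contained in W is at most ξ; (3) for every linear hyperplane W₀ ⊆ F_q^{n+ℓ}, the density of A among the ℓ-flats whose direction is contained in W₀ is at most ξ; (4) for every nonzero v ∈ F_q^{n+ℓ}, the density of A among the ℓ-flats whose direction contains v is at most ξ; and (5) 1 − Φ(A) ≥ 1/q − δ, where Φ is edge expansion in AffGras(n+ℓ, ℓ). Then there exists a point x ∈ F_q^{n+ℓ} such that the density of A among the ℓ-flats containing x is at least 1 − q²·(4·q^{−ℓ} + 867·ξ^{1/4} + δ/(q−1)). -/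
noncomputable section

open Finset

section Fourier

open scoped Classical

variable {F : Type} [Field F] {m N : ℕ}

/-- The value at `α` of the linear map `F^m → F^N` with columns `T`. -/
def linEval (T : Fin m → Fin N → F) (α : Fin m → F) : Fin N → F := ∑ i, α i • T i

/-- The standard bilinear pairing of families of vectors. -/
def famPair (R T : Fin m → Fin N → F) : F := ∑ i, dotProduct (R i) (T i)

/-- The rank one family `α ⊗ b`. -/
def tens (α : Fin m → F) (b : Fin N → F) : Fin m → Fin N → F := fun i => α i • b

lemma linEval_add_tens (T : Fin m → Fin N → F) (τ α : Fin m → F) (u : Fin N → F) :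
    linEval (T + tens τ u) α = linEval T α + dotProduct τ α • u := by
  simp only [linEval, tens, Pi.add_apply, smul_add, Finset.sum_add_distrib, dotProduct,
    Finset.sum_smul, smul_smul]
  congr 1
  exact Finset.sum_congr rfl fun i _ => by rw [mul_comm]

lemma linEval_sub (T : Fin m → Fin N → F) (α β : Fin m → F) :
    linEval T (α - β) = linEval T α - linEval T β := by
  simp [linEval, sub_smul, Finset.sum_sub_distrib]

lemma linEval_smul (T : Fin m → Fin N → F) (c : F) (α : Fin m → F) :
    linEval T (c • α) = c • linEval T α := by
  simp [linEval, smul_smul, Finset.smul_sum]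

lemma linEval_zero (T : Fin m → Fin N → F) : linEval T 0 = 0 := by
  simp [linEval]

lemma linEval_tens (α : Fin m → F) (b : Fin N → F) (a : Fin m → F) :
    linEval (tens α b) a = dotProduct a α • b := by
  simp [linEval, tens, dotProduct, Finset.sum_smul, smul_smul]

lemma famPair_tens_left (α : Fin m → F) (b : Fin N → F) (T : Fin m → Fin N → F) :
    famPair (tens α b) T = dotProduct b (linEval T α) := by
  simp [famPair, tens, linEval, smul_dotProduct, dotProduct_sum, dotProduct_smul]

lemma famPair_comm (R T : Fin m → Fin N → F) : famPair R T = famPair T R := by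
  simp [famPair, dotProduct_comm]

lemma famPair_tens_right (R : Fin m → Fin N → F) (a : Fin m → F) (u : Fin N → F) :
    famPair R (tens a u) = dotProduct (linEval R a) u := by
  rw [famPair_comm, famPair_tens_left, dotProduct_comm]

lemma famPair_sub_left (R T T' : Fin m → Fin N → F) :
    famPair (T - T') R = famPair T R - famPair T' R := by
  simp [famPair, sub_dotProduct, Finset.sum_sub_distrib]

lemma famPair_add_left (R T T' : Fin m → Fin N → F) :
    famPair (T + T') R = famPair T R + famPair T' R := by
  simp [famPair, add_dotProduct, Finset.sum_add_distrib]

lemma char_sum_eq_prod {ι : Type} (ψ : AddChar F ℂ) (s : Finset ι) (g : ι → F) :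
    ψ (∑ i ∈ s, g i) = ∏ i ∈ s, ψ (g i) := by
  induction s using Finset.induction_on with
  | empty => simp
  | insert a s ha ih => rw [Finset.sum_insert ha, Finset.prod_insert ha, AddChar.map_add_eq_mul, ih]

variable [Fintype F]

/-- The Fourier coefficient of `f` at `R`. -/
def coef (ψ : AddChar F ℂ) (f : (Fin m → Fin N → F) → ℝ) (R : Fin m → Fin N → F) : ℂ :=
  (Fintype.card (Fin m → Fin N → F) : ℂ)⁻¹ * ∑ T, (f T : ℂ) * ψ (-famPair R T)

lemma sum_char_dot {ψ : AddChar F ℂ} (hψ : ψ.IsPrimitive) (r : Fin N → F) :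
    ∑ x : Fin N → F, ψ (dotProduct r x) = if r = 0 then (Fintype.card F : ℂ) ^ N else 0 := by
  have h1 : ∀ x : Fin N → F, ψ (dotProduct r x) = ∏ i, ψ (x i * r i) := fun x => by
    rw [dotProduct, char_sum_eq_prod]
    exact Finset.prod_congr rfl fun i _ => by rw [mul_comm]
  have h2 := Finset.prod_univ_sum (fun _ : Fin N => (Finset.univ : Finset F))
    (fun i y => ψ (y * r i))
  rw [Fintype.piFinset_univ] at h2
  simp_rw [h1]
  rw [← h2]
  simp_rw [AddChar.sum_mulShift _ hψ]
  split_ifs with h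
  · simp [h]
  · obtain ⟨i, hi⟩ := Function.ne_iff.mp h
    exact Finset.prod_eq_zero (Finset.mem_univ i) (by simpa using hi)

lemma sum_char_famPair {ψ : AddChar F ℂ} (hψ : ψ.IsPrimitive) (R : Fin m → Fin N → F) :
    ∑ T : Fin m → Fin N → F, ψ (famPair R T) =
      if R = 0 then (Fintype.card (Fin m → Fin N → F) : ℂ) else 0 := by
  have h1 : ∀ T : Fin m → Fin N → F, ψ (famPair R T) = ∏ i, ψ (dotProduct (R i) (T i)) :=
    fun x => by rw [famPair, char_sum_eq_prod]
  have h2 := Finset.prod_univ_sum (fun _ : Fin m => (Finset.univ : Finset (Fin N → F)))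
    (fun i y => ψ (dotProduct (R i) y))
  rw [Fintype.piFinset_univ] at h2
  simp_rw [h1]
  rw [← h2]
  simp_rw [sum_char_dot hψ]
  split_ifs with h
  · simp [h]
  · obtain ⟨i, hi⟩ := Function.ne_iff.mp h
    exact Finset.prod_eq_zero (Finset.mem_univ i) (by simpa using hi)

lemma conj_char (ψ : AddChar F ℂ) (x : F) : (starRingEnd ℂ) (ψ x) = ψ (-x) :=
  (AddChar.map_neg_eq_conj ψ x).symm

lemma sum_coef_sq_correlation {ψ : AddChar F ℂ} (hψ : ψ.IsPrimitive)
    (f : (Fin m → Fin N → F) → ℝ) (a : Fin m → F) :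
    ∑ R : Fin m → Fin N → F, (if linEval R a = 0 then ‖coef ψ f R‖ ^ 2 else 0) =
      ((Fintype.card (Fin m → Fin N → F) : ℝ) * (Fintype.card F : ℝ) ^ N)⁻¹ *
        ∑ T, ∑ u : Fin N → F, f T * f (T + tens a u) := by
  have hG : (Fintype.card (Fin m → Fin N → F) : ℂ) ≠ 0 := Nat.cast_ne_zero.mpr Fintype.card_ne_zero
  have hq : (Fintype.card F : ℂ) ≠ 0 := Nat.cast_ne_zero.mpr Fintype.card_ne_zero
  set g := (Fintype.card (Fin m → Fin N → F) : ℂ) with hg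
  set q := (Fintype.card F : ℂ) with hqd
  have key : ∀ R : Fin m → Fin N → F,
      (((if linEval R a = 0 then ‖coef ψ f R‖ ^ 2 else 0 : ℝ)) : ℂ) =
      (g * q ^ N)⁻¹ * g⁻¹ * ∑ u : Fin N → F, ∑ T, ∑ T', (f T : ℂ) * f T' *
        ψ (famPair (T' + tens a u - T) R) := by
    intro R
    have e1 : ((‖coef ψ f R‖ ^ 2 : ℝ) : ℂ) = g⁻¹ * g⁻¹ * ∑ T, ∑ T', (f T : ℂ) * f T' *
        ψ (famPair (T' - T) R) := by
      push_cast
      rw [← Complex.mul_conj', coef, map_mul, map_sum]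
      have : ((starRingEnd ℂ) g⁻¹) = g⁻¹ := by rw [hg]; simp
      rw [this]
      simp only [map_mul, Complex.conj_ofReal, conj_char, neg_neg]
      rw [mul_mul_mul_comm, Finset.sum_mul_sum]
      congr 1
      refine Finset.sum_congr rfl fun T _ => Finset.sum_congr rfl fun T' _ => ?_
      rw [famPair_sub_left, famPair_comm T', famPair_comm T, sub_eq_neg_add,
        AddChar.map_add_eq_mul]
      ring
    have e2 : ∀ u : Fin N → F, (∑ T, ∑ T', (f T : ℂ) * f T' *
        ψ (famPair (T' + tens a u - T) R)) =
        ψ (dotProduct (linEval R a) u) * ∑ T, ∑ T', (f T : ℂ) * f T' *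
        ψ (famPair (T' - T) R) := by
      intro u
      rw [Finset.mul_sum]
      refine Finset.sum_congr rfl fun T _ => ?_
      rw [Finset.mul_sum]
      refine Finset.sum_congr rfl fun T' _ => ?_
      rw [add_sub_right_comm, famPair_add_left, AddChar.map_add_eq_mul, famPair_comm (tens a u),
        famPair_tens_right]
      ring
    simp_rw [e2]
    rw [← Finset.sum_mul, sum_char_dot hψ]
    split_ifs
    · rw [e1, ← hqd]; field_simp
    · simp
  have : ((∑ R : Fin m → Fin N → F, (if linEval R a = 0 then ‖coef ψ f R‖ ^ 2 else 0) : ℝ) : ℂ) =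
      ((((Fintype.card (Fin m → Fin N → F) : ℝ) * (Fintype.card F : ℝ) ^ N)⁻¹ *
        ∑ T, ∑ u : Fin N → F, f T * f (T + tens a u) : ℝ) : ℂ) := by
    rw [Complex.ofReal_sum]
    simp_rw [key]
    rw [← Finset.mul_sum, Finset.sum_comm]
    have e3 : ∀ u : Fin N → F, ∑ R : Fin m → Fin N → F, (∑ T, ∑ T', (f T : ℂ) * f T' *
        ψ (famPair (T' + tens a u - T) R)) = g * ∑ T', (f T' : ℂ) * f (T' + tens a u) := by
      intro u
      rw [Finset.sum_comm, Finset.mul_sum]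
      rw [Finset.sum_congr rfl fun T _ => Finset.sum_comm]
      rw [Finset.sum_comm]
      refine Finset.sum_congr rfl fun T' _ => ?_
      simp_rw [← Finset.mul_sum, sum_char_famPair hψ, sub_eq_zero]
      rw [Finset.sum_eq_single (T' + tens a u)]
      · simp [hg]; ring
      · intro b _ hb; simp [hb.symm]
      · simp
    simp_rw [e3]
    rw [← Finset.mul_sum, Finset.sum_comm]
    push_cast
    rw [← hg, ← hqd]
    field_simp
  exact_mod_cast this

/-- Parseval inequality with multiplicities. -/
lemma sum_norm_sq_char_le {ψ : AddChar F ℂ} (hψ : ψ.IsPrimitive) {I : Type} (s : Finset I)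
    (S : I → Fin m → Fin N → F) (d : I → ℂ) (r : I → ℝ)
    (hr : ∀ i ∈ s, ((s.filter fun j => S j = S i).card : ℝ) ≤ r i) :
    ∑ T : Fin m → Fin N → F, ‖∑ i ∈ s, d i * ψ (famPair (S i) T)‖ ^ 2 ≤
      (Fintype.card (Fin m → Fin N → F) : ℝ) * ∑ i ∈ s, ‖d i‖ ^ 2 * r i := by
  have key : ∑ T : Fin m → Fin N → F, ‖∑ i ∈ s, d i * ψ (famPair (S i) T)‖ ^ 2 =
      (Fintype.card (Fin m → Fin N → F) : ℝ) *
        ∑ i ∈ s, ∑ j ∈ s, if S j = S i then (d i * (starRingEnd ℂ) (d j)).re else 0 := by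
    have h1 : ∀ T : Fin m → Fin N → F, ((‖∑ i ∈ s, d i * ψ (famPair (S i) T)‖ ^ 2 : ℝ) : ℂ) =
        ∑ i ∈ s, ∑ j ∈ s, d i * (starRingEnd ℂ) (d j) * ψ (famPair (S i - S j) T) := by
      intro T
      push_cast
      rw [← Complex.mul_conj', map_sum, Finset.sum_mul_sum]
      refine Finset.sum_congr rfl fun i _ => Finset.sum_congr rfl fun j _ => ?_
      rw [map_mul, conj_char, famPair_sub_left, sub_eq_add_neg, AddChar.map_add_eq_mul]
      ring
    have h2 : ((∑ T : Fin m → Fin N → F, ‖∑ i ∈ s, d i * ψ (famPair (S i) T)‖ ^ 2 : ℝ) : ℂ) =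
        (Fintype.card (Fin m → Fin N → F) : ℂ) *
        ∑ i ∈ s, ∑ j ∈ s, if S j = S i then (d i * (starRingEnd ℂ) (d j)) else 0 := by
      rw [Complex.ofReal_sum]
      simp_rw [h1]
      rw [Finset.sum_comm, Finset.mul_sum]
      refine Finset.sum_congr rfl fun i _ => ?_
      rw [Finset.sum_comm, Finset.mul_sum]
      refine Finset.sum_congr rfl fun j _ => ?_
      rw [← Finset.mul_sum, sum_char_famPair hψ]
      by_cases h : S j = S i
      · simp [h]; ring
      · have : S i - S j ≠ 0 := fun e => h (sub_eq_zero.mp e).symm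
        simp [h, this]
    have h3 := congrArg Complex.re h2
    rw [Complex.ofReal_re] at h3
    rw [h3, ← Complex.ofReal_natCast, Complex.re_ofReal_mul, Complex.re_sum]
    congr 1
    refine Finset.sum_congr rfl fun i _ => ?_
    rw [Complex.re_sum]
    refine Finset.sum_congr rfl fun j _ => ?_
    split_ifs <;> simp
  rw [key]
  refine mul_le_mul_of_nonneg_left ?_ (Nat.cast_nonneg _)
  have h4 : ∀ i ∈ s, ∀ j ∈ s, (if S j = S i then (d i * (starRingEnd ℂ) (d j)).re else 0) ≤
      (if S j = S i then ‖d i‖ ^ 2 / 2 else 0) + (if S j = S i then ‖d j‖ ^ 2 / 2 else 0) := by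
    intro i _ j _
    split_ifs
    · refine (Complex.re_le_norm _).trans ?_
      rw [norm_mul, Complex.norm_conj]
      nlinarith [sq_nonneg (‖d i‖ - ‖d j‖)]
    · simp
  refine (Finset.sum_le_sum fun i hi => Finset.sum_le_sum fun j hj => h4 i hi j hj).trans ?_
  simp_rw [Finset.sum_add_distrib]
  have h5 : ∑ i ∈ s, ∑ j ∈ s, (if S j = S i then ‖d j‖ ^ 2 / 2 else 0) =
      ∑ i ∈ s, ∑ j ∈ s, (if S j = S i then ‖d i‖ ^ 2 / 2 else 0) := by
    rw [Finset.sum_comm]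
    simp_rw [eq_comm]
  rw [h5, ← Finset.sum_add_distrib]
  refine Finset.sum_le_sum fun i hi => ?_
  rw [← Finset.sum_add_distrib, ← Finset.sum_filter_add_sum_filter_not s (fun j => S j = S i)]
  rw [Finset.sum_congr rfl (g := fun _ => ‖d i‖ ^ 2), Finset.sum_eq_zero
    (s := s.filter fun j => ¬ S j = S i)]
  · rw [Finset.sum_const, nsmul_eq_mul, add_zero, mul_comm]
    exact mul_le_mul_of_nonneg_left (hr i hi) (sq_nonneg _)
  · intro j hj
    simp [(Finset.mem_filter.mp hj).2]
  · intro j hj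
    simp [(Finset.mem_filter.mp hj).2]

end Fourier

section LevelOne

open scoped Classical

variable {F : Type} [Field F] [Fintype F] {m N : ℕ}

/-- The mean of `f`. -/
def famMean (f : (Fin m → Fin N → F) → ℝ) : ℝ :=
  (Fintype.card (Fin m → Fin N → F) : ℝ)⁻¹ * ∑ T, f T

/-- The mean of `f` conditioned on `T α = z`, for `α ≠ 0`. -/
def famCond (f : (Fin m → Fin N → F) → ℝ) (α : Fin m → F) (z : Fin N → F) : ℝ :=
  (Fintype.card F : ℝ) ^ N * (Fintype.card (Fin m → Fin N → F) : ℝ)⁻¹ *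
    ∑ T, if linEval T α = z then f T else 0

/-- The level one Fourier weight of `f` on rank one families supported on `P`. -/
def levelOneWeight (ψ : AddChar F ℂ) (f : (Fin m → Fin N → F) → ℝ)
    (P : Finset (Fin m → F)) : ℝ :=
  ∑ α ∈ P, ∑ b : Fin N → F, if b = 0 then 0 else ‖coef ψ f (tens α b)‖ ^ 2

lemma coef_zero (ψ : AddChar F ℂ) (f : (Fin m → Fin N → F) → ℝ) :
    coef ψ f 0 = (famMean f : ℂ) := by
  have : ∀ T : Fin m → Fin N → F, famPair 0 T = 0 := fun T => by simp [famPair]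
  simp [coef, famMean, this]

omit [Fintype F] in
lemma tens_zero (α : Fin m → F) : tens α (0 : Fin N → F) = 0 := by
  ext i j; simp [tens]

lemma famCond_eq_sum {ψ : AddChar F ℂ} (hψ : ψ.IsPrimitive)
    (f : (Fin m → Fin N → F) → ℝ) (α : Fin m → F) (z : Fin N → F) :
    (famCond f α z : ℂ) = ∑ b : Fin N → F, coef ψ f (tens α b) * ψ (dotProduct b z) := by
  simp_rw [coef, famPair_tens_left, mul_assoc, ← Finset.mul_sum, Finset.sum_mul]
  rw [Finset.sum_comm]
  have : ∀ T : Fin m → Fin N → F, ∑ b : Fin N → F,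
      (f T : ℂ) * ψ (-dotProduct b (linEval T α)) * ψ (dotProduct b z) =
      f T * if linEval T α = z then (Fintype.card F : ℂ) ^ N else 0 := by
    intro T
    have h : ∀ b : Fin N → F,
        (f T : ℂ) * ψ (-dotProduct b (linEval T α)) * ψ (dotProduct b z) =
        f T * ψ (dotProduct (z - linEval T α) b) := fun b => by
      rw [mul_assoc, ← AddChar.map_add_eq_mul, dotProduct_comm, sub_dotProduct,
        dotProduct_comm b z, sub_eq_neg_add]
    simp_rw [h]
    rw [← Finset.mul_sum, sum_char_dot hψ]
    simp_rw [sub_eq_zero, eq_comm]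
  simp_rw [this, famCond]
  push_cast
  rw [mul_comm ((Fintype.card F : ℂ) ^ N), mul_assoc, Finset.mul_sum]
  congr 1
  refine Finset.sum_congr rfl fun T _ => ?_
  split_ifs <;> simp [mul_comm]

lemma famCond_sub_mean {ψ : AddChar F ℂ} (hψ : ψ.IsPrimitive)
    (f : (Fin m → Fin N → F) → ℝ) (α : Fin m → F) (z : Fin N → F) :
    ((famCond f α z - famMean f : ℝ) : ℂ) = ∑ b ∈ Finset.univ.filter (fun b : Fin N → F => b ≠ 0),
      coef ψ f (tens α b) * ψ (dotProduct b z) := by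
  rw [Complex.ofReal_sub, famCond_eq_sum hψ, Finset.filter_ne', ← Finset.add_sum_erase _ _
    (Finset.mem_univ 0), tens_zero, coef_zero, zero_dotProduct]
  simp

lemma sum_famCond_mul (f : (Fin m → Fin N → F) → ℝ) (α : Fin m → F) (h : (Fin N → F) → ℝ) :
    ∑ z, famCond f α z * h z = (Fintype.card F : ℝ) ^ N *
      (Fintype.card (Fin m → Fin N → F) : ℝ)⁻¹ * ∑ T, f T * h (linEval T α) := by
  simp_rw [famCond, mul_assoc, ← Finset.mul_sum, Finset.sum_mul]
  rw [Finset.sum_comm]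
  simp

lemma sum_famCond (f : (Fin m → Fin N → F) → ℝ) (α : Fin m → F) :
    ∑ z, famCond f α z = (Fintype.card F : ℝ) ^ N * famMean f := by
  have := sum_famCond_mul f α (fun _ => 1)
  simpa [famMean, mul_assoc] using this

lemma sum_famCond_sub_mean_sq {ψ : AddChar F ℂ} (hψ : ψ.IsPrimitive)
    (f : (Fin m → Fin N → F) → ℝ) (α : Fin m → F) :
    ∑ z, (famCond f α z - famMean f) ^ 2 = (Fintype.card F : ℝ) ^ N *
      ∑ b : Fin N → F, if b = 0 then 0 else ‖coef ψ f (tens α b)‖ ^ 2 := by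
  have h1 : ∀ b : Fin N → F, b ≠ 0 →
      ∑ z, ((famCond f α z - famMean f : ℝ) : ℂ) * ψ (dotProduct b z) =
        (Fintype.card F : ℂ) ^ N * (starRingEnd ℂ) (coef ψ f (tens α b)) := by
    intro b hb
    simp_rw [Complex.ofReal_sub, sub_mul, Finset.sum_sub_distrib]
    rw [← Finset.mul_sum _ _ (famMean f : ℂ), sum_char_dot hψ, if_neg hb, mul_zero, sub_zero]
    simp only [famCond, coef, map_mul, map_sum, conj_char, Complex.conj_ofReal, neg_neg,
      map_inv₀, map_natCast, famPair_tens_left]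
    push_cast
    simp_rw [mul_assoc, ← Finset.mul_sum, Finset.sum_mul]
    rw [Finset.sum_comm]
    congr 2
    refine Finset.sum_congr rfl fun T _ => ?_
    rw [Finset.sum_eq_single (linEval T α)]
    · simp
    · intro z _ hz; simp [hz.symm]
    · simp
  have h2 : ((∑ z, (famCond f α z - famMean f) ^ 2 : ℝ) : ℂ) = (((Fintype.card F : ℝ) ^ N *
      ∑ b : Fin N → F, (if b = 0 then 0 else ‖coef ψ f (tens α b)‖ ^ 2) : ℝ) : ℂ) := by
    rw [Complex.ofReal_sum]
    have : ∀ z, (((famCond f α z - famMean f) ^ 2 : ℝ) : ℂ) =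
        ∑ b ∈ Finset.univ.filter (fun b : Fin N → F => b ≠ 0),
      coef ψ f (tens α b) * (((famCond f α z - famMean f : ℝ) : ℂ) * ψ (dotProduct b z)) := by
      intro z
      rw [Complex.ofReal_pow, sq]
      nth_rewrite 2 [famCond_sub_mean hψ]
      rw [Finset.mul_sum]
      exact Finset.sum_congr rfl fun _ _ => by ring
    simp_rw [this]
    rw [Finset.sum_comm]
    simp_rw [← Finset.mul_sum]
    rw [Finset.sum_congr rfl fun b hb => by rw [h1 b (Finset.mem_filter.mp hb).2]]
    rw [Complex.ofReal_mul, Complex.ofReal_sum, Finset.mul_sum, Finset.sum_filter]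
    push_cast
    refine Finset.sum_congr rfl fun b _ => ?_
    by_cases hb : b = 0
    · simp [hb]
    · simp [hb, ← Complex.mul_conj']; ring
  exact_mod_cast h2

lemma sum_sum_famCond_sub_mean_sq {ψ : AddChar F ℂ} (hψ : ψ.IsPrimitive)
    (f : (Fin m → Fin N → F) → ℝ) (P : Finset (Fin m → F)) :
    ∑ α ∈ P, ∑ z, (famCond f α z - famMean f) ^ 2 =
      (Fintype.card F : ℝ) ^ N * levelOneWeight ψ f P := by
  simp_rw [sum_famCond_sub_mean_sq hψ, levelOneWeight, Finset.mul_sum]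

lemma sum_mul_levelOne {ψ : AddChar F ℂ} (hψ : ψ.IsPrimitive)
    (f : (Fin m → Fin N → F) → ℝ) (P : Finset (Fin m → F)) :
    ∑ T, f T * ∑ α ∈ P, (famCond f α (linEval T α) - famMean f) =
      (Fintype.card (Fin m → Fin N → F) : ℝ) * levelOneWeight ψ f P := by
  have hG : (Fintype.card (Fin m → Fin N → F) : ℝ) ≠ 0 := Nat.cast_ne_zero.mpr Fintype.card_ne_zero
  have hq : (Fintype.card F : ℝ) ≠ 0 := Nat.cast_ne_zero.mpr Fintype.card_ne_zero
  simp_rw [Finset.mul_sum]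
  rw [Finset.sum_comm]
  have h : ∀ α, ∑ T, f T * (famCond f α (linEval T α) - famMean f) =
      (Fintype.card (Fin m → Fin N → F) : ℝ) * ((Fintype.card F : ℝ) ^ N)⁻¹ *
        ∑ z, (famCond f α z - famMean f) ^ 2 := by
    intro α
    have h1 := sum_famCond_mul f α (fun z => famCond f α z - famMean f)
    have h2 : ∑ z, (famCond f α z - famMean f) ^ 2 =
        ∑ z, famCond f α z * (famCond f α z - famMean f) := by
      have : ∀ z, (famCond f α z - famMean f) ^ 2 =
        famCond f α z * (famCond f α z - famMean f) -
          famMean f * (famCond f α z - famMean f) := fun z => by ring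
      simp_rw [this, Finset.sum_sub_distrib, ← Finset.mul_sum, Finset.sum_sub_distrib]
      rw [sum_famCond]
      simp
    rw [h2, h1]
    field_simp
  simp_rw [h]
  rw [← Finset.mul_sum, sum_sum_famCond_sub_mean_sq hψ]
  field_simp

lemma sum_mul_diag_le {ψ : AddChar F ℂ} (hψ : ψ.IsPrimitive)
    (f : (Fin m → Fin N → F) → ℝ) (P : Finset (Fin m → F)) {M : ℝ}
    (hM : ∀ α ∈ P, ∀ z, famCond f α z ≤ M) :
    ∑ T, f T * ∑ α ∈ P, (famCond f α (linEval T α) - famMean f) ^ 2 ≤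
      (Fintype.card (Fin m → Fin N → F) : ℝ) * (M * levelOneWeight ψ f P) := by
  have hG : (0 : ℝ) < (Fintype.card (Fin m → Fin N → F) : ℝ) :=
    Nat.cast_pos.mpr Fintype.card_pos
  have hq : (0 : ℝ) < (Fintype.card F : ℝ) := Nat.cast_pos.mpr Fintype.card_pos
  simp_rw [Finset.mul_sum]
  rw [Finset.sum_comm]
  have h : ∀ α ∈ P, ∑ T, f T * (famCond f α (linEval T α) - famMean f) ^ 2 ≤
      (Fintype.card (Fin m → Fin N → F) : ℝ) * ((Fintype.card F : ℝ) ^ N)⁻¹ * M *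
        ∑ z, (famCond f α z - famMean f) ^ 2 := by
    intro α hα
    have h1 := sum_famCond_mul f α (fun z => (famCond f α z - famMean f) ^ 2)
    have h2 : ∑ z, famCond f α z * (famCond f α z - famMean f) ^ 2 ≤
        M * ∑ z, (famCond f α z - famMean f) ^ 2 := by
      rw [Finset.mul_sum]
      exact Finset.sum_le_sum fun z _ => mul_le_mul_of_nonneg_right (hM α hα z) (sq_nonneg _)
    have h3 : ∑ T, f T * (famCond f α (linEval T α) - famMean f) ^ 2 =
        (Fintype.card (Fin m → Fin N → F) : ℝ) * ((Fintype.card F : ℝ) ^ N)⁻¹ *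
        ∑ z, famCond f α z * (famCond f α z - famMean f) ^ 2 := by
      rw [h1]; field_simp
    rw [h3, mul_assoc _ M]
    exact mul_le_mul_of_nonneg_left h2 (by positivity)
  refine (Finset.sum_le_sum h).trans (le_of_eq ?_)
  rw [← Finset.mul_sum, sum_sum_famCond_sub_mean_sq hψ]
  field_simp

end LevelOne

section Pairs

open scoped Classical

variable {F : Type} [Field F] {m N : ℕ}

/-- The vectors of `P` are nonzero and pairwise non-proportional. -/
def PairIndep (P : Finset (Fin m → F)) : Prop :=
  ∀ α ∈ P, ∀ β ∈ P, α ≠ β → LinearIndependent F ![α, β]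

lemma exists_dot_eq_of_linearIndependent {ι : Type} {v : ι → Fin m → F}
    (hv : LinearIndependent F v) (c : ι → F) : ∃ a : Fin m → F, ∀ i, dotProduct a (v i) = c i := by
  obtain ⟨φ, hφ⟩ := LinearMap.exists_extend ((Module.Basis.span hv).constr F c)
  refine ⟨fun i => φ (Pi.single i 1), fun i => ?_⟩
  have h1 : φ (v i) = c i := by
    have h2 := LinearMap.congr_fun hφ (Module.Basis.span hv i)
    rw [Module.Basis.constr_basis] at h2
    simpa [Module.Basis.span_apply] using h2
  rw [← h1, LinearMap.pi_apply_eq_sum_univ φ (v i)]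
  simp only [dotProduct, smul_eq_mul, mul_comm]
  refine Finset.sum_congr rfl fun j _ => ?_
  congr 2
  ext k
  simp [Pi.single_apply, eq_comm]

lemma exists_dot_pair {α β : Fin m → F} (h : LinearIndependent F ![α, β]) (x y : F) :
    ∃ a : Fin m → F, dotProduct a α = x ∧ dotProduct a β = y := by
  obtain ⟨a, ha⟩ := exists_dot_eq_of_linearIndependent h ![x, y]
  exact ⟨a, by simpa using ha 0, by simpa using ha 1⟩

lemma tens_injOn {P : Finset (Fin m → F)} (hP : PairIndep P) (hP0 : ∀ α ∈ P, α ≠ 0)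
    {α β : Fin m → F} (hα : α ∈ P) (hβ : β ∈ P) {b c : Fin N → F} (hb : b ≠ 0)
    (h : tens α b = tens β c) : α = β ∧ b = c := by
  have hev : ∀ a, dotProduct a α • b = dotProduct a β • c := fun a => by
    rw [← linEval_tens, ← linEval_tens, h]
  have hαβ : α = β := by
    by_contra hne
    obtain ⟨a, h1, h2⟩ := exists_dot_pair (hP α hα β hβ hne) 1 0
    have := hev a
    rw [h1, h2, one_smul, zero_smul] at this
    exact hb this
  subst hαβ
  refine ⟨rfl, ?_⟩
  obtain ⟨i, hi⟩ := Function.ne_iff.mp (hP0 α hα)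
  have h3 := congr_fun h i
  simp only [tens] at h3
  exact smul_right_injective _ (by simpa using hi) h3

lemma tens_add_eq_left {α β α' β' : Fin m → F} {b c b' c' : Fin N → F}
    (h' : LinearIndependent F ![α', β'])
    (h : tens α b + tens β c = tens α' b' + tens β' c') :
    ∃ x y : F, b' = x • b + y • c := by
  obtain ⟨a, h1, h2⟩ := exists_dot_pair h' 1 0
  have h3 := congr_arg (fun S => linEval S a) h
  have hadd : ∀ S S' : Fin m → Fin N → F, linEval (S + S') a = linEval S a + linEval S' a :=
    fun S S' => by simp [linEval, Finset.sum_add_distrib]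
  simp only [hadd, linEval_tens, h1, h2, one_smul, zero_smul, add_zero] at h3
  exact ⟨_, _, h3.symm⟩

lemma linearIndependent_pair_of_mem_span {b c b' c' : Fin N → F}
    (hbc : LinearIndependent F ![b, c]) (hb : ∃ x y : F, b = x • b' + y • c')
    (hc : ∃ x y : F, c = x • b' + y • c') : LinearIndependent F ![b', c'] := by
  rw [linearIndependent_iff_card_le_finrank_span] at hbc ⊢
  refine hbc.trans (Submodule.finrank_mono (Submodule.span_le.mpr ?_))
  simp only [Matrix.range_cons, Matrix.range_empty, Set.union_empty, Set.singleton_union]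
  rintro v (rfl | rfl)
  · obtain ⟨x, y, h⟩ := hb
    exact Submodule.mem_span_pair.mpr ⟨x, y, h.symm⟩
  · obtain ⟨x, y, h⟩ := hc
    exact Submodule.mem_span_pair.mpr ⟨x, y, h.symm⟩

lemma tens_add_eq_right {α β α' β' : Fin m → F} {b c b' c' : Fin N → F}
    (hαβ : LinearIndependent F ![α, β]) (hbc : LinearIndependent F ![b, c])
    (h : tens α b + tens β c = tens α' b' + tens β' c') :
    ∃ x y : F, α' = x • α + y • β := by
  have hbc' : LinearIndependent F ![b', c'] :=
    linearIndependent_pair_of_mem_span hbc (tens_add_eq_left hαβ h.symm)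
      (tens_add_eq_left (LinearIndependent.pair_symm_iff.mp hαβ)
        (by rw [add_comm (tens β c), h]))
  obtain ⟨d, h1, h2⟩ := exists_dot_pair hbc' 1 0
  refine ⟨dotProduct d b, dotProduct d c, ?_⟩
  funext i
  have h3 := congr_arg (fun v => dotProduct d v) (congr_fun h i)
  simp only [Pi.add_apply, tens, dotProduct_add, dotProduct_smul, h1, h2, smul_eq_mul, mul_one,
    mul_zero, add_zero] at h3
  simp only [Pi.add_apply, Pi.smul_apply, smul_eq_mul]
  rw [← h3]
  ring

end Pairs

section OffDiagonal

open scoped Classical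

variable {F : Type} [Field F] [Fintype F] {m N : ℕ}

/-- Pairs of nonzero rank one families with distinct left factors in `P`. -/
def tensOffDiag (N : ℕ) (P : Finset (Fin m → F)) :
    Finset (((Fin m → F) × (Fin N → F)) × ((Fin m → F) × (Fin N → F))) :=
  ((P ×ˢ univ.filter (· ≠ 0)) ×ˢ (P ×ˢ univ.filter (· ≠ 0))).filter fun i => i.1.1 ≠ i.2.1

lemma mem_tensOffDiag {P : Finset (Fin m → F)}
    {i : ((Fin m → F) × (Fin N → F)) × ((Fin m → F) × (Fin N → F))} :
    i ∈ tensOffDiag N P ↔ ((i.1.1 ∈ P ∧ i.1.2 ≠ 0) ∧ i.2.1 ∈ P ∧ i.2.2 ≠ 0) ∧ i.1.1 ≠ i.2.1 := by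
  simp [tensOffDiag]

lemma card_fiber_tensOffDiag_le {P : Finset (Fin m → F)} (hP : PairIndep P) (hP0 : ∀ α ∈ P, α ≠ 0)
    (i : ((Fin m → F) × (Fin N → F)) × ((Fin m → F) × (Fin N → F))) (hi : i ∈ tensOffDiag N P) :
    (((tensOffDiag N P).filter fun j => tens j.1.1 j.1.2 + tens j.2.1 j.2.2 =
      tens i.1.1 i.1.2 + tens i.2.1 i.2.2).card : ℝ) ≤
      (Fintype.card F : ℝ) ^ 4 +
        if ∃ c : F, i.2.2 = c • i.1.2 then (P.card : ℝ) * Fintype.card F else 0 := by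
  obtain ⟨⟨α, b⟩, ⟨β, c⟩⟩ := i
  rw [mem_tensOffDiag] at hi
  obtain ⟨⟨⟨hα, hb⟩, hβ, hc⟩, hne⟩ := hi
  simp only at hα hb hβ hc hne ⊢
  have hαβ := hP α hα β hβ hne
  set s := (tensOffDiag N P).filter fun j => tens j.1.1 j.1.2 + tens j.2.1 j.2.2 =
      tens α b + tens β c with hs
  have hmem : ∀ j ∈ s, ((j.1.1 ∈ P ∧ j.1.2 ≠ 0) ∧ j.2.1 ∈ P ∧ j.2.2 ≠ 0) ∧ j.1.1 ≠ j.2.1 ∧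
      tens j.1.1 j.1.2 + tens j.2.1 j.2.2 = tens α b + tens β c := by
    intro j hj
    rw [hs, Finset.mem_filter, mem_tensOffDiag] at hj
    exact ⟨hj.1.1, hj.1.2, hj.2⟩
  have hinj : Set.InjOn (fun j : ((Fin m → F) × (Fin N → F)) × ((Fin m → F) × (Fin N → F)) => j.1)
      s := by
    rintro ⟨⟨α₁, b₁⟩, ⟨β₁, c₁⟩⟩ hj ⟨⟨α₂, b₂⟩, ⟨β₂, c₂⟩⟩ hj' heq
    obtain ⟨⟨-, h1, h2⟩, -, h3⟩ := hmem _ hj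
    obtain ⟨⟨-, h1', h2'⟩, -, h3'⟩ := hmem _ hj'
    simp only [Prod.mk.injEq] at heq
    obtain ⟨rfl, rfl⟩ := heq
    simp only at h1 h2 h3 h1' h2' h3'
    have h4 : tens β₁ c₁ = tens β₂ c₂ := add_left_cancel (h3.trans h3'.symm)
    obtain ⟨rfl, rfl⟩ := tens_injOn hP hP0 h1 h1' h2 h4
    rfl
  have hleft : ∀ j ∈ s, ∃ x y : F, j.1.2 = x • b + y • c := by
    intro j hj
    obtain ⟨⟨⟨h1, -⟩, h2, -⟩, h3, h4⟩ := hmem _ hj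
    exact tens_add_eq_left (hP _ h1 _ h2 h3) h4.symm
  by_cases hbc : ∃ t : F, c = t • b
  · rw [if_pos hbc]
    obtain ⟨t, rfl⟩ := hbc
    have hle : s.card ≤ (P ×ˢ (univ.image fun x : F => x • b)).card := by
      refine Finset.card_le_card_of_injOn _ (fun j hj => ?_) hinj
      obtain ⟨x, y, hxy⟩ := hleft j hj
      refine Finset.mem_product.mpr ⟨(hmem _ hj).1.1.1, Finset.mem_image.mpr
        ⟨x + y * t, Finset.mem_univ _, ?_⟩⟩
      rw [hxy, smul_smul, add_smul]
    have hle2 : s.card ≤ P.card * Fintype.card F := by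
      refine hle.trans ?_
      rw [Finset.card_product]
      exact Nat.mul_le_mul_left _ Finset.card_image_le
    have : (s.card : ℝ) ≤ P.card * Fintype.card F := by exact_mod_cast hle2
    have h0 : (0 : ℝ) ≤ (Fintype.card F : ℝ) ^ 4 := by positivity
    linarith
  · rw [if_neg hbc, add_zero]
    have hbc' : LinearIndependent F ![b, c] := by
      rw [LinearIndependent.pair_iff' hb]
      exact fun t ht => hbc ⟨t, ht.symm⟩
    have hle : s.card ≤ ((univ.image fun x : F × F => x.1 • α + x.2 • β) ×ˢ
        (univ.image fun x : F × F => x.1 • b + x.2 • c)).card := by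
      refine Finset.card_le_card_of_injOn _ (fun j hj => ?_) hinj
      obtain ⟨x, y, hxy⟩ := hleft j hj
      obtain ⟨x', y', hxy'⟩ := tens_add_eq_right hαβ hbc' (hmem _ hj).2.2.symm
      exact Finset.mem_product.mpr ⟨Finset.mem_image.mpr ⟨(x', y'), Finset.mem_univ _, hxy'.symm⟩,
        Finset.mem_image.mpr ⟨(x, y), Finset.mem_univ _, hxy.symm⟩⟩
    have hle2 : s.card ≤ Fintype.card F ^ 4 := by
      refine hle.trans ?_
      rw [Finset.card_product]
      refine (Nat.mul_le_mul Finset.card_image_le Finset.card_image_le).trans (le_of_eq ?_)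
      simp only [Finset.card_univ, Fintype.card_prod]
      ring
    exact_mod_cast hle2

/-- The off-diagonal part of the square of the level one part of `f`. -/
def offDiagSum (f : (Fin m → Fin N → F) → ℝ) (P : Finset (Fin m → F))
    (T : Fin m → Fin N → F) : ℝ :=
  ∑ α ∈ P, ∑ β ∈ P, if α ≠ β then (famCond f α (linEval T α) - famMean f) *
    (famCond f β (linEval T β) - famMean f) else 0

lemma sq_levelOne_eq (f : (Fin m → Fin N → F) → ℝ) (P : Finset (Fin m → F))
    (T : Fin m → Fin N → F) :
    (∑ α ∈ P, (famCond f α (linEval T α) - famMean f)) ^ 2 =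
      ∑ α ∈ P, (famCond f α (linEval T α) - famMean f) ^ 2 + offDiagSum f P T := by
  rw [sq, Finset.sum_mul_sum, offDiagSum, ← Finset.sum_add_distrib]
  refine Finset.sum_congr rfl fun α hα => ?_
  rw [← Finset.add_sum_erase P _ hα, ← Finset.add_sum_erase P
    (fun β => if α ≠ β then _ else (0 : ℝ)) hα]
  simp only [ne_eq, not_true_eq_false, if_false, zero_add, sq, add_right_inj]
  exact Finset.sum_congr rfl fun β hβ => by rw [if_pos (Finset.ne_of_mem_erase hβ).symm]

lemma offDiagSum_eq {ψ : AddChar F ℂ} (hψ : ψ.IsPrimitive)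
    (f : (Fin m → Fin N → F) → ℝ) (P : Finset (Fin m → F)) (T : Fin m → Fin N → F) :
    (offDiagSum f P T : ℂ) = ∑ i ∈ tensOffDiag N P,
      (coef ψ f (tens i.1.1 i.1.2) * coef ψ f (tens i.2.1 i.2.2)) *
        ψ (famPair (tens i.1.1 i.1.2 + tens i.2.1 i.2.2) T) := by
  rw [tensOffDiag, Finset.sum_filter, Finset.sum_product, Finset.sum_product, offDiagSum]
  push_cast
  refine Finset.sum_congr rfl fun α _ => ?_
  simp_rw [Finset.sum_product]
  rw [Finset.sum_comm]
  refine Finset.sum_congr rfl fun β _ => ?_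
  by_cases h : α = β
  · simp [h]
  · simp only [ne_eq, h, not_false_eq_true, if_true]
    have h1 := famCond_sub_mean hψ f α (linEval T α)
    have h2 := famCond_sub_mean hψ f β (linEval T β)
    rw [Complex.ofReal_mul, h1, h2, Finset.sum_mul_sum]
    refine Finset.sum_congr rfl fun b _ => Finset.sum_congr rfl fun c _ => ?_
    rw [famPair_add_left, AddChar.map_add_eq_mul, famPair_tens_left, famPair_tens_left]
    ring

lemma levelOneWeight_eq (ψ : AddChar F ℂ) (f : (Fin m → Fin N → F) → ℝ)
    (P : Finset (Fin m → F)) :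
    levelOneWeight ψ f P = ∑ p ∈ P ×ˢ univ.filter (fun b : Fin N → F => b ≠ 0),
      ‖coef ψ f (tens p.1 p.2)‖ ^ 2 := by
  rw [Finset.sum_product, levelOneWeight]
  refine Finset.sum_congr rfl fun α _ => ?_
  rw [Finset.sum_filter]
  exact Finset.sum_congr rfl fun b _ => by split_ifs <;> simp_all

lemma sum_offDiagSum_sq_le {ψ : AddChar F ℂ} (hψ : ψ.IsPrimitive)
    (f : (Fin m → Fin N → F) → ℝ) {P : Finset (Fin m → F)} (hP : PairIndep P)
    (hP0 : ∀ α ∈ P, α ≠ 0) {κ : ℝ} (hκ : ∀ α ∈ P, ∀ b : Fin N → F, b ≠ 0 →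
      ‖coef ψ f (tens α b)‖ ≤ κ) :
    ∑ T, offDiagSum f P T ^ 2 ≤ (Fintype.card (Fin m → Fin N → F) : ℝ) *
      ((Fintype.card F : ℝ) ^ 4 * levelOneWeight ψ f P ^ 2 +
        κ ^ 2 * (P.card : ℝ) ^ 2 * (Fintype.card F : ℝ) ^ 2 * levelOneWeight ψ f P) := by
  have h0 : ∀ T, offDiagSum f P T ^ 2 = ‖∑ i ∈ tensOffDiag N P,
      (coef ψ f (tens i.1.1 i.1.2) * coef ψ f (tens i.2.1 i.2.2)) *
        ψ (famPair (tens i.1.1 i.1.2 + tens i.2.1 i.2.2) T)‖ ^ 2 := fun T => by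
    rw [← offDiagSum_eq hψ, Complex.norm_real, Real.norm_eq_abs, sq_abs]
  simp_rw [h0]
  refine (sum_norm_sq_char_le hψ (tensOffDiag N P) _ _ _ (card_fiber_tensOffDiag_le hP hP0)).trans ?_
  refine mul_le_mul_of_nonneg_left ?_ (Nat.cast_nonneg _)
  simp_rw [mul_add, Finset.sum_add_distrib]
  set q : ℝ := (Fintype.card F : ℝ)
  set W := levelOneWeight ψ f P with hW
  have hWs := levelOneWeight_eq ψ f P
  rw [← hW] at hWs
  set Pv := P ×ˢ univ.filter (fun b : Fin N → F => b ≠ 0) with hPv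
  refine add_le_add ?_ ?_
  · rw [← Finset.sum_mul, mul_comm]
    refine mul_le_mul_of_nonneg_left ?_ (by positivity)
    rw [hWs, sq, Finset.sum_mul_sum, ← Finset.sum_product']
    refine (Finset.sum_le_sum_of_subset_of_nonneg (Finset.filter_subset _ _)
      fun i _ _ => by positivity).trans (le_of_eq ?_)
    exact Finset.sum_congr rfl fun i _ => by rw [norm_mul, mul_pow]
  · have h1 : ∀ i ∈ Pv ×ˢ Pv,
        ‖coef ψ f (tens i.1.1 i.1.2) * coef ψ f (tens i.2.1 i.2.2)‖ ^ 2 *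
          (if ∃ c : F, i.2.2 = c • i.1.2 then (P.card : ℝ) * q else 0) ≤
        ‖coef ψ f (tens i.1.1 i.1.2)‖ ^ 2 * (κ ^ 2 * ((P.card : ℝ) * q)) *
          (if ∃ c : F, i.2.2 = c • i.1.2 then 1 else 0) := by
      intro i hi
      rw [hPv] at hi
      simp only [Finset.mem_product, Finset.mem_filter, Finset.mem_univ, true_and] at hi
      split_ifs
      · rw [norm_mul, mul_pow, mul_one, mul_assoc]
        refine mul_le_mul_of_nonneg_left (mul_le_mul_of_nonneg_right ?_ (by positivity))
          (by positivity)
        exact pow_le_pow_left₀ (norm_nonneg _) (hκ _ hi.2.1 _ hi.2.2) 2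
      · simp
    refine (Finset.sum_le_sum_of_subset_of_nonneg (Finset.filter_subset _ _)
      fun i _ _ => by positivity).trans ?_
    refine (Finset.sum_le_sum h1).trans ?_
    rw [Finset.sum_product]
    have h2 : ∀ p ∈ Pv, ∑ p' ∈ Pv, ‖coef ψ f (tens p.1 p.2)‖ ^ 2 * (κ ^ 2 * ((P.card : ℝ) * q)) *
          (if ∃ c : F, p'.2 = c • p.2 then (1 : ℝ) else 0) ≤
        ‖coef ψ f (tens p.1 p.2)‖ ^ 2 * (κ ^ 2 * ((P.card : ℝ) * q)) * (P.card * q) := by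
      intro p _
      rw [← Finset.mul_sum]
      refine mul_le_mul_of_nonneg_left ?_ (by positivity)
      rw [Finset.sum_boole]
      have h3 : (Pv.filter fun p' => ∃ c : F, p'.2 = c • p.2).card ≤
          (P ×ˢ univ.image fun c : F => c • p.2).card := by
        refine Finset.card_le_card fun p' hp' => ?_
        rw [Finset.mem_filter, hPv, Finset.mem_product] at hp'
        obtain ⟨⟨h4, -⟩, c, h5⟩ := hp'
        exact Finset.mem_product.mpr ⟨h4, Finset.mem_image.mpr ⟨c, Finset.mem_univ _, h5.symm⟩⟩
      have h4 := h3.trans ((Finset.card_product _ _).le.trans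
        (Nat.mul_le_mul_left _ Finset.card_image_le))
      rw [Finset.card_univ] at h4
      simpa only [Nat.cast_mul] using (Nat.cast_le (α := ℝ)).mpr h4
    refine (Finset.sum_le_sum h2).trans (le_of_eq ?_)
    rw [← Finset.sum_mul, ← Finset.sum_mul, ← hWs]
    ring

lemma levelOneWeight_sq_le {ψ : AddChar F ℂ} (hψ : ψ.IsPrimitive)
    {f : (Fin m → Fin N → F) → ℝ} (hf : ∀ T, f T * f T = f T)
    {P : Finset (Fin m → F)} (hP : PairIndep P) (hP0 : ∀ α ∈ P, α ≠ 0) {κ M : ℝ}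
    (hκ : ∀ α ∈ P, ∀ b : Fin N → F, b ≠ 0 → ‖coef ψ f (tens α b)‖ ≤ κ)
    (hM : ∀ α ∈ P, ∀ z, famCond f α z ≤ M) :
    levelOneWeight ψ f P ^ 2 ≤ famMean f * (M * levelOneWeight ψ f P +
      √(famMean f * ((Fintype.card F : ℝ) ^ 4 * levelOneWeight ψ f P ^ 2 +
        κ ^ 2 * (P.card : ℝ) ^ 2 * (Fintype.card F : ℝ) ^ 2 * levelOneWeight ψ f P))) := by
  set X : (Fin m → Fin N → F) → ℝ :=
    fun T => ∑ α ∈ P, (famCond f α (linEval T α) - famMean f) with hX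
  have hfn : ∀ T, 0 ≤ f T := fun T => by rw [← hf]; exact mul_self_nonneg _
  have hG : (0 : ℝ) < (Fintype.card (Fin m → Fin N → F) : ℝ) := Nat.cast_pos.mpr Fintype.card_pos
  set g : ℝ := (Fintype.card (Fin m → Fin N → F) : ℝ)
  set W := levelOneWeight ψ f P
  have hmean : ∑ T, f T = g * famMean f := by
    rw [famMean, ← mul_assoc, mul_inv_cancel₀ hG.ne', one_mul]
  have hν : 0 ≤ famMean f := mul_nonneg (inv_nonneg.mpr hG.le) (Finset.sum_nonneg fun T _ => hfn T)
  have hcs : ∀ Y : (Fin m → Fin N → F) → ℝ,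
      (∑ T, f T * Y T) ^ 2 ≤ (∑ T, f T) * ∑ T, f T * Y T ^ 2 := by
    intro Y
    have h := Finset.sum_mul_sq_le_sq_mul_sq Finset.univ f (fun T => f T * Y T)
    have h1 : ∀ T, f T * (f T * Y T) = f T * Y T := fun T => by rw [← mul_assoc, hf]
    have h2 : ∀ T, (f T * Y T) ^ 2 = f T * Y T ^ 2 := fun T => by rw [mul_pow, sq (f T), hf]
    simpa only [h1, h2, sq (f _), hf] using h
  have h1 : (g * W) ^ 2 ≤ g * famMean f * ∑ T, f T * X T ^ 2 := by
    rw [← sum_mul_levelOne hψ f P, ← hmean]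
    exact hcs X
  have h2 : ∑ T, f T * X T ^ 2 ≤ g * (M * W) + ∑ T, f T * offDiagSum f P T := by
    simp_rw [hX, sq_levelOne_eq, mul_add, Finset.sum_add_distrib]
    exact add_le_add (sum_mul_diag_le hψ f P hM) le_rfl
  set E := (Fintype.card F : ℝ) ^ 4 * W ^ 2 + κ ^ 2 * (P.card : ℝ) ^ 2 *
    (Fintype.card F : ℝ) ^ 2 * W with hE
  have h3 : ∑ T, f T * offDiagSum f P T ≤ g * √(famMean f * E) := by
    rw [← Real.sqrt_sq hG.le, ← Real.sqrt_mul (sq_nonneg g)]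
    apply Real.le_sqrt_of_sq_le
    refine (hcs _).trans ?_
    rw [hmean]
    have h4 : ∑ T, f T * offDiagSum f P T ^ 2 ≤ g * E := by
      refine le_trans (Finset.sum_le_sum fun T _ => ?_) (sum_offDiagSum_sq_le hψ f hP hP0 hκ)
      have : f T ≤ 1 := by nlinarith [hf T, hfn T]
      exact mul_le_of_le_one_left (sq_nonneg _) this
    calc g * famMean f * ∑ T, f T * offDiagSum f P T ^ 2 ≤ g * famMean f * (g * E) :=
          mul_le_mul_of_nonneg_left h4 (by positivity)
      _ = g ^ 2 * (famMean f * E) := by ring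
  have h5 : g ^ 2 * W ^ 2 ≤ g ^ 2 * (famMean f * (M * W + √(famMean f * E))) := by
    calc g ^ 2 * W ^ 2 = (g * W) ^ 2 := by ring
      _ ≤ g * famMean f * ∑ T, f T * X T ^ 2 := h1
      _ ≤ g * famMean f * (g * (M * W) + g * √(famMean f * E)) :=
        mul_le_mul_of_nonneg_left (h2.trans (add_le_add le_rfl h3)) (by positivity)
      _ = _ := by ring
  exact le_of_mul_le_mul_left h5 (by positivity)

end OffDiagonal

section Spectral

open scoped Classical

variable {F : Type} [Field F] [Fintype F] {N ℓ : ℕ}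

/-- `P` is a set of representatives of the lines of `F^m`. -/
structure IsLineTransversal {m : ℕ} (P : Finset (Fin m → F)) : Prop where
  ne_zero : ∀ α ∈ P, α ≠ 0
  pairIndep : PairIndep P
  cover : ∀ v : Fin m → F, v ≠ 0 → ∃ α ∈ P, ∃ t : F, v = t • α

lemma exists_isLineTransversal (m : ℕ) :
    ∃ P : Finset (Fin m → F), IsLineTransversal P := by
  refine ⟨(Set.toFinite (Set.range (Projectivization.rep (K := F) (V := Fin m → F)))).toFinset,
    ?_, ?_, ?_⟩
  · intro α hα
    obtain ⟨x, rfl⟩ := (Set.Finite.mem_toFinset _).mp hα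
    exact Projectivization.rep_nonzero x
  · intro α hα β hβ hne
    obtain ⟨x, rfl⟩ := (Set.Finite.mem_toFinset _).mp hα
    obtain ⟨y, rfl⟩ := (Set.Finite.mem_toFinset _).mp hβ
    have hxy : x ≠ y := fun h => hne (h ▸ rfl)
    have h := Projectivization.independent_iff.mp ((Projectivization.independent_pair_iff_ne x y).mpr hxy)
    have heq : ![x.rep, y.rep] = Projectivization.rep ∘ ![x, y] := by
      funext i
      fin_cases i <;> rfl
    rw [heq]
    exact h
  · intro v hv
    refine ⟨_, (Set.Finite.mem_toFinset _).mpr ⟨Projectivization.mk F v hv, rfl⟩, ?_⟩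
    obtain ⟨a, ha⟩ := Projectivization.exists_smul_eq_mk_rep F v hv
    refine ⟨((a⁻¹ : Fˣ) : F), ?_⟩
    rw [← ha, ← Units.smul_def, smul_smul, inv_mul_cancel, one_smul]

lemma IsLineTransversal.card_le {P : Finset (Fin (ℓ + 1) → F)} (hP : IsLineTransversal P) :
    (P.card : ℝ) ≤ 2 * (Fintype.card F : ℝ) ^ ℓ := by
  have h1 : (P ×ˢ (univ.filter fun t : F => t ≠ 0)).card ≤ Fintype.card (Fin (ℓ + 1) → F) := by
    rw [← Finset.card_univ]
    refine Finset.card_le_card_of_injOn (fun x => x.2 • x.1) (fun _ _ => Finset.mem_univ _) ?_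
    rintro ⟨α, s⟩ h ⟨β, t⟩ h' heq
    simp only [Finset.coe_product, Set.mem_prod, Finset.mem_coe, Finset.mem_filter,
      Finset.mem_univ, true_and] at h h' heq
    have hαβ : α = β := by
      by_contra hne
      have := LinearIndependent.pair_iff.mp (hP.pairIndep α h.1 β h'.1 hne) s (-t)
        (by rw [heq, neg_smul, add_neg_cancel])
      exact h.2 this.1
    subst hαβ
    have := smul_left_injective F (hP.ne_zero α h.1) heq
    rw [this]
  rw [Finset.card_product, Finset.filter_ne', Finset.card_erase_of_mem (Finset.mem_univ _),
    Finset.card_univ, Fintype.card_fun, Fintype.card_fin] at h1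
  have hq : 2 ≤ Fintype.card F := Fintype.one_lt_card
  have h2 : (P.card : ℝ) * ((Fintype.card F : ℝ) - 1) ≤ (Fintype.card F : ℝ) ^ (ℓ + 1) := by
    have : ((Fintype.card F - 1 : ℕ) : ℝ) = (Fintype.card F : ℝ) - 1 := by
      rw [Nat.cast_sub (by omega), Nat.cast_one]
    rw [← this]
    exact_mod_cast h1
  have hq' : (2 : ℝ) ≤ Fintype.card F := by exact_mod_cast hq
  have h3 : (0 : ℝ) ≤ P.card := Nat.cast_nonneg _
  have h4 : (P.card : ℝ) * ((Fintype.card F : ℝ)) ≤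
      2 * (Fintype.card F : ℝ) ^ ℓ * Fintype.card F := by
    rw [pow_succ] at h2
    nlinarith
  exact le_of_mul_le_mul_right h4 (by linarith)

omit [Fintype F] in
lemma linEval_eq_linearCombination {m : ℕ} (R : Fin m → Fin N → F) (a : Fin m → F) :
    linEval R a = Fintype.linearCombination F R a := by
  rw [Fintype.linearCombination_apply, linEval]

lemma card_ker_filter_le {m : ℕ} (R : Fin m → Fin N → F) {r d : ℕ}
    (hr : r ≤ Module.finrank F (LinearMap.range (Fintype.linearCombination F R))) (hd : d + r = m)
    {s : Finset (Fin m → F)} (hs : 0 ∉ s) :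
    ((s.filter fun a => linEval R a = 0).card : ℝ) ≤ (Fintype.card F : ℝ) ^ d - 1 := by
  have h1 := LinearMap.finrank_range_add_finrank_ker (Fintype.linearCombination F R)
  rw [Module.finrank_fintype_fun_eq_card, Fintype.card_fin] at h1
  have h2 : Module.finrank F (LinearMap.ker (Fintype.linearCombination F R)) ≤ d := by omega
  set S := LinearMap.ker (Fintype.linearCombination F R) with hS
  have h3 : Fintype.card S ≤ Fintype.card F ^ d := by
    rw [Module.card_eq_pow_finrank (K := F)]
    exact Nat.pow_le_pow_right Fintype.card_pos h2
  have h4 : s.filter (fun a => linEval R a = 0) ⊆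
      (univ.filter fun a => a ∈ S).erase 0 := by
    intro a ha
    simp only [Finset.mem_filter] at ha
    refine Finset.mem_erase.mpr ⟨?_, ?_⟩
    · rintro rfl
      exact hs ha.1
    · rw [Finset.mem_filter]
      refine ⟨Finset.mem_univ _, ?_⟩
      rw [hS, LinearMap.mem_ker, ← linEval_eq_linearCombination]
      exact ha.2
  have h5 := Finset.card_le_card h4
  rw [Finset.card_erase_of_mem (by simp), ← Fintype.card_subtype] at h5
  have h6 : Fintype.card {a // a ∈ S} = Fintype.card S := rfl
  have h7 : 0 < Fintype.card S := Fintype.card_pos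
  have h8 : (s.filter fun a => linEval R a = 0).card + 1 ≤ Fintype.card F ^ d := by
    omega
  have h9 : ((s.filter fun a => linEval R a = 0).card : ℝ) + 1 ≤
    (Fintype.card F : ℝ) ^ d := by exact_mod_cast h8
  linarith

omit [Fintype F] in
lemma exists_eq_tens {m : ℕ} {P : Finset (Fin m → F)} (hP : IsLineTransversal P)
    {R : Fin m → Fin N → F} (hR : R ≠ 0)
    (h : Module.finrank F (LinearMap.range (Fintype.linearCombination F R)) ≤ 1) :
    ∃ α ∈ P, ∃ b : Fin N → F, b ≠ 0 ∧ R = tens α b := by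
  obtain ⟨⟨b, hb⟩, hspan⟩ := finrank_le_one_iff.mp h
  have h1 : ∀ i, ∃ c : F, c • b = R i := by
    intro i
    have hmem : R i ∈ LinearMap.range (Fintype.linearCombination F R) :=
      ⟨Pi.single i 1, by simp⟩
    obtain ⟨c, hc⟩ := hspan ⟨_, hmem⟩
    exact ⟨c, congr_arg Subtype.val hc⟩
  choose c hc using h1
  have hRc : R = tens c b := by
    funext i
    exact (hc i).symm
  have hc0 : c ≠ 0 := by
    rintro rfl
    apply hR
    rw [hRc]
    ext; simp [tens]
  have hb0 : b ≠ 0 := by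
    rintro rfl
    exact hR (hRc.trans (tens_zero c))
  obtain ⟨α, hα, t, rfl⟩ := hP.cover c hc0
  refine ⟨α, hα, t • b, smul_ne_zero (fun ht => hc0 (by rw [ht, zero_smul])) hb0, ?_⟩
  rw [hRc]
  ext i j
  simp only [tens, Pi.smul_apply, smul_eq_mul]
  ring

/-- The vectors of `F^(ℓ+1)` with nonzero tail. -/
def goodVec (F : Type) [Field F] [Fintype F] (ℓ : ℕ) : Finset (Fin (ℓ + 1) → F) :=
  univ.filter fun a => Fin.tail a ≠ 0

lemma card_goodVec : ((goodVec F ℓ).card : ℝ) =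
    (Fintype.card F : ℝ) ^ (ℓ + 1) - Fintype.card F := by
  have h1 : (univ.filter fun a : Fin (ℓ + 1) → F => Fin.tail a = 0).card = Fintype.card F := by
    rw [← Finset.card_univ]
    refine Finset.card_nbij' (fun a => a 0) (fun c => Fin.cons c 0) (by simp) (by simp)
      (fun a ha => ?_) (fun c _ => rfl)
    simp only [← (Finset.mem_filter.mp ha).2, Fin.cons_self_tail]
  have h2 := Finset.card_filter_add_card_filter_not (s := (univ : Finset (Fin (ℓ + 1) → F)))
    (fun a => Fin.tail a = 0)
  rw [h1, Finset.card_univ, Fintype.card_fun, Fintype.card_fin] at h2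
  have h3 : (Fintype.card F : ℝ) + (goodVec F ℓ).card = (Fintype.card F : ℝ) ^ (ℓ + 1) := by
    exact_mod_cast h2
  linarith

lemma card_goodVec_ker_le {P : Finset (Fin (ℓ + 1) → F)} (hP : IsLineTransversal P)
    (R : Fin (ℓ + 1) → Fin N → F) :
    (((goodVec F ℓ).filter fun a => linEval R a = 0).card : ℝ) ≤
      (goodVec F ℓ).card * (((Fintype.card F : ℝ) ^ 2)⁻¹ +
        (1 - ((Fintype.card F : ℝ) ^ 2)⁻¹) * (if R = 0 then 1 else 0) +
        ((Fintype.card F : ℝ)⁻¹ - ((Fintype.card F : ℝ) ^ 2)⁻¹) *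
          ∑ p ∈ P ×ˢ univ.filter (fun b : Fin N → F => b ≠ 0),
            if R = tens p.1 p.2 then 1 else 0) := by
  have hq : (2 : ℝ) ≤ Fintype.card F := by exact_mod_cast (Fintype.one_lt_card : 1 < Fintype.card F)
  have hsum : (0 : ℝ) ≤ ∑ p ∈ P ×ˢ univ.filter (fun b : Fin N → F => b ≠ 0),
      if R = tens p.1 p.2 then 1 else 0 :=
    Finset.sum_nonneg fun _ _ => by split_ifs <;> norm_num
  have hcard := card_goodVec (F := F) (ℓ := ℓ)
  have hg0 : (0 : ℝ) ≤ (goodVec F ℓ).card := Nat.cast_nonneg _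
  set g : ℝ := ((goodVec F ℓ).card : ℝ)
  set q : ℝ := (Fintype.card F : ℝ)
  set X := ∑ p ∈ P ×ˢ univ.filter (fun b : Fin N → F => b ≠ 0),
      if R = tens p.1 p.2 then (1 : ℝ) else 0 with hX
  have hcoef : 0 ≤ q⁻¹ - (q ^ 2)⁻¹ := by
    have : q ≤ q ^ 2 := by nlinarith
    rw [sub_nonneg]
    exact inv_anti₀ (by linarith) this
  have h0 : (0 : Fin (ℓ + 1) → F) ∉ goodVec F ℓ := fun h => (Finset.mem_filter.mp h).2 rfl
  by_cases hR : R = 0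
  · rw [if_pos hR]
    calc (((goodVec F ℓ).filter fun a => linEval R a = 0).card : ℝ) ≤ g := by
          exact Nat.cast_le.mpr (Finset.card_filter_le _ _)
      _ ≤ g * 1 + g * ((q⁻¹ - (q ^ 2)⁻¹) * X) := by
          rw [mul_one]
          exact le_add_of_nonneg_right (by positivity)
      _ = _ := by ring
  · rw [if_neg hR, mul_zero, add_zero]
    have hr1 : 1 ≤ Module.finrank F (LinearMap.range (Fintype.linearCombination F R)) := by
      rw [Nat.one_le_iff_ne_zero, Ne, Submodule.finrank_eq_zero, LinearMap.range_eq_bot]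
      intro h
      apply hR
      funext i
      have := LinearMap.congr_fun h (Pi.single i 1)
      simpa using this
    by_cases hr2 : 2 ≤ Module.finrank F (LinearMap.range (Fintype.linearCombination F R))
    · have hℓ : 1 ≤ ℓ := by
        have := LinearMap.finrank_range_le (Fintype.linearCombination F R)
        rw [Module.finrank_fintype_fun_eq_card, Fintype.card_fin] at this
        omega
      obtain ⟨k, rfl⟩ : ∃ k, ℓ = k + 1 := ⟨ℓ - 1, by omega⟩
      have h1 := card_ker_filter_le R hr2 (d := k) rfl h0
      calc (((goodVec F (k + 1)).filter fun a => linEval R a = 0).card : ℝ) ≤ q ^ k - 1 := h1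
        _ ≤ g * (q ^ 2)⁻¹ := by
          rw [hcard, le_mul_inv_iff₀ (by positivity)]
          have : q ≤ q ^ 2 := by nlinarith
          ring_nf
          ring_nf at this
          linarith
        _ ≤ g * (q ^ 2)⁻¹ + g * ((q⁻¹ - (q ^ 2)⁻¹) * X) := le_add_of_nonneg_right (by positivity)
        _ = _ := by ring
    · obtain ⟨α, hα, b, hb, hRαb⟩ := exists_eq_tens hP hR (by omega)
      have h1 := card_ker_filter_le R hr1 (d := ℓ) rfl h0
      have hX1 : 1 ≤ X := by
        have := Finset.single_le_sum (f := fun p : (Fin (ℓ + 1) → F) × (Fin N → F) =>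
          if R = tens p.1 p.2 then (1 : ℝ) else 0)
          (s := P ×ˢ univ.filter (fun b : Fin N → F => b ≠ 0))
          (fun _ _ => by split_ifs <;> norm_num) (a := (α, b)) (by simp [hα, hb])
        simp only [hRαb, if_true] at this
        simp only [hX, hRαb]
        exact this
      calc (((goodVec F ℓ).filter fun a => linEval R a = 0).card : ℝ) ≤ q ^ ℓ - 1 := h1
        _ = g * q⁻¹ := by
          rw [hcard, eq_mul_inv_iff_mul_eq₀ (by positivity)]
          ring
        _ = g * ((q ^ 2)⁻¹ + (q⁻¹ - (q ^ 2)⁻¹) * 1) := by ring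
        _ ≤ _ := by gcongr

lemma levelOneWeight_ge {ψ : AddChar F ℂ} (hψ : ψ.IsPrimitive) (hℓ : 1 ≤ ℓ)
    {f : (Fin (ℓ + 1) → Fin N → F) → ℝ} (hf : ∀ T, f T * f T = f T)
    {P : Finset (Fin (ℓ + 1) → F)} (hP : IsLineTransversal P) {θ : ℝ}
    (hC : ∀ a, Fin.tail a ≠ 0 → (Fintype.card F : ℝ) ^ N * θ * ∑ T, f T ≤
      ∑ T, ∑ u : Fin N → F, f T * f (T + tens a u)) :
    θ * famMean f ≤ ((Fintype.card F : ℝ) ^ 2)⁻¹ * famMean f +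
      (1 - ((Fintype.card F : ℝ) ^ 2)⁻¹) * famMean f ^ 2 +
      ((Fintype.card F : ℝ)⁻¹ - ((Fintype.card F : ℝ) ^ 2)⁻¹) * levelOneWeight ψ f P := by
  have hq : (2 : ℝ) ≤ Fintype.card F := by exact_mod_cast (Fintype.one_lt_card : 1 < Fintype.card F)
  have hG : (0 : ℝ) < (Fintype.card (Fin (ℓ + 1) → Fin N → F) : ℝ) :=
    Nat.cast_pos.mpr Fintype.card_pos
  have hg0 : (0 : ℝ) < (goodVec F ℓ).card := by
    rw [card_goodVec]
    have : (Fintype.card F : ℝ) ^ 2 ≤ (Fintype.card F : ℝ) ^ (ℓ + 1) :=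
      pow_le_pow_right₀ (by linarith) (by omega)
    nlinarith
  have hpars : ∑ R : Fin (ℓ + 1) → Fin N → F, ‖coef ψ f R‖ ^ 2 = famMean f := by
    have h := sum_coef_sq_correlation (N := N) hψ f 0
    have hlin : ∀ R : Fin (ℓ + 1) → Fin N → F, linEval R 0 = 0 := linEval_zero
    have htens : ∀ u : Fin N → F, tens (0 : Fin (ℓ + 1) → F) u = 0 := fun u => by ext; simp [tens]
    simp only [hlin, htens, if_true, add_zero, hf, Finset.sum_const, Finset.card_univ,
      nsmul_eq_mul, ← Finset.mul_sum] at h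
    rw [h, famMean]
    have hq' : (Fintype.card F : ℝ) ≠ 0 := by linarith
    simp
    field_simp
  have hlow : ∀ a ∈ goodVec F ℓ, θ * famMean f ≤
      ∑ R : Fin (ℓ + 1) → Fin N → F, (if linEval R a = 0 then ‖coef ψ f R‖ ^ 2 else 0) := by
    intro a ha
    rw [sum_coef_sq_correlation hψ, le_inv_mul_iff₀ (by positivity)]
    refine le_trans (le_of_eq ?_) (hC a (Finset.mem_filter.mp ha).2)
    rw [famMean]
    field_simp
  have hlow' := Finset.sum_le_sum hlow
  rw [Finset.sum_const, nsmul_eq_mul, Finset.sum_comm] at hlow'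
  have hup : ∀ R : Fin (ℓ + 1) → Fin N → F,
      ∑ a ∈ goodVec F ℓ, (if linEval R a = 0 then ‖coef ψ f R‖ ^ 2 else 0) ≤
      (goodVec F ℓ).card * (((Fintype.card F : ℝ) ^ 2)⁻¹ * ‖coef ψ f R‖ ^ 2 +
        (1 - ((Fintype.card F : ℝ) ^ 2)⁻¹) * (if R = 0 then ‖coef ψ f R‖ ^ 2 else 0) +
        ((Fintype.card F : ℝ)⁻¹ - ((Fintype.card F : ℝ) ^ 2)⁻¹) *
          ∑ p ∈ P ×ˢ univ.filter (fun b : Fin N → F => b ≠ 0),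
            if R = tens p.1 p.2 then ‖coef ψ f R‖ ^ 2 else 0) := by
    intro R
    rw [← Finset.sum_filter, Finset.sum_const, nsmul_eq_mul]
    refine (mul_le_mul_of_nonneg_right (card_goodVec_ker_le hP R) (sq_nonneg _)).trans
      (le_of_eq ?_)
    have h1 : ∀ (p : Prop) [Decidable p] (x : ℝ), (if p then x else 0) = (if p then (1 : ℝ) else 0) * x :=
      fun p _ x => by split_ifs <;> simp
    rw [h1 (R = 0) (‖coef ψ f R‖ ^ 2), Finset.sum_congr rfl fun p _ => h1 _ (‖coef ψ f R‖ ^ 2),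
      ← Finset.sum_mul]
    ring
  have h2 := hlow'.trans (Finset.sum_le_sum fun R _ => hup R)
  rw [← Finset.mul_sum] at h2
  have h3 := le_of_mul_le_mul_left h2 hg0
  rw [Finset.sum_add_distrib, Finset.sum_add_distrib, ← Finset.mul_sum, ← Finset.mul_sum,
    ← Finset.mul_sum, hpars, Finset.sum_comm] at h3
  simp only [Finset.sum_ite_eq', Finset.mem_univ, if_true] at h3
  rw [← levelOneWeight_eq, coef_zero, Complex.norm_real, Real.norm_eq_abs, sq_abs] at h3
  exact h3

end Spectral

section Frames

open scoped Classical

variable {F : Type} [Field F] {N k : ℕ}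

/-- The flat through `T 0` spanned by the remaining vectors of `T`. -/
def frameFlat (T : Fin (k + 1) → Fin N → F) : AffineSubspace F (Fin N → F) :=
  AffineSubspace.mk' (T 0) (Submodule.span F (Set.range (Fin.tail T)))

lemma frameFlat_direction (T : Fin (k + 1) → Fin N → F) :
    (frameFlat T).direction = Submodule.span F (Set.range (Fin.tail T)) :=
  AffineSubspace.direction_mk' _ _

lemma isFlat_frameFlat {T : Fin (k + 1) → Fin N → F} (hT : LinearIndependent F (Fin.tail T)) :
    IsFlat k (frameFlat T) := by
  refine ⟨⟨T 0, AffineSubspace.self_mem_mk' _ _⟩, ?_⟩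
  rw [frameFlat_direction, finrank_span_eq_card hT, Fintype.card_fin]

lemma linEval_cons (T : Fin (k + 1) → Fin N → F) (c : F) (w : Fin k → F) :
    linEval T (Fin.cons c w) = c • T 0 + ∑ i, w i • T i.succ := by
  simp [linEval, Fin.sum_univ_succ]

lemma linEval_eq_tail (T : Fin (k + 1) → Fin N → F) (α : Fin (k + 1) → F) :
    linEval T α = α 0 • T 0 + ∑ i : Fin k, α i.succ • T i.succ := by
  simp [linEval, Fin.sum_univ_succ]

lemma mem_frameFlat_direction {T : Fin (k + 1) → Fin N → F} {v : Fin N → F} :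
    v ∈ (frameFlat T).direction ↔ ∃ w : Fin k → F, linEval T (Fin.cons 0 w) = v := by
  rw [frameFlat_direction, Submodule.mem_span_range_iff_exists_fun]
  simp [linEval_cons, Fin.tail]

lemma mem_frameFlat {T : Fin (k + 1) → Fin N → F} {v : Fin N → F} :
    v ∈ frameFlat T ↔ ∃ w : Fin k → F, linEval T (Fin.cons 1 w) = v := by
  rw [frameFlat, AffineSubspace.mem_mk', Submodule.mem_span_range_iff_exists_fun]
  simp only [linEval_cons, Fin.tail, one_smul, vsub_eq_sub, eq_sub_iff_add_eq']

lemma linearIndependent_tail_iff {T : Fin (k + 1) → Fin N → F} :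
    LinearIndependent F (Fin.tail T) ↔
      ∀ β : Fin (k + 1) → F, β 0 = 0 → linEval T β = 0 → β = 0 := by
  rw [Fintype.linearIndependent_iff]
  constructor
  · intro h β h0 h1
    rw [linEval_eq_tail, h0, zero_smul, zero_add] at h1
    have h2 := h (fun i => β i.succ) h1
    funext i
    refine Fin.cases h0 h2 i
  · intro h w hw i
    have := h (Fin.cons 0 w) (by simp) (by simpa [linEval_cons, Fin.tail] using hw)
    simpa using congr_fun this i.succ

lemma frameFlat_ext {T T' : Fin (k + 1) → Fin N → F}
    (h : ∀ v, v ∈ frameFlat T ↔ v ∈ frameFlat T') : frameFlat T = frameFlat T' :=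
  SetLike.ext h

/-- The indicator of the frames of the flats in `A`. -/
def flatInd (A : Set (AffineSubspace F (Fin N → F))) (T : Fin (k + 1) → Fin N → F) : ℝ :=
  if LinearIndependent F (Fin.tail T) ∧ frameFlat T ∈ A then 1 else 0

lemma flatInd_mul_self (A : Set (AffineSubspace F (Fin N → F))) (T : Fin (k + 1) → Fin N → F) :
    flatInd A T * flatInd A T = flatInd A T := by
  rw [flatInd]; split_ifs <;> simp

lemma flatInd_nonneg (A : Set (AffineSubspace F (Fin N → F))) (T : Fin (k + 1) → Fin N → F) :
    0 ≤ flatInd A T := by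
  rw [flatInd]; split_ifs <;> simp

lemma flatInd_le_one (A : Set (AffineSubspace F (Fin N → F))) (T : Fin (k + 1) → Fin N → F) :
    flatInd A T ≤ 1 := by
  rw [flatInd]; split_ifs <;> simp

lemma flatInd_inter (A C : Set (AffineSubspace F (Fin N → F))) (T : Fin (k + 1) → Fin N → F) :
    flatInd (A ∩ C) T = if frameFlat T ∈ C then flatInd A T else 0 := by
  simp only [flatInd, Set.mem_inter_iff]
  split_ifs <;> simp_all

variable [Fintype F]

lemma natCard_of_isFlat {U : AffineSubspace F (Fin N → F)} (hU : IsFlat k U) :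
    Nat.card U = Fintype.card F ^ k := by
  obtain ⟨⟨p, hp⟩, hk⟩ := hU
  have : Nonempty U := ⟨⟨p, hp⟩⟩
  rw [← Nat.card_congr (Equiv.vaddConst (⟨p, hp⟩ : U)), Module.natCard_eq_pow_finrank (K := F), hk,
    Nat.card_eq_fintype_card]

/-- The number of frames of a `k`-flat over `F`. -/
def frameCount (F : Type) [Fintype F] (k : ℕ) : ℕ :=
  Fintype.card F ^ k * ∏ i : Fin k, (Fintype.card F ^ k - Fintype.card F ^ (i : ℕ))

lemma frameCount_pos : 0 < frameCount F k := by
  refine Nat.mul_pos (pow_pos Fintype.card_pos _) (Finset.prod_pos fun i _ => ?_)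
  exact Nat.sub_pos_of_lt (Nat.pow_lt_pow_right Fintype.one_lt_card i.2)

lemma card_frames {U : AffineSubspace F (Fin N → F)} (hU : IsFlat k U) :
    (univ.filter fun T : Fin (k + 1) → Fin N → F =>
      LinearIndependent F (Fin.tail T) ∧ frameFlat T = U).card = frameCount F k := by
  rw [← Fintype.card_subtype, ← Nat.card_eq_fintype_card, frameCount]
  have h1 := card_linearIndependent (K := F) (V := U.direction) (k := k) hU.2.ge
  rw [hU.2] at h1
  rw [← h1, ← natCard_of_isFlat hU, ← Nat.card_prod]
  symm
  have hdir : ∀ (x : U) (s : Fin k → U.direction), LinearIndependent F s →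
      LinearIndependent F (Fin.tail (Fin.cons (x : Fin N → F) fun i => (s i : Fin N → F) :
        Fin (k + 1) → Fin N → F)) ∧
      frameFlat (Fin.cons (x : Fin N → F) fun i => (s i : Fin N → F)) = U := by
    intro x s hs
    have hs' : LinearIndependent F fun i => (s i : Fin N → F) :=
      hs.map' U.direction.subtype (Submodule.ker_subtype _)
    refine ⟨by simpa using hs', ?_⟩
    rw [frameFlat, Fin.tail_cons, Fin.cons_zero]
    have : Submodule.span F (Set.range fun i => (s i : Fin N → F)) = U.direction := by
      refine Submodule.eq_of_le_of_finrank_eq (Submodule.span_le.mpr ?_) ?_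
      · rintro _ ⟨i, rfl⟩
        exact (s i).2
      · rw [finrank_span_eq_card hs', Fintype.card_fin, hU.2]
    rw [this]
    exact AffineSubspace.mk'_eq x.2
  refine Nat.card_eq_of_bijective
    (fun x => ⟨Fin.cons (x.1 : Fin N → F) fun i => (x.2.1 i : Fin N → F), hdir x.1 x.2.1 x.2.2⟩)
    ⟨?_, ?_⟩
  · rintro ⟨x, s, hs⟩ ⟨y, t, ht⟩ h
    simp only [Subtype.mk.injEq] at h
    obtain ⟨h2, h3⟩ := Fin.cons_inj.mp h
    obtain rfl : x = y := Subtype.ext h2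
    obtain rfl : s = t := funext fun i => Subtype.ext (congr_fun h3 i)
    rfl
  · rintro ⟨T, hT, rfl⟩
    have hmem : ∀ i, Fin.tail T i ∈ (frameFlat T).direction := fun i => by
      rw [frameFlat_direction]
      exact Submodule.subset_span ⟨i, rfl⟩
    refine ⟨(⟨T 0, AffineSubspace.self_mem_mk' _ _⟩, ⟨fun i => ⟨Fin.tail T i, hmem i⟩, ?_⟩), ?_⟩
    · exact LinearIndependent.of_comp (frameFlat T).direction.subtype hT
    · exact Subtype.ext (Fin.cons_self_tail T)

lemma sum_frames (h : AffineSubspace F (Fin N → F) → ℝ) :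
    ∑ T : Fin (k + 1) → Fin N → F,
      (if LinearIndependent F (Fin.tail T) then h (frameFlat T) else 0) =
      frameCount F k * ∑ U : AffineSubspace F (Fin N → F), if IsFlat k U then h U else 0 := by
  rw [Finset.mul_sum, ← Finset.sum_filter, ← Finset.sum_fiberwise _ frameFlat]
  refine Finset.sum_congr rfl fun U _ => ?_
  rw [Finset.filter_filter]
  split_ifs with hU
  · rw [← card_frames hU, ← nsmul_eq_mul, ← Finset.sum_const]
    exact Finset.sum_congr rfl fun T hT => by rw [(Finset.mem_filter.mp hT).2.2]
  · rw [mul_zero]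
    refine Finset.sum_eq_zero fun T hT => ?_
    obtain ⟨h1, rfl⟩ := (Finset.mem_filter.mp hT).2
    exact absurd (isFlat_frameFlat h1) hU

lemma sum_flatInd (k : ℕ) {A : Set (AffineSubspace F (Fin N → F))} (hA : A ⊆ {U | IsFlat k U}) :
    ∑ T : Fin (k + 1) → Fin N → F, flatInd A T = frameCount F k * (Nat.card A : ℝ) := by
  have h := sum_frames (F := F) (N := N) (k := k) (fun U => if U ∈ A then 1 else 0)
  have h1 : ∀ T : Fin (k + 1) → Fin N → F, flatInd A T =
      if LinearIndependent F (Fin.tail T) then (if frameFlat T ∈ A then 1 else 0) else 0 :=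
    fun T => by rw [flatInd, ite_and]
  simp_rw [h1]
  rw [h]
  congr 1
  have h2 : ∀ U : AffineSubspace F (Fin N → F),
      (if IsFlat k U then (if U ∈ A then (1 : ℝ) else 0) else 0) = if U ∈ A then 1 else 0 := by
    intro U
    by_cases hU : U ∈ A
    · rw [if_pos hU, if_pos (show IsFlat k U from hA hU)]
    · simp [hU]
  simp_rw [h2]
  rw [Finset.sum_boole, Nat.card_eq_fintype_card, Fintype.card_subtype]

lemma card_inter_le_of_dens_le {α : Type} [Finite α] {A C : Set α} {θ : ℝ} (h : dens A C ≤ θ) :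
    (Nat.card ↥(A ∩ C) : ℝ) ≤ θ * Nat.card C := by
  rw [_root_.dens] at h
  by_cases h0 : Nat.card C = 0
  · have h1 : Nat.card ↥(A ∩ C) ≤ Nat.card C := Nat.card_mono (Set.toFinite _) Set.inter_subset_right
    have h2 : Nat.card ↥(A ∩ C) = 0 := by omega
    rw [h0, h2]; simp
  · rwa [div_le_iff₀ (by positivity)] at h

lemma sum_flatInd_inter_le (k : ℕ) {A C : Set (AffineSubspace F (Fin N → F))}
    (hC : C ⊆ {U | IsFlat k U}) {θ : ℝ} (h : dens A C ≤ θ) :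
    ∑ T : Fin (k + 1) → Fin N → F, flatInd (A ∩ C) T ≤
      θ * ∑ T : Fin (k + 1) → Fin N → F, flatInd C T := by
  rw [sum_flatInd k hC, sum_flatInd k (Set.inter_subset_right.trans hC)]
  have := card_inter_le_of_dens_le h
  have h2 : (0 : ℝ) ≤ frameCount F k := Nat.cast_nonneg _
  nlinarith

end Frames

section Invariance

open scoped Classical

variable {F : Type} [Field F] {m k N : ℕ}

/-- The family of the composition of `T` with `g`. -/
def famComp (T : Fin m → Fin N → F) (g : (Fin m → F) ≃ₗ[F] (Fin m → F)) : Fin m → Fin N → F :=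
  fun i => linEval T (g (Pi.single i 1))

lemma linEval_single (T : Fin m → Fin N → F) (i : Fin m) : linEval T (Pi.single i 1) = T i := by
  simp [linEval_eq_linearCombination]

lemma linEval_famComp (T : Fin m → Fin N → F) (g : (Fin m → F) ≃ₗ[F] (Fin m → F))
    (α : Fin m → F) : linEval (famComp T g) α = linEval T (g α) := by
  have h := LinearMap.pi_apply_eq_sum_univ
    ((Fintype.linearCombination F T).comp (g : (Fin m → F) →ₗ[F] (Fin m → F))) α
  simp only [LinearMap.comp_apply, LinearEquiv.coe_coe, ← linEval_eq_linearCombination] at h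
  rw [h, linEval]
  refine Finset.sum_congr rfl fun i _ => ?_
  have : (fun j => if i = j then (1 : F) else 0) = Pi.single i 1 := by
    ext j; simp [Pi.single_apply, eq_comm]
  rw [this, famComp]

lemma fam_ext {T T' : Fin m → Fin N → F} (h : ∀ α, linEval T α = linEval T' α) : T = T' := by
  funext i
  rw [← linEval_single T, h, linEval_single]

/-- Composition with `g` as a permutation of the families. -/
def famCompEquiv (N : ℕ) (g : (Fin m → F) ≃ₗ[F] (Fin m → F)) :
    (Fin m → Fin N → F) ≃ (Fin m → Fin N → F) where
  toFun T := famComp T g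
  invFun T := famComp T g.symm
  left_inv T := fam_ext fun α => by simp [linEval_famComp]
  right_inv T := fam_ext fun α => by simp [linEval_famComp]

lemma sum_famComp [Fintype F] {M : Type} [AddCommMonoid M] (g : (Fin m → F) ≃ₗ[F] (Fin m → F))
    (h : (Fin m → Fin N → F) → M) : ∑ T, h (famComp T g) = ∑ T, h T :=
  Equiv.sum_comp (famCompEquiv N g) h

/-- Linear automorphisms preserving the zeroth coordinate. -/
def FixesHead (g : (Fin (k + 1) → F) ≃ₗ[F] (Fin (k + 1) → F)) : Prop := ∀ β, g β 0 = β 0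

lemma flatInd_famComp (A : Set (AffineSubspace F (Fin N → F))) (T : Fin (k + 1) → Fin N → F)
    {g : (Fin (k + 1) → F) ≃ₗ[F] (Fin (k + 1) → F)} (hg : FixesHead g) :
    flatInd A (famComp T g) = flatInd A T := by
  have hg' : ∀ β, g.symm β 0 = β 0 := fun β => by
    conv_rhs => rw [← g.apply_symm_apply β, hg]
  have h1 : LinearIndependent F (Fin.tail (famComp T g)) ↔ LinearIndependent F (Fin.tail T) := by
    simp only [linearIndependent_tail_iff, linEval_famComp]
    constructor
    · intro h β h0 hβ
      have := h (g.symm β) (by rw [hg', h0]) (by rwa [g.apply_symm_apply])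
      simpa using this
    · intro h β h0 hβ
      have := h (g β) (by rw [hg, h0]) hβ
      simpa using this
  have h2 : frameFlat (famComp T g) = frameFlat T := by
    refine frameFlat_ext fun v => ?_
    simp only [mem_frameFlat, linEval_famComp]
    have hc : ∀ β : Fin (k + 1) → F, β 0 = 1 → Fin.cons 1 (Fin.tail β) = β := fun β hβ => by
      rw [← hβ, Fin.cons_self_tail]
    constructor
    · rintro ⟨w, hw⟩
      exact ⟨Fin.tail (g (Fin.cons 1 w)), by rw [hc _ (by rw [hg, Fin.cons_zero]), hw]⟩
    · rintro ⟨w, hw⟩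
      exact ⟨Fin.tail (g.symm (Fin.cons 1 w)), by
        rw [hc _ (by rw [hg', Fin.cons_zero]), g.apply_symm_apply, hw]⟩
  rw [flatInd, flatInd, h1, h2]

/-- The map `β ↦ β + (τ ⬝ β) w`. -/
def shearMap (τ w : Fin m → F) : (Fin m → F) →ₗ[F] (Fin m → F) where
  toFun β := β + dotProduct τ β • w
  map_add' β γ := by rw [dotProduct_add, add_smul]; abel
  map_smul' c β := by simp [smul_smul]

lemma shearMap_injective {τ w : Fin m → F} (h : 1 + dotProduct τ w ≠ 0) :
    Function.Injective (shearMap τ w) := by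
  rw [injective_iff_map_eq_zero]
  intro β hβ
  have hβ' : β + dotProduct τ β • w = 0 := hβ
  have h1 : dotProduct τ β * (1 + dotProduct τ w) = 0 := by
    have := congr_arg (dotProduct τ) hβ'
    rw [dotProduct_add, dotProduct_smul, dotProduct_zero, smul_eq_mul] at this
    linear_combination this
  rcases mul_eq_zero.mp h1 with h2 | h2
  · rwa [h2, zero_smul, add_zero] at hβ'
  · exact absurd h2 h

lemma exists_dot_ne_zero {u v : Fin m → F} (hu : u ≠ 0) (hv : v ≠ 0) :
    ∃ x, dotProduct u x ≠ 0 ∧ dotProduct v x ≠ 0 := by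
  obtain ⟨i, hi⟩ := Function.ne_iff.mp hu
  obtain ⟨j, hj⟩ := Function.ne_iff.mp hv
  rw [Pi.zero_apply] at hi hj
  by_cases h1 : v i = 0
  · by_cases h2 : u j = 0
    · exact ⟨Pi.single i 1 + Pi.single j 1, by simp [dotProduct_add, h1, h2, hi, hj]⟩
    · exact ⟨Pi.single j 1, by simp [h2, hj]⟩
  · exact ⟨Pi.single i 1, by simp [h1, hi]⟩

lemma exists_dot_eq_one_ne_zero {u v : Fin m → F} (hu : u ≠ 0) (hv : v ≠ 0) :
    ∃ x, dotProduct u x = 1 ∧ dotProduct v x ≠ 0 := by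
  obtain ⟨x, h1, h2⟩ := exists_dot_ne_zero hu hv
  refine ⟨(dotProduct u x)⁻¹ • x, ?_, ?_⟩
  · rw [dotProduct_smul, smul_eq_mul, inv_mul_cancel₀ h1]
  · rw [dotProduct_smul, smul_eq_mul]
    exact mul_ne_zero (inv_ne_zero h1) h2

lemma exists_fixesHead_map {α α' : Fin (k + 1) → F} (hα : α ≠ 0) (hα' : α' ≠ 0)
    (h0 : α 0 = α' 0) : ∃ g : (Fin (k + 1) → F) ≃ₗ[F] (Fin (k + 1) → F),
      FixesHead g ∧ g α = α' := by
  obtain ⟨τ, h1, h2⟩ := exists_dot_eq_one_ne_zero hα hα'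
  rw [dotProduct_comm] at h1 h2
  have h3 : 1 + dotProduct τ (α' - α) ≠ 0 := by
    rw [dotProduct_sub, h1]
    simpa using h2
  refine ⟨LinearEquiv.ofInjectiveEndo _ (shearMap_injective h3), fun β => ?_, ?_⟩
  · simp [shearMap, h0]
  · simp [shearMap, h1]

lemma exists_fixesHead_dual {a a' : Fin (k + 1) → F} (ha : Fin.tail a ≠ 0)
    (ha' : Fin.tail a' ≠ 0) : ∃ g : (Fin (k + 1) → F) ≃ₗ[F] (Fin (k + 1) → F),
      FixesHead g ∧ ∀ β, dotProduct a (g β) = dotProduct a' β := by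
  obtain ⟨x, h1, h2⟩ := exists_dot_eq_one_ne_zero ha ha'
  have hdot : ∀ c : Fin (k + 1) → F, dotProduct c (Fin.cons 0 x) = dotProduct (Fin.tail c) x := by
    intro c
    simp [dotProduct, Fin.sum_univ_succ, Fin.tail]
  have h3 : 1 + dotProduct (a' - a) (Fin.cons 0 x) ≠ 0 := by
    rw [sub_dotProduct, hdot, hdot, h1]
    simpa using h2
  refine ⟨LinearEquiv.ofInjectiveEndo _ (shearMap_injective h3), fun β => ?_, fun β => ?_⟩
  · simp [shearMap]
  · simp [shearMap, dotProduct_add, hdot, h1]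

variable [Fintype F]

lemma famCond_eq_of_head_eq {f : (Fin (k + 1) → Fin N → F) → ℝ}
    (hf : ∀ g, FixesHead g → ∀ T, f (famComp T g) = f T) {α α' : Fin (k + 1) → F}
    (hα : α ≠ 0) (hα' : α' ≠ 0) (h0 : α 0 = α' 0) (z : Fin N → F) :
    famCond f α z = famCond f α' z := by
  obtain ⟨g, hg, rfl⟩ := exists_fixesHead_map hα hα' h0
  rw [famCond, ← sum_famComp g, famCond]
  simp_rw [hf g hg, linEval_famComp]

lemma coef_tens_eq_of_head_eq (ψ : AddChar F ℂ) {f : (Fin (k + 1) → Fin N → F) → ℝ}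
    (hf : ∀ g, FixesHead g → ∀ T, f (famComp T g) = f T) {α α' : Fin (k + 1) → F}
    (hα : α ≠ 0) (hα' : α' ≠ 0) (h0 : α 0 = α' 0) (b : Fin N → F) :
    coef ψ f (tens α b) = coef ψ f (tens α' b) := by
  obtain ⟨g, hg, rfl⟩ := exists_fixesHead_map hα hα' h0
  rw [coef, ← sum_famComp g, coef]
  simp_rw [hf g hg, famPair_tens_left, linEval_famComp]

lemma correlation_eq {f : (Fin (k + 1) → Fin N → F) → ℝ}
    (hf : ∀ g, FixesHead g → ∀ T, f (famComp T g) = f T) {a a' : Fin (k + 1) → F}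
    (ha : Fin.tail a ≠ 0) (ha' : Fin.tail a' ≠ 0) :
    ∑ T, ∑ u : Fin N → F, f T * f (T + tens a u) =
      ∑ T, ∑ u : Fin N → F, f T * f (T + tens a' u) := by
  obtain ⟨g, hg, hga⟩ := exists_fixesHead_dual ha ha'
  rw [← sum_famComp g (fun T => ∑ u : Fin N → F, f T * f (T + tens a' u))]
  refine Finset.sum_congr rfl fun T _ => Finset.sum_congr rfl fun u _ => ?_
  have h1 : famComp T g + tens a' u = famComp (T + tens a u) g := by
    refine fam_ext fun α => ?_
    rw [linEval_famComp, linEval_add_tens, linEval_add_tens, linEval_famComp, hga]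
  rw [h1, hf g hg, hf g hg]

end Invariance

section Bounds

open scoped Classical

variable {F : Type} [Field F] {N k : ℕ}

lemma dotProduct_linEval_cons (b : Fin N → F) (T : Fin (k + 1) → Fin N → F) (s : F)
    (w : Fin k → F) : dotProduct b (linEval T (Fin.cons s w)) =
      dotProduct b (s • T 0) + dotProduct (fun i : Fin k => dotProduct b (T i.succ)) w := by
  rw [linEval_cons, dotProduct_add, dotProduct_sum, dotProduct_comm _ w]
  simp_rw [dotProduct_smul]
  rfl

lemma tens_eq_zero {m : ℕ} {α : Fin m → F} {b : Fin N → F} (h : tens α b = 0) :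
    α = 0 ∨ b = 0 := by
  by_contra! hne
  obtain ⟨i, hi⟩ := Function.ne_iff.mp hne.1
  obtain ⟨j, hj⟩ := Function.ne_iff.mp hne.2
  have := congr_fun (congr_fun h i) j
  simp only [tens, Pi.smul_apply, smul_eq_mul, Pi.zero_apply] at this hi hj
  exact (mul_ne_zero hi hj) this

variable [Fintype F]

lemma exists_isPrimitive (F : Type) [Field F] [Fintype F] :
    ∃ ψ : AddChar F ℂ, ψ.IsPrimitive := by
  obtain ⟨ψ, hψ⟩ := (AddChar.exists_apply_ne_zero (a := (1 : F))).mpr one_ne_zero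
  refine ⟨ψ, AddChar.IsPrimitive.of_ne_one ?_⟩
  rintro rfl
  exact hψ rfl

lemma sum_char_linEval_cons {ψ : AddChar F ℂ} (hψ : ψ.IsPrimitive) (b : Fin N → F)
    (T : Fin (k + 1) → Fin N → F) (s : F) :
    ∑ w : Fin k → F, ψ (-dotProduct b (linEval T (Fin.cons s w))) =
      ψ (-dotProduct b (s • T 0)) *
        if ∀ i : Fin k, dotProduct b (T i.succ) = 0 then (Fintype.card F : ℂ) ^ k else 0 := by
  have h : ∀ w : Fin k → F, ψ (-dotProduct b (linEval T (Fin.cons s w))) =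
      ψ (-dotProduct b (s • T 0)) *
        ψ (dotProduct (-fun i : Fin k => dotProduct b (T i.succ)) w) := fun w => by
    rw [dotProduct_linEval_cons, neg_add, AddChar.map_add_eq_mul, neg_dotProduct]
  simp_rw [h]
  rw [← Finset.mul_sum, sum_char_dot hψ]
  congr 1
  refine if_congr ?_ rfl rfl
  rw [neg_eq_zero, funext_iff]
  rfl

/-- The mean of `f` over families whose tail is orthogonal to `b`, not normalized. -/
def annMean (f : (Fin (k + 1) → Fin N → F) → ℝ) (b : Fin N → F) : ℝ :=
  famMean fun T => if ∀ i : Fin k, dotProduct b (T i.succ) = 0 then f T else 0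

lemma sum_coef_cons {ψ : AddChar F ℂ} (hψ : ψ.IsPrimitive) (f : (Fin (k + 1) → Fin N → F) → ℝ)
    (b : Fin N → F) (s : F) :
    ∑ w : Fin k → F, coef ψ f (tens (Fin.cons s w) b) =
      (Fintype.card (Fin (k + 1) → Fin N → F) : ℂ)⁻¹ * ∑ T, (f T : ℂ) *
        (ψ (-dotProduct b (s • T 0)) *
          if ∀ i : Fin k, dotProduct b (T i.succ) = 0 then (Fintype.card F : ℂ) ^ k else 0) := by
  simp_rw [coef, famPair_tens_left, ← Finset.mul_sum]
  rw [Finset.sum_comm]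
  simp_rw [← Finset.mul_sum, sum_char_linEval_cons hψ]

lemma norm_sum_coef_cons_le {ψ : AddChar F ℂ} (hψ : ψ.IsPrimitive)
    {f : (Fin (k + 1) → Fin N → F) → ℝ} (hf : ∀ T, 0 ≤ f T) (b : Fin N → F) (s : F) :
    ‖∑ w : Fin k → F, coef ψ f (tens (Fin.cons s w) b)‖ ≤
      (Fintype.card F : ℝ) ^ k * annMean f b := by
  rw [sum_coef_cons hψ, norm_mul, annMean, famMean, mul_left_comm]
  have h1 : ‖(Fintype.card (Fin (k + 1) → Fin N → F) : ℂ)⁻¹‖ =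
      (Fintype.card (Fin (k + 1) → Fin N → F) : ℝ)⁻¹ := by
    rw [norm_inv, Complex.norm_natCast]
  rw [h1, Finset.mul_sum]
  refine mul_le_mul_of_nonneg_left ((norm_sum_le _ _).trans (Finset.sum_le_sum fun T _ => ?_))
    (by positivity)
  rw [norm_mul, norm_mul, AddChar.norm_apply, one_mul, Complex.norm_of_nonneg (hf T), mul_comm]
  split_ifs
  · simp
  · simp

lemma norm_coef_tens_le {ψ : AddChar F ℂ} (hψ : ψ.IsPrimitive)
    {f : (Fin (k + 1) → Fin N → F) → ℝ} (hf : ∀ T, 0 ≤ f T)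
    (hinv : ∀ g, FixesHead g → ∀ T, f (famComp T g) = f T) (hk : 1 ≤ k) {ξ : ℝ}
    (hν : famMean f ≤ ξ) {b : Fin N → F}
    (hb : (Fintype.card F : ℝ) ^ k * annMean f b ≤ ξ) {α : Fin (k + 1) → F} (hα : α ≠ 0) :
    ‖coef ψ f (tens α b)‖ ≤ 4 * ξ / (Fintype.card F : ℝ) ^ k := by
  have hq : (2 : ℝ) ≤ Fintype.card F := by exact_mod_cast Fintype.one_lt_card (α := F)
  have hqk : (2 : ℝ) ≤ (Fintype.card F : ℝ) ^ k :=
    hq.trans (le_self_pow₀ (by linarith) (by omega))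
  have hν0 : 0 ≤ famMean f :=
    mul_nonneg (by positivity) (Finset.sum_nonneg fun T _ => hf T)
  have hS := (norm_sum_coef_cons_le hψ hf b (α 0)).trans hb
  have hcard : (Fintype.card (Fin k → F) : ℝ) = (Fintype.card F : ℝ) ^ k := by simp
  rw [le_div_iff₀ (by positivity)]
  have hn := norm_nonneg (coef ψ f (tens α b))
  by_cases h0 : α 0 = 0
  · have h1 : ∀ w ∈ (univ : Finset (Fin k → F)).erase 0,
        coef ψ f (tens (Fin.cons (α 0) w) b) = coef ψ f (tens α b) := fun w hw => by
      refine coef_tens_eq_of_head_eq ψ hinv (fun h => (Finset.mem_erase.mp hw).1 ?_) hα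
        (by simp) b
      funext i
      simpa using congr_fun h i.succ
    have h2 : (Fin.cons (α 0) 0 : Fin (k + 1) → F) = 0 := by
      rw [h0]
      exact funext fun i => Fin.cases rfl (fun _ => rfl) i
    have h3 : tens (0 : Fin (k + 1) → F) b = 0 := by ext; simp [tens]
    rw [← Finset.add_sum_erase _ _ (Finset.mem_univ (0 : Fin k → F)), Finset.sum_congr rfl h1,
      h2, h3, coef_zero, Finset.sum_const, Finset.card_erase_of_mem (Finset.mem_univ _),
      Finset.card_univ, nsmul_eq_mul, Nat.cast_sub Fintype.card_pos] at hS
    have h4 : ‖((Fintype.card (Fin k → F) : ℂ) - 1) * coef ψ f (tens α b)‖ =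
        ((Fintype.card F : ℝ) ^ k - 1) * ‖coef ψ f (tens α b)‖ := by
      rw [norm_mul, ← hcard]
      congr 1
      have h5 : ((Fintype.card (Fin k → F) : ℂ) - 1) =
        (((Fintype.card (Fin k → F) : ℝ) - 1 : ℝ) : ℂ) := by push_cast; rfl
      rw [h5, Complex.norm_of_nonneg]
      rw [hcard]
      linarith
    have h6 := norm_sub_le ((famMean f : ℂ) + ((Fintype.card (Fin k → F) : ℂ) - 1) *
      coef ψ f (tens α b)) (famMean f : ℂ)
    rw [add_sub_cancel_left, Complex.norm_of_nonneg hν0, h4] at h6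
    rw [Nat.cast_one] at hS
    nlinarith
  · have h1 : ∀ w ∈ (univ : Finset (Fin k → F)),
        coef ψ f (tens (Fin.cons (α 0) w) b) = coef ψ f (tens α b) := fun w _ => by
      refine coef_tens_eq_of_head_eq ψ hinv (fun h => h0 ?_) hα (by simp) b
      simpa using congr_fun h 0
    rw [Finset.sum_congr rfl h1, Finset.sum_const, Finset.card_univ, nsmul_eq_mul, norm_mul,
      Complex.norm_natCast, hcard] at hS
    nlinarith

lemma sum_ann_eq {b : Fin N → F} (hb : b ≠ 0) :
    (Fintype.card F : ℝ) ^ k * annMean (fun _ : Fin (k + 1) → Fin N → F => (1 : ℝ)) b = 1 := by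
  obtain ⟨ψ, hψ⟩ := exists_isPrimitive F
  have hG : (Fintype.card (Fin (k + 1) → Fin N → F) : ℂ) ≠ 0 :=
    Nat.cast_ne_zero.mpr Fintype.card_ne_zero
  have h1 := sum_coef_cons (k := k) hψ (fun _ => (1 : ℝ)) b 0
  have h2 : ∀ w : Fin k → F, coef ψ (fun _ => (1 : ℝ))
      (tens (Fin.cons 0 w : Fin (k + 1) → F) b) = if w = 0 then 1 else 0 := by
    intro w
    have h3 : ∀ T, ψ (-famPair (tens (Fin.cons 0 w : Fin (k + 1) → F) b) T) =
        ψ (famPair (tens (Fin.cons 0 w) (-b)) T) := fun T => by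
      rw [famPair_tens_left, famPair_tens_left, neg_dotProduct]
    simp only [coef, h3, Complex.ofReal_one, one_mul, sum_char_famPair hψ]
    by_cases hw : w = 0
    · have h4 : tens (Fin.cons 0 w : Fin (k + 1) → F) (-b) = 0 := by
        ext i j
        refine Fin.cases ?_ (fun i => ?_) i <;> simp [tens, hw]
      rw [if_pos h4, if_pos hw, inv_mul_cancel₀ hG]
    · have h4 : tens (Fin.cons 0 w : Fin (k + 1) → F) (-b) ≠ 0 := by
        intro h
        rcases tens_eq_zero h with h | h
        · exact hw (funext fun i => by simpa using congr_fun h i.succ)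
        · exact hb (neg_eq_zero.mp h)
      rw [if_neg h4, if_neg hw, mul_zero]
  simp only [h2, Finset.sum_ite_eq', Finset.mem_univ, if_true, zero_smul, dotProduct_zero, neg_zero,
    AddChar.map_zero_eq_one, one_mul, Complex.ofReal_one] at h1
  have h5 : (((Fintype.card F : ℝ) ^ k *
      annMean (fun _ : Fin (k + 1) → Fin N → F => (1 : ℝ)) b : ℝ) : ℂ) = 1 := by
    rw [h1, annMean, famMean, mul_left_comm, Finset.mul_sum]
    push_cast
    congr 1
    refine Finset.sum_congr rfl fun T _ => ?_
    split_ifs <;> simp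
  exact_mod_cast h5

lemma famMean_mono {m : ℕ} {f g : (Fin m → Fin N → F) → ℝ} (h : ∀ T, f T ≤ g T) :
    famMean f ≤ famMean g :=
  mul_le_mul_of_nonneg_left (Finset.sum_le_sum fun T _ => h T) (by positivity)

lemma famMean_flatInd_inter_le {A C : Set (AffineSubspace F (Fin N → F))}
    (hC : C ⊆ {U | IsFlat k U}) {θ : ℝ} (h : dens A C ≤ θ) :
    famMean (flatInd (k := k) (A ∩ C)) ≤ θ * famMean (flatInd (k := k) C) := by
  rw [famMean, famMean, mul_left_comm]
  exact mul_le_mul_of_nonneg_left (sum_flatInd_inter_le k hC h) (by positivity)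

lemma annMean_flatInd_le {A : Set (AffineSubspace F (Fin N → F))} {ξ : ℝ} (hξ : 0 ≤ ξ)
    (h : ∀ W₀ : Submodule F (Fin N → F), Module.finrank F W₀ = N - 1 →
      dens A {U | IsFlat k U ∧ U.direction ≤ W₀} ≤ ξ) {b : Fin N → F} (hb : b ≠ 0) :
    (Fintype.card F : ℝ) ^ k * annMean (flatInd (k := k) A) b ≤ ξ := by
  set φ : (Fin N → F) →ₗ[F] F := dotProductBilin F F b with hφ
  have hφ0 : φ ≠ 0 := by
    intro h0
    obtain ⟨i, hi⟩ := Function.ne_iff.mp hb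
    have := LinearMap.congr_fun h0 (Pi.single i 1)
    simp [hφ] at this
    exact hi this
  have hrank := Module.Dual.finrank_ker_add_one_of_ne_zero hφ0
  rw [Module.finrank_fin_fun] at hrank
  have hd := h (LinearMap.ker φ) (by omega)
  set C : Set (AffineSubspace F (Fin N → F)) :=
    {U | IsFlat k U ∧ U.direction ≤ LinearMap.ker φ} with hC
  have hmem : ∀ T : Fin (k + 1) → Fin N → F, LinearIndependent F (Fin.tail T) →
      (frameFlat T ∈ C ↔ ∀ i : Fin k, dotProduct b (T i.succ) = 0) := by
    intro T hT
    rw [hC, Set.mem_ofPred_eq, and_iff_right (isFlat_frameFlat hT), frameFlat_direction,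
      Submodule.span_le, Set.range_subset_iff]
    rfl
  have h1 : annMean (flatInd (k := k) A) b = famMean (flatInd (k := k) (A ∩ C)) := by
    rw [annMean]
    congr 1
    funext T
    rw [flatInd_inter]
    by_cases hT : LinearIndependent F (Fin.tail T)
    · simp only [hmem T hT]
    · simp [flatInd, hT]
  have h2 : famMean (flatInd (k := k) C) ≤
      annMean (fun _ : Fin (k + 1) → Fin N → F => (1 : ℝ)) b := by
    refine famMean_mono fun T => ?_
    rw [flatInd]
    by_cases hT : LinearIndependent F (Fin.tail T)
    · simp only [hmem T hT, hT, true_and]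
      split_ifs <;> simp
    · rw [if_neg (fun h => hT h.1)]
      split_ifs <;> simp
  have h3 := famMean_flatInd_inter_le (k := k) (fun U hU => hU.1) hd
  rw [h1]
  calc _ ≤ (Fintype.card F : ℝ) ^ k *
        (ξ * annMean (fun _ : Fin (k + 1) → Fin N → F => (1 : ℝ)) b) :=
          mul_le_mul_of_nonneg_left (h3.trans (mul_le_mul_of_nonneg_left h2 hξ)) (by positivity)
    _ = ξ := by rw [mul_left_comm, sum_ann_eq hb, mul_one]

lemma famCond_one {m : ℕ} {α : Fin m → F} (hα : α ≠ 0) (z : Fin N → F) :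
    famCond (fun _ => (1 : ℝ)) α z = 1 := by
  obtain ⟨ψ, hψ⟩ := exists_isPrimitive F
  have hG : (Fintype.card (Fin m → Fin N → F) : ℂ) ≠ 0 :=
    Nat.cast_ne_zero.mpr Fintype.card_ne_zero
  have h2 : ∀ b : Fin N → F, coef ψ (fun _ => (1 : ℝ)) (tens α b) = if b = 0 then 1 else 0 := by
    intro b
    have h3 : ∀ T, ψ (-famPair (tens α b) T) = ψ (famPair (tens α (-b)) T) := fun T => by
      rw [famPair_tens_left, famPair_tens_left, neg_dotProduct]
    simp only [coef, h3, Complex.ofReal_one, one_mul, sum_char_famPair hψ]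
    by_cases hb : b = 0
    · rw [if_pos (by rw [hb, neg_zero, tens_zero]), if_pos hb, inv_mul_cancel₀ hG]
    · rw [if_neg (fun h => (tens_eq_zero h).elim hα fun h => hb (neg_eq_zero.mp h)), if_neg hb,
        mul_zero]
  have h1 := famCond_eq_sum hψ (fun _ => (1 : ℝ)) α z
  simp only [h2, ite_mul, one_mul, zero_mul, Finset.sum_ite_eq', Finset.mem_univ, if_true,
    zero_dotProduct, AddChar.map_zero_eq_one] at h1
  exact_mod_cast h1

lemma famCond_mono {m : ℕ} {f g : (Fin m → Fin N → F) → ℝ} (h : ∀ T, f T ≤ g T)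
    (α : Fin m → F) (z : Fin N → F) : famCond f α z ≤ famCond g α z := by
  refine mul_le_mul_of_nonneg_left (Finset.sum_le_sum fun T _ => ?_) (by positivity)
  split_ifs
  exacts [h T, le_rfl]

/-- The flats containing `z`, scaled by `s⁻¹`; for `s = 0`, those with direction containing
the nonzero vector `z`. -/
def incidentFlats (k : ℕ) (s : F) (z : Fin N → F) : Set (AffineSubspace F (Fin N → F)) :=
  {U | IsFlat k U ∧ if s = 0 then z ≠ 0 ∧ z ∈ U.direction else s⁻¹ • z ∈ U}

omit [Fintype F] in
lemma frameFlat_mem_incidentFlats {T : Fin (k + 1) → Fin N → F}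
    (hT : LinearIndependent F (Fin.tail T)) (s : F) (z : Fin N → F) :
    frameFlat T ∈ incidentFlats k s z ↔
      ∃ w : Fin k → F, (Fin.cons s w : Fin (k + 1) → F) ≠ 0 ∧ linEval T (Fin.cons s w) = z := by
  rw [incidentFlats, Set.mem_ofPred_eq, and_iff_right (isFlat_frameFlat hT)]
  split_ifs with hs
  · subst hs
    rw [mem_frameFlat_direction]
    constructor
    · rintro ⟨hz, w, rfl⟩
      refine ⟨w, fun h => hz ?_, rfl⟩
      rw [h, linEval_zero]
    · rintro ⟨w, hw, rfl⟩
      refine ⟨fun h => hw ?_, w, rfl⟩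
      exact linearIndependent_tail_iff.mp hT _ rfl h
  · rw [mem_frameFlat]
    have hcons : ∀ (c : F) (w : Fin k → F), c • (Fin.cons s w : Fin (k + 1) → F) =
        Fin.cons (c * s) (c • w) := fun c w =>
      funext fun i => Fin.cases rfl (fun _ => rfl) i
    constructor
    · rintro ⟨w, hw⟩
      refine ⟨s • w, fun h => hs (congr_fun h 0), ?_⟩
      have : (Fin.cons s (s • w) : Fin (k + 1) → F) = s • Fin.cons 1 w :=
        funext fun i => Fin.cases (by simp) (fun _ => rfl) i
      rw [this, linEval_smul, hw, smul_inv_smul₀ hs]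
    · rintro ⟨w, -, rfl⟩
      refine ⟨s⁻¹ • w, ?_⟩
      rw [← linEval_smul, hcons, inv_mul_cancel₀ hs]

lemma sum_cons_flatInd (A : Set (AffineSubspace F (Fin N → F))) (T : Fin (k + 1) → Fin N → F)
    (s : F) (z : Fin N → F) :
    ∑ w ∈ univ.filter (fun w : Fin k → F => (Fin.cons s w : Fin (k + 1) → F) ≠ 0),
      (if linEval T (Fin.cons s w) = z then flatInd A T else 0) =
      flatInd (A ∩ incidentFlats k s z) T := by
  rw [flatInd_inter]
  by_cases hT : LinearIndependent F (Fin.tail T)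
  · rw [if_congr (frameFlat_mem_incidentFlats hT s z) rfl rfl]
    split_ifs with h
    · obtain ⟨w, hw, hz⟩ := h
      rw [Finset.sum_eq_single_of_mem w (by simpa using hw), if_pos hz]
      intro w' _ hne
      refine if_neg fun h => hne ?_
      have h1 := linearIndependent_tail_iff.mp hT (Fin.cons s w' - Fin.cons s w) (by simp)
        (by rw [linEval_sub, h, hz, sub_self])
      funext i
      simpa [sub_eq_zero] using congr_fun h1 i.succ
    · refine Finset.sum_eq_zero fun w hw => if_neg fun h' => h ⟨w, ?_, h'⟩
      simpa using hw
  · have : flatInd A T = 0 := if_neg fun h => hT h.1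
    simp [this]

lemma card_mul_famCond_flatInd (A : Set (AffineSubspace F (Fin N → F)))
    {α : Fin (k + 1) → F} (hα : α ≠ 0) (z : Fin N → F) :
    ((univ.filter fun w : Fin k → F => (Fin.cons (α 0) w : Fin (k + 1) → F) ≠ 0).card : ℝ) *
      famCond (flatInd (k := k) A) α z =
      (Fintype.card F : ℝ) ^ N * famMean (flatInd (k := k) (A ∩ incidentFlats k (α 0) z)) := by
  rw [famMean]
  simp_rw [← sum_cons_flatInd]
  rw [Finset.sum_comm, ← nsmul_eq_mul, ← Finset.sum_const, Finset.mul_sum, Finset.mul_sum]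
  refine Finset.sum_congr rfl fun w hw => ?_
  rw [famCond_eq_of_head_eq (fun g hg T => flatInd_famComp A T hg) hα
    (Finset.mem_filter.mp hw).2 (by simp) z, famCond, mul_assoc]

lemma famCond_flatInd_le {A : Set (AffineSubspace F (Fin N → F))}
    {α : Fin (k + 1) → F} (hα : α ≠ 0) {z : Fin N → F} {θ : ℝ} (hθ : 0 ≤ θ)
    (h : dens A (incidentFlats k (α 0) z) ≤ θ) :
    famCond (flatInd (k := k) A) α z ≤ θ := by
  have h1 := card_mul_famCond_flatInd A hα z
  have h2 := card_mul_famCond_flatInd (Set.univ) hα z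
  rw [Set.univ_inter] at h2
  have h3 := famMean_flatInd_inter_le (k := k) (fun U hU => hU.1) h
  have h4 : famCond (flatInd (k := k) (Set.univ)) α z ≤ 1 :=
    (famCond_mono (fun T => flatInd_le_one _ T) α z).trans (famCond_one hα z).le
  have hpos : 0 < (univ.filter fun w : Fin k → F =>
      (Fin.cons (α 0) w : Fin (k + 1) → F) ≠ 0).card := by
    refine Finset.card_pos.mpr ⟨Fin.tail α, ?_⟩
    simpa using hα
  have hpos' : (0 : ℝ) < (univ.filter fun w : Fin k → F =>
      (Fin.cons (α 0) w : Fin (k + 1) → F) ≠ 0).card := by exact_mod_cast hpos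
  set c : ℝ := ((univ.filter fun w : Fin k → F =>
      (Fin.cons (α 0) w : Fin (k + 1) → F) ≠ 0).card : ℝ)
  have hqN : (0 : ℝ) ≤ (Fintype.card F : ℝ) ^ N := by positivity
  refine le_of_mul_le_mul_left ?_ hpos'
  calc c * famCond (flatInd (k := k) A) α z
      ≤ (Fintype.card F : ℝ) ^ N * (θ * famMean (flatInd (k := k) (incidentFlats k (α 0) z))) := by
        rw [h1]; gcongr
    _ = θ * (c * famCond (flatInd (k := k) (Set.univ)) α z) := by rw [h2]; ring
    _ ≤ θ * (c * 1) := by gcongr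
    _ = c * θ := by ring

end Bounds

section Expansion

open scoped Classical

variable {F : Type} [Field F] {N k : ℕ}

lemma eq_of_le_of_isFlat {U V : AffineSubspace F (Fin N → F)} (hle : U ≤ V) (hU : IsFlat k U)
    (hV : IsFlat k V) : U = V :=
  AffineSubspace.eq_of_direction_eq_of_nonempty_of_le
    (Submodule.eq_of_le_of_finrank_eq (AffineSubspace.direction_le hle) (hU.2.trans hV.2.symm))
    hU.1 hle

lemma frameFlat_le {T : Fin (k + 1) → Fin N → F} {U : AffineSubspace F (Fin N → F)}
    (h0 : T 0 ∈ U) (h : ∀ i, Fin.tail T i ∈ U.direction) : frameFlat T ≤ U := by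
  rw [← AffineSubspace.mk'_eq h0, frameFlat, AffineSubspace.mk'_le_mk'_iff, Submodule.span_le]
  rintro _ ⟨i, rfl⟩
  exact h i

omit [Field F] in
lemma tail_snoc (T : Fin (k + 1) → Fin N → F) (v : Fin N → F) :
    Fin.tail (Fin.snoc T v : Fin (k + 2) → Fin N → F) =
      (Fin.snoc (Fin.tail T) v : Fin (k + 1) → Fin N → F) := by
  funext i
  refine Fin.lastCases ?_ (fun i => ?_) i
  · rw [Fin.snoc_last, Fin.tail, Fin.succ_last, Fin.snoc_last]
  · rw [Fin.snoc_castSucc, Fin.tail, ← Fin.castSucc_succ, Fin.snoc_castSucc]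
    rfl

lemma frame_snoc_iff {T : Fin (k + 1) → Fin N → F} {v : Fin N → F}
    {U : AffineSubspace F (Fin N → F)} :
    (LinearIndependent F (Fin.tail (Fin.snoc T v : Fin (k + 2) → Fin N → F)) ∧
      frameFlat (Fin.snoc T v : Fin (k + 2) → Fin N → F) = U) ↔
    (LinearIndependent F (Fin.tail T) ∧ IsFlat (k + 1) U ∧ frameFlat T ≤ U) ∧
      v ∈ U.direction ∧ v ∉ (frameFlat T).direction := by
  have h0 : (Fin.snoc T v : Fin (k + 2) → Fin N → F) 0 = T 0 := Fin.snoc_apply_zero _ _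
  rw [frameFlat_direction T]
  constructor
  · rintro ⟨hT, rfl⟩
    have hdir : ∀ i, (Fin.snoc (Fin.tail T) v : Fin (k + 1) → Fin N → F) i ∈
        (frameFlat (Fin.snoc T v : Fin (k + 2) → Fin N → F)).direction := fun i => by
      rw [frameFlat_direction, tail_snoc]
      exact Submodule.subset_span ⟨i, rfl⟩
    refine ⟨⟨?_, isFlat_frameFlat hT, frameFlat_le ?_ fun i => ?_⟩, ?_, ?_⟩
    · rw [tail_snoc, linearIndependent_finSnoc] at hT
      exact hT.1
    · rw [← h0]
      exact AffineSubspace.self_mem_mk' _ _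
    · simpa using hdir i.castSucc
    · simpa using hdir (Fin.last k)
    · rw [tail_snoc, linearIndependent_finSnoc] at hT
      exact hT.2
  · rintro ⟨⟨hT, hU, hle⟩, hv, hv'⟩
    have hT' : LinearIndependent F (Fin.tail (Fin.snoc T v : Fin (k + 2) → Fin N → F)) := by
      rw [tail_snoc, linearIndependent_finSnoc]
      exact ⟨hT, hv'⟩
    refine ⟨hT', eq_of_le_of_isFlat (frameFlat_le ?_ fun i => ?_) (isFlat_frameFlat hT') hU⟩
    · rw [h0]
      exact hle (AffineSubspace.self_mem_mk' _ _)
    · rw [tail_snoc]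
      refine Fin.lastCases ?_ (fun i => ?_) i
      · rwa [Fin.snoc_last]
      · rw [Fin.snoc_castSucc]
        refine AffineSubspace.direction_le hle ?_
        rw [frameFlat_direction]
        exact Submodule.subset_span ⟨i, rfl⟩

lemma isFlat_and_le_iff {U V : AffineSubspace F (Fin N → F)} (hU : IsFlat (k + 1) U)
    (hV : IsFlat (k + 1) V) (hne : U ≠ V) (D : AffineSubspace F (Fin N → F)) :
    (IsFlat k D ∧ D ≤ U ∧ D ≤ V) ↔ (adjGras (k + 1) U V ∧ D = U ⊓ V) := by
  constructor
  · rintro ⟨hD, h1, h2⟩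
    have hle : D ≤ U ⊓ V := le_inf h1 h2
    have hnon : ((U ⊓ V : AffineSubspace F (Fin N → F)) : Set (Fin N → F)).Nonempty :=
      hD.1.mono hle
    have h3 : k ≤ Module.finrank F (U ⊓ V).direction := by
      rw [← hD.2]
      exact Submodule.finrank_mono (AffineSubspace.direction_le hle)
    have h4 : Module.finrank F (U ⊓ V).direction ≤ k + 1 := by
      rw [← hU.2]
      exact Submodule.finrank_mono (AffineSubspace.direction_le inf_le_left)
    have h5 : Module.finrank F (U ⊓ V).direction ≠ k + 1 := by
      intro h
      have hflat : IsFlat (k + 1) (U ⊓ V) := ⟨hnon, h⟩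
      exact hne ((eq_of_le_of_isFlat inf_le_left hflat hU).symm.trans
        (eq_of_le_of_isFlat inf_le_right hflat hV))
    have hflat : IsFlat k (U ⊓ V) := ⟨hnon, by omega⟩
    exact ⟨⟨hne, hU, hV, by simpa using hflat⟩, eq_of_le_of_isFlat hle hD hflat⟩
  · rintro ⟨h, rfl⟩
    exact ⟨by simpa using h.2.2.2, inf_le_left, inf_le_right⟩

variable [Fintype F]

/-- The number of members of `A` containing the flat `D`. -/
def upDeg (A : Set (AffineSubspace F (Fin N → F))) (D : AffineSubspace F (Fin N → F)) : ℝ :=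
  ∑ U : AffineSubspace F (Fin N → F), if U ∈ A ∧ D ≤ U then 1 else 0

lemma card_direction_sdiff {D U : AffineSubspace F (Fin N → F)} (hD : IsFlat k D)
    (hU : IsFlat (k + 1) U) (hle : D ≤ U) :
    ((univ.filter fun v => v ∈ U.direction ∧ v ∉ D.direction).card : ℝ) =
      (Fintype.card F : ℝ) ^ (k + 1) - (Fintype.card F : ℝ) ^ k := by
  have hcard : ∀ (j : ℕ) (E : AffineSubspace F (Fin N → F)), IsFlat j E →
      (univ.filter fun v => v ∈ E.direction).card = Fintype.card F ^ j := by
    intro j E hE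
    rw [← Fintype.card_subtype, ← Nat.card_eq_fintype_card]
    have := Module.natCard_eq_pow_finrank (K := F) (V := E.direction)
    rw [hE.2, Nat.card_eq_fintype_card (α := F)] at this
    exact this
  have h1 : (univ.filter fun v => v ∈ U.direction ∧ v ∉ D.direction) =
      (univ.filter fun v => v ∈ U.direction) \ (univ.filter fun v => v ∈ D.direction) := by
    ext v
    simp
  have h2 : (univ.filter fun v => v ∈ D.direction) ⊆ univ.filter fun v => v ∈ U.direction := by
    intro v hv
    simp only [Finset.mem_filter, Finset.mem_univ, true_and] at hv ⊢
    exact AffineSubspace.direction_le hle hv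
  rw [h1, Finset.card_sdiff_of_subset h2, Nat.cast_sub (Finset.card_le_card h2), hcard k D hD,
    hcard (k + 1) U hU]
  push_cast
  rfl

lemma sum_flatInd_snoc {A : Set (AffineSubspace F (Fin N → F))}
    (hA : A ⊆ {U | IsFlat (k + 1) U}) (T : Fin (k + 1) → Fin N → F) :
    ∑ v, flatInd A (Fin.snoc T v : Fin (k + 2) → Fin N → F) =
      if LinearIndependent F (Fin.tail T) then
        ((Fintype.card F : ℝ) ^ (k + 1) - (Fintype.card F : ℝ) ^ k) * upDeg A (frameFlat T)
      else 0 := by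
  have h1 : ∀ v, flatInd A (Fin.snoc T v : Fin (k + 2) → Fin N → F) =
      ∑ U : AffineSubspace F (Fin N → F), if U ∈ A ∧
        LinearIndependent F (Fin.tail T) ∧ frameFlat T ≤ U then
          (if v ∈ U.direction ∧ v ∉ (frameFlat T).direction then (1 : ℝ) else 0) else 0 := by
    intro v
    have h2 : ∀ U : AffineSubspace F (Fin N → F), (if U ∈ A ∧
        LinearIndependent F (Fin.tail T) ∧ frameFlat T ≤ U then
          (if v ∈ U.direction ∧ v ∉ (frameFlat T).direction then (1 : ℝ) else 0) else 0) =
        if frameFlat (Fin.snoc T v : Fin (k + 2) → Fin N → F) = U then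
          flatInd A (Fin.snoc T v : Fin (k + 2) → Fin N → F) else 0 := by
      intro U
      have h3 := frame_snoc_iff (T := T) (v := v) (U := U)
      rw [← ite_and, flatInd, ← ite_and]
      refine if_congr ?_ rfl rfl
      constructor
      · rintro ⟨⟨hUA, hT, hle⟩, hv⟩
        obtain ⟨h4, rfl⟩ := h3.mpr ⟨⟨hT, hA hUA, hle⟩, hv⟩
        exact ⟨rfl, h4, hUA⟩
      · rintro ⟨rfl, hT, hUA⟩
        obtain ⟨⟨h4, -, h5⟩, h6⟩ := h3.mp ⟨hT, rfl⟩
        exact ⟨⟨hUA, h4, h5⟩, h6⟩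
    simp_rw [h2]
    simp
  simp_rw [h1]
  rw [Finset.sum_comm]
  split_ifs with hT
  · rw [upDeg, Finset.mul_sum]
    refine Finset.sum_congr rfl fun U _ => ?_
    simp only [hT, true_and]
    split_ifs with h
    · rw [Finset.sum_boole, card_direction_sdiff (isFlat_frameFlat hT) (hA h.1) h.2, mul_one]
    · simp
  · simp [hT]

omit [Field F] in
lemma sum_snoc (h : (Fin (k + 2) → Fin N → F) → ℝ) :
    ∑ T, h T = ∑ T : Fin (k + 1) → Fin N → F, ∑ v, h (Fin.snoc T v) := by
  rw [← (Fin.snocEquiv fun _ : Fin (k + 2) => Fin N → F).sum_comp, Fintype.sum_prod_type,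
    Finset.sum_comm]
  rfl

lemma sum_flatInd_eq {A : Set (AffineSubspace F (Fin N → F))}
    (hA : A ⊆ {U | IsFlat (k + 1) U}) :
    ∑ T : Fin (k + 2) → Fin N → F, flatInd A T = frameCount F k *
      (((Fintype.card F : ℝ) ^ (k + 1) - (Fintype.card F : ℝ) ^ k) *
        ∑ D : AffineSubspace F (Fin N → F), if IsFlat k D then upDeg A D else 0) := by
  rw [sum_snoc]
  simp_rw [sum_flatInd_snoc hA]
  rw [sum_frames (fun D => ((Fintype.card F : ℝ) ^ (k + 1) - (Fintype.card F : ℝ) ^ k) *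
    upDeg A D)]
  simp_rw [Finset.mul_sum, mul_ite, mul_zero]

lemma correlation_last_eq {A : Set (AffineSubspace F (Fin N → F))}
    (hA : A ⊆ {U | IsFlat (k + 1) U}) :
    ∑ T : Fin (k + 2) → Fin N → F, ∑ u : Fin N → F,
      flatInd A T * flatInd A (T + tens (Pi.single (Fin.last (k + 1)) 1) u) = frameCount F k *
      (((Fintype.card F : ℝ) ^ (k + 1) - (Fintype.card F : ℝ) ^ k) ^ 2 *
        ∑ D : AffineSubspace F (Fin N → F), if IsFlat k D then upDeg A D ^ 2 else 0) := by
  rw [sum_snoc]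
  have h1 : ∀ (T : Fin (k + 1) → Fin N → F) (v u : Fin N → F),
      (Fin.snoc T v : Fin (k + 2) → Fin N → F) + tens (Pi.single (Fin.last (k + 1)) 1) u =
        Fin.snoc T (v + u) := by
    intro T v u
    funext i
    refine Fin.lastCases ?_ (fun i => ?_) i
    · simp [tens]
    · simp [tens, (Fin.castSucc_lt_last i).ne]
  have h2 : ∀ (T : Fin (k + 1) → Fin N → F),
      ∑ v : Fin N → F, ∑ u : Fin N → F, flatInd A (Fin.snoc T v : Fin (k + 2) → Fin N → F) *
        flatInd A ((Fin.snoc T v : Fin (k + 2) → Fin N → F) +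
          tens (Pi.single (Fin.last (k + 1)) 1) u) =
      if LinearIndependent F (Fin.tail T) then
        (((Fintype.card F : ℝ) ^ (k + 1) - (Fintype.card F : ℝ) ^ k) * upDeg A (frameFlat T)) ^ 2
      else 0 := by
    intro T
    have h3 := sum_flatInd_snoc hA T
    simp_rw [h1, ← Finset.mul_sum]
    have h4 : ∀ v : Fin N → F,
        ∑ u, flatInd A (Fin.snoc T (v + u) : Fin (k + 2) → Fin N → F) =
        ∑ u, flatInd A (Fin.snoc T u : Fin (k + 2) → Fin N → F) := fun v =>
      Fintype.sum_equiv (Equiv.addLeft v) _ _ fun _ => rfl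
    simp_rw [h4]
    rw [← Finset.sum_mul, h3]
    split_ifs <;> ring
  simp_rw [h2]
  rw [sum_frames (fun D => (((Fintype.card F : ℝ) ^ (k + 1) - (Fintype.card F : ℝ) ^ k) *
    upDeg A D) ^ 2)]
  simp_rw [Finset.mul_sum, mul_ite, mul_zero, mul_pow]

lemma exists_frame {D : AffineSubspace F (Fin N → F)} (hD : IsFlat k D) :
    ∃ T : Fin (k + 1) → Fin N → F, LinearIndependent F (Fin.tail T) ∧ frameFlat T = D := by
  obtain ⟨T, hT⟩ := Finset.card_pos.mp ((card_frames hD).symm ▸ frameCount_pos (F := F) (k := k))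
  exact ⟨T, (Finset.mem_filter.mp hT).2⟩

lemma upDeg_flats {D : AffineSubspace F (Fin N → F)} (hD : IsFlat k D) :
    ((Fintype.card F : ℝ) ^ (k + 1) - (Fintype.card F : ℝ) ^ k) *
      upDeg {U | IsFlat (k + 1) U} D = (Fintype.card F : ℝ) ^ N - (Fintype.card F : ℝ) ^ k := by
  obtain ⟨T, hT, rfl⟩ := exists_frame hD
  have h1 := sum_flatInd_snoc (A := {U | IsFlat (k + 1) U}) (fun U hU => hU) T
  rw [if_pos hT] at h1
  rw [← h1]
  have h2 : ∀ v, flatInd {U | IsFlat (k + 1) U} (Fin.snoc T v : Fin (k + 2) → Fin N → F) =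
      1 - if v ∈ (frameFlat T).direction then 1 else 0 := by
    intro v
    have h3 : (LinearIndependent F (Fin.tail (Fin.snoc T v : Fin (k + 2) → Fin N → F)) ∧
        frameFlat (Fin.snoc T v : Fin (k + 2) → Fin N → F) ∈ {U | IsFlat (k + 1) U}) ↔
        v ∉ (frameFlat T).direction := by
      rw [frameFlat_direction, Set.mem_ofPred_eq,
        and_iff_left_of_imp (fun h => isFlat_frameFlat h), tail_snoc, linearIndependent_finSnoc,
        and_iff_right hT]
    rw [flatInd, if_congr h3 rfl rfl]
    split_ifs <;> simp_all
  simp_rw [h2]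
  rw [Finset.sum_sub_distrib, Finset.sum_boole, Finset.sum_const, Finset.card_univ,
    ← Fintype.card_subtype]
  have := Module.natCard_eq_pow_finrank (K := F) (V := (frameFlat T).direction)
  rw [hD.2, Nat.card_eq_fintype_card (α := F)] at this
  have h4 : Fintype.card {v // v ∈ (frameFlat T).direction} = Fintype.card F ^ k := by
    rw [← this, Nat.card_eq_fintype_card]
  rw [h4]
  simp

/-- The number of ordered adjacent pairs in `A × B`. -/
def edgeCount (k : ℕ) (A B : Set (AffineSubspace F (Fin N → F))) : ℝ :=
  ∑ U : AffineSubspace F (Fin N → F), ∑ V : AffineSubspace F (Fin N → F),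
    if (U ∈ A ∧ V ∈ B) ∧ adjGras k U V then 1 else 0

lemma edgeCount_eq {A B : Set (AffineSubspace F (Fin N → F))} (hAB : A ⊆ B)
    (hB : B ⊆ {U | IsFlat (k + 1) U}) :
    edgeCount (k + 1) A B = ∑ D : AffineSubspace F (Fin N → F),
      if IsFlat k D then upDeg A D * upDeg B D - upDeg A D else 0 := by
  have h1 : ∀ U V : AffineSubspace F (Fin N → F),
      (if (U ∈ A ∧ V ∈ B) ∧ adjGras (k + 1) U V then (1 : ℝ) else 0) =
      ∑ D : AffineSubspace F (Fin N → F), if IsFlat k D then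
        ((if U ∈ A ∧ D ≤ U then (1 : ℝ) else 0) * (if V ∈ B ∧ D ≤ V then 1 else 0) -
          if U = V then (if U ∈ A ∧ D ≤ U then (1 : ℝ) else 0) else 0) else 0 := by
    intro U V
    by_cases hUV : U ∈ A ∧ V ∈ B
    · by_cases hne : U = V
      · subst hne
        rw [if_neg (fun h => h.2.1 rfl)]
        symm
        refine Finset.sum_eq_zero fun D _ => ?_
        simp only [hUV.1, hUV.2, true_and, if_true]
        split_ifs <;> simp
      · have h2 : ∀ D : AffineSubspace F (Fin N → F), (if IsFlat k D then
            ((if U ∈ A ∧ D ≤ U then (1 : ℝ) else 0) * (if V ∈ B ∧ D ≤ V then 1 else 0) -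
              if U = V then (if U ∈ A ∧ D ≤ U then (1 : ℝ) else 0) else 0) else 0) =
            if D = U ⊓ V then (if adjGras (k + 1) U V then 1 else 0) else 0 := by
          intro D
          have h3 := isFlat_and_le_iff (hB (hAB hUV.1)) (hB hUV.2) hne D
          simp only [hUV.1, hUV.2, true_and, if_neg hne, sub_zero, ite_zero_mul_ite_zero, mul_one]
          rw [← ite_and, ← ite_and]
          exact if_congr (h3.trans and_comm) rfl rfl
        simp_rw [h2]
        simp [hUV]
    · rw [if_neg (fun h => hUV h.1)]
      symm
      refine Finset.sum_eq_zero fun D _ => ?_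
      by_cases hU : U ∈ A
      · have hV : V ∉ B := fun h => hUV ⟨hU, h⟩
        have hne : U ≠ V := fun h => hV (h ▸ hAB hU)
        simp [hV, hne]
      · simp [hU]
  have h2 : ∀ D : AffineSubspace F (Fin N → F), upDeg A D * upDeg B D - upDeg A D =
      ∑ U : AffineSubspace F (Fin N → F), ∑ V : AffineSubspace F (Fin N → F),
        ((if U ∈ A ∧ D ≤ U then (1 : ℝ) else 0) * (if V ∈ B ∧ D ≤ V then 1 else 0) -
          if U = V then (if U ∈ A ∧ D ≤ U then (1 : ℝ) else 0) else 0) := by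
    intro D
    simp_rw [Finset.sum_sub_distrib, ← Finset.mul_sum, ← Finset.sum_mul, Finset.sum_ite_eq,
      Finset.mem_univ, if_true]
    rfl
  simp_rw [edgeCount, h1, h2]
  rw [Finset.sum_congr rfl fun U _ => Finset.sum_comm, Finset.sum_comm]
  refine Finset.sum_congr rfl fun D _ => ?_
  split_ifs <;> simp

lemma one_sub_expans {A : Set (AffineSubspace F (Fin N → F))}
    (hpos : edgeCount k A Set.univ ≠ 0) :
    1 - expans (adjGras k) A = edgeCount k A A / edgeCount k A Set.univ := by
  have h1 : (Nat.card {x : AffineSubspace F (Fin N → F) × AffineSubspace F (Fin N → F) //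
      x.1 ∈ A ∧ adjGras k x.1 x.2} : ℝ) = edgeCount k A Set.univ := by
    rw [Nat.card_eq_fintype_card, Fintype.card_subtype, ← Finset.sum_boole, Fintype.sum_prod_type]
    simp [edgeCount]
  have h2 : (Nat.card {x : AffineSubspace F (Fin N → F) × AffineSubspace F (Fin N → F) //
      x.1 ∈ A ∧ adjGras k x.1 x.2 ∧ x.2 ∉ A} : ℝ) =
      edgeCount k A Set.univ - edgeCount k A A := by
    rw [Nat.card_eq_fintype_card, Fintype.card_subtype, ← Finset.sum_boole, Fintype.sum_prod_type,
      edgeCount, edgeCount, ← Finset.sum_sub_distrib]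
    refine Finset.sum_congr rfl fun U _ => ?_
    rw [← Finset.sum_sub_distrib]
    refine Finset.sum_congr rfl fun V _ => ?_
    by_cases hU : U ∈ A <;> by_cases hV : V ∈ A <;> by_cases h : adjGras k U V <;> simp [hU, hV, h]
  rw [expans, h1, h2, sub_div, div_self hpos, sub_sub_cancel]

lemma edgeCount_univ {A : Set (AffineSubspace F (Fin N → F))} :
    edgeCount k A Set.univ = edgeCount k A {U | IsFlat k U} := by
  refine Finset.sum_congr rfl fun U _ => Finset.sum_congr rfl fun V _ => ?_
  by_cases h : adjGras k U V
  · have hV : IsFlat k V := h.2.2.1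
    simp [hV]
  · simp [h]

lemma correlation_ge (hN : k + 2 ≤ N) {A : Set (AffineSubspace F (Fin N → F))}
    (hA : A ⊆ {U | IsFlat (k + 1) U}) {θ : ℝ} (hθ : θ ≤ 1 / Fintype.card F)
    (h : θ ≤ 1 - expans (adjGras (k + 1)) A) {a : Fin (k + 2) → F} (ha : Fin.tail a ≠ 0) :
    (Fintype.card F : ℝ) ^ N * θ * ∑ T : Fin (k + 2) → Fin N → F, flatInd A T ≤
      ∑ T, ∑ u : Fin N → F, flatInd A T * flatInd A (T + tens a u) := by
  have ha' : Fin.tail (Pi.single (Fin.last (k + 1)) (1 : F) : Fin (k + 2) → F) ≠ 0 := fun h0 => by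
    have := congr_fun h0 (Fin.last k)
    simp [Fin.tail] at this
  rw [correlation_eq (fun g hg T => flatInd_famComp A T hg) ha ha', correlation_last_eq hA,
    sum_flatInd_eq hA]
  set S₁ := ∑ D : AffineSubspace F (Fin N → F), if IsFlat k D then upDeg A D else 0 with hS₁
  set S₂ := ∑ D : AffineSubspace F (Fin N → F), if IsFlat k D then upDeg A D ^ 2 else 0 with hS₂
  have hq : (2 : ℝ) ≤ Fintype.card F := by exact_mod_cast Fintype.one_lt_card (α := F)
  set q : ℝ := (Fintype.card F : ℝ) with hqdef
  set s : ℝ := q ^ (k + 1) - q ^ k with hs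
  have hqk : 0 < q ^ k := by positivity
  have hs1 : q ^ k ≤ s := by rw [hs, pow_succ]; nlinarith
  have hs0 : 0 < s := hqk.trans_le hs1
  have hup0 : ∀ D, 0 ≤ upDeg A D := fun D =>
    Finset.sum_nonneg fun U _ => by split_ifs <;> simp
  have hS₁0 : 0 ≤ S₁ := Finset.sum_nonneg fun D _ => by
    split_ifs
    exacts [hup0 D, le_rfl]
  have hqN : q ^ (k + 1) < q ^ N := pow_lt_pow_right₀ (by linarith) (by omega)
  have hAA : edgeCount (k + 1) A A = S₂ - S₁ := by
    rw [edgeCount_eq le_rfl hA, hS₁, hS₂, ← Finset.sum_sub_distrib]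
    refine Finset.sum_congr rfl fun D _ => ?_
    split_ifs <;> ring
  have hAU : s * edgeCount (k + 1) A Set.univ = (q ^ N - q ^ (k + 1)) * S₁ := by
    rw [edgeCount_univ, edgeCount_eq hA le_rfl, hS₁, Finset.mul_sum, Finset.mul_sum]
    refine Finset.sum_congr rfl fun D _ => ?_
    split_ifs with hD
    · have := upDeg_flats hD
      rw [← hqdef, ← hs] at this
      linear_combination (upDeg A D) * this - upDeg A D * hs
    · simp
  have hkey : θ * (q ^ N - q ^ (k + 1)) * S₁ ≤ s * (S₂ - S₁) := by
    rcases hS₁0.eq_or_lt with h0 | h0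
    · have : edgeCount (k + 1) A A ≥ 0 := Finset.sum_nonneg fun U _ => Finset.sum_nonneg fun V _ => by
        split_ifs <;> simp
      rw [← hAA, ← h0, mul_zero]
      exact mul_nonneg hs0.le this
    · have hpos : 0 < edgeCount (k + 1) A Set.univ := by
        refine pos_of_mul_pos_right ?_ hs0.le
        rw [hAU]
        exact mul_pos (by linarith) h0
      rw [one_sub_expans hpos.ne', le_div_iff₀ hpos, hAA] at h
      calc θ * (q ^ N - q ^ (k + 1)) * S₁ = s * (θ * edgeCount (k + 1) A Set.univ) := by
            rw [mul_assoc, ← hAU]; ring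
        _ ≤ s * (S₂ - S₁) := by gcongr
  have hθ' : θ * q ^ (k + 1) ≤ s := by
    refine le_trans ?_ hs1
    calc θ * q ^ (k + 1) ≤ 1 / q * q ^ (k + 1) := by gcongr
      _ = q ^ k := by rw [pow_succ]; field_simp
  have hfin : q ^ N * θ * S₁ ≤ s * S₂ := by nlinarith
  calc q ^ N * θ * (frameCount F k * (s * S₁)) = frameCount F k * s * (q ^ N * θ * S₁) := by ring
    _ ≤ frameCount F k * s * (s * S₂) := by gcongr
    _ = _ := by ring

end Expansion

section Conclusion

lemma levelOne_contradiction {q t ν W B ε c : ℝ} (hq : 2 ≤ q) (ht0 : 0 < t) (ht1 : t ≤ 1)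
    (hν0 : 0 < ν) (hν : ν ≤ t ^ 4) (hB0 : 0 ≤ B) (hB : B ≤ 1 - ε - 867 * q ^ 2 * t)
    (hc0 : 0 ≤ c) (hc : c ≤ 8 * t ^ 4) (hlow : (1 - ε - (q + 1) * ν) * ν ≤ W)
    (hup : W ^ 2 ≤ ν * ((B + t ^ 4) * W + √(ν * (q ^ 4 * W ^ 2 + c ^ 2 * q ^ 2 * W)))) :
    False := by
  have hq2 : q + 1 ≤ q ^ 2 := by nlinarith
  have ht2 : t ^ 2 ≤ t := by nlinarith
  have ht4 : t ^ 4 ≤ t := pow_le_of_le_one ht0.le ht1 (by norm_num)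
  have hq4 : 4 ≤ q ^ 2 := by nlinarith
  have h1 : (q + 1) * ν ≤ q ^ 2 * t := mul_le_mul hq2 (hν.trans ht4) hν0.le (by positivity)
  have hW : (B + 866 * q ^ 2 * t) * ν ≤ W := by
    refine le_trans (mul_le_mul_of_nonneg_right ?_ hν0.le) hlow
    linarith
  have hqt : 0 < q ^ 2 * t := by positivity
  have hW1 : 866 * (q ^ 2 * t) * ν ≤ W := by nlinarith
  have hW0 : 0 < W := lt_of_lt_of_le (by positivity) hW1
  have hc2 : c ^ 2 ≤ 64 * t ^ 8 := by
    calc c ^ 2 ≤ (8 * t ^ 4) ^ 2 := by gcongr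
      _ = 64 * t ^ 8 := by ring
  have hterm : ν * (c ^ 2 * q ^ 2 * W) ≤ 3 * (q ^ 4 * t ^ 4 * W ^ 2) := by
    have h2 : 64 * ν * t ^ 4 ≤ 3 * q ^ 2 * W := by
      have h3 : 64 * ν * t ^ 4 ≤ W := by
        refine le_trans ?_ hW1
        have : 64 * t ^ 4 ≤ 866 * (q ^ 2 * t) := by nlinarith
        nlinarith
      nlinarith
    calc ν * (c ^ 2 * q ^ 2 * W) ≤ ν * (64 * t ^ 8 * q ^ 2 * W) := by gcongr
      _ = (64 * ν * t ^ 4) * (t ^ 4 * q ^ 2 * W) := by ring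
      _ ≤ (3 * q ^ 2 * W) * (t ^ 4 * q ^ 2 * W) := by gcongr
      _ = _ := by ring
  have hmain : ν * (q ^ 4 * W ^ 2) ≤ t ^ 4 * (q ^ 4 * W ^ 2) := by gcongr
  have hsqrt : √(ν * (q ^ 4 * W ^ 2 + c ^ 2 * q ^ 2 * W)) ≤ 2 * q ^ 2 * t ^ 2 * W := by
    refine Real.sqrt_le_iff.mpr ⟨by positivity, ?_⟩
    calc _ = ν * (q ^ 4 * W ^ 2) + ν * (c ^ 2 * q ^ 2 * W) := by ring
      _ ≤ t ^ 4 * (q ^ 4 * W ^ 2) + 3 * (q ^ 4 * t ^ 4 * W ^ 2) := add_le_add hmain hterm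
      _ = _ := by ring
  have h4 : W ≤ ν * (B + t ^ 4 + 2 * q ^ 2 * t ^ 2) := by
    refine le_of_mul_le_mul_right ?_ hW0
    calc W * W = W ^ 2 := by ring
      _ ≤ ν * ((B + t ^ 4) * W + 2 * q ^ 2 * t ^ 2 * W) := hup.trans (by gcongr)
      _ = _ := by ring
  have h5 : B + 866 * q ^ 2 * t ≤ B + t ^ 4 + 2 * q ^ 2 * t ^ 2 := by
    refine le_of_mul_le_mul_right ?_ hν0
    linarith
  have h6 : q ^ 2 * t ^ 2 ≤ q ^ 2 * t := by gcongr
  nlinarith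

lemma lower_bound_of_levelOneWeight {q δ ν W : ℝ} (hq : 2 ≤ q)
    (h : (1 / q - δ) * ν ≤ (q ^ 2)⁻¹ * ν + (1 - (q ^ 2)⁻¹) * ν ^ 2 + (q⁻¹ - (q ^ 2)⁻¹) * W) :
    (1 - q ^ 2 * (δ / (q - 1)) - (q + 1) * ν) * ν ≤ W := by
  have hq1 : 0 < q - 1 := by linarith
  have h1 := mul_le_mul_of_nonneg_left h (sq_nonneg q)
  have h2 : q ^ 2 * ((1 / q - δ) * ν) = (q - q ^ 2 * δ) * ν := by field_simp
  have h3 : q ^ 2 * ((q ^ 2)⁻¹ * ν + (1 - (q ^ 2)⁻¹) * ν ^ 2 + (q⁻¹ - (q ^ 2)⁻¹) * W) =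
      ν + (q ^ 2 - 1) * ν ^ 2 + (q - 1) * W := by field_simp
  rw [h2, h3] at h1
  refine le_of_mul_le_mul_left ?_ hq1
  calc (q - 1) * ((1 - q ^ 2 * (δ / (q - 1)) - (q + 1) * ν) * ν) =
      (q - 1 - q ^ 2 * δ - (q ^ 2 - 1) * ν) * ν := by field_simp; ring
    _ ≤ (q - 1) * W := by linarith

variable {F : Type} [Field F] {N k : ℕ}

lemma incidentFlats_of_ne_zero {s : F} (hs : s ≠ 0) (z : Fin N → F) :
    incidentFlats k s z = {U | IsFlat k U ∧ s⁻¹ • z ∈ U} := by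
  simp [incidentFlats, hs]

lemma incidentFlats_zero {z : Fin N → F} (hz : z ≠ 0) :
    incidentFlats k (0 : F) z = {U | IsFlat k U ∧ z ∈ U.direction} := by
  simp [incidentFlats, hz]

lemma incidentFlats_zero_zero :
    incidentFlats k (0 : F) (0 : Fin N → F) = ∅ := by
  simp [incidentFlats]

lemma dens_nonneg {α : Type} (A C : Set α) : 0 ≤ dens A C :=
  div_nonneg (Nat.cast_nonneg _) (Nat.cast_nonneg _)

variable [Fintype F]

lemma famMean_flatInd_le {A : Set (AffineSubspace F (Fin N → F))}
    (hA : A ⊆ {U | IsFlat k U}) {ξ : ℝ} (hξ : 0 ≤ ξ) (h : dens A {U | IsFlat k U} ≤ ξ) :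
    famMean (flatInd (k := k) A) ≤ ξ := by
  have h1 := famMean_flatInd_inter_le (k := k) le_rfl h
  rw [Set.inter_eq_left.mpr hA] at h1
  have h2 : famMean (flatInd (k := k) {U : AffineSubspace F (Fin N → F) | IsFlat k U}) ≤ 1 := by
    refine (famMean_mono fun T => flatInd_le_one _ T).trans (le_of_eq ?_)
    simp [famMean]
  nlinarith

lemma famMean_flatInd_pos {A : Set (AffineSubspace F (Fin N → F))}
    (hA : A ⊆ {U | IsFlat k U}) (hne : A.Nonempty) : 0 < famMean (flatInd (k := k) A) := by
  have : Nonempty A := hne.to_subtype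
  rw [famMean, sum_flatInd k hA]
  have h1 : 0 < Nat.card A := Nat.card_pos
  have h2 := frameCount_pos (F := F) (k := k)
  have h3 : 0 < Fintype.card (Fin (k + 1) → Fin N → F) := Fintype.card_pos
  positivity

end Conclusion

/-- A small, pseudorandom (w.r.t. affine hyperplanes, linear hyperplanes on the
direction, and points on the direction) set of `ℓ`-flats with edge expansion at most
`1 - 1/q + δ` in the affine Grassmann graph must be dense among the flats through some point. -/
theorem affine_grassmann_structure
    (p k : ℕ) (hp : p.Prime) (hk : 1 ≤ k)
    (F : Type) [Field F] [Fintype F]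
    (q : ℕ) (hq : q = p ^ k) (hcard : Fintype.card F = q)
    (n ℓ : ℕ) (hℓ : 1 ≤ ℓ) (hn : 1 ≤ n)
    (ξ δ : ℝ) (hξ0 : 0 ≤ ξ) (hξ1 : ξ ≤ 1) (hδ : 0 ≤ δ)
    (A : Set (AffineSubspace F (Fin (n + ℓ) → F)))
    (hA : A ⊆ {U | IsFlat ℓ U}) (hAne : A.Nonempty)
    (h1 : dens A {U | IsFlat ℓ U} ≤ ξ)
    (h2 : ∀ W : AffineSubspace F (Fin (n + ℓ) → F), IsFlat (n + ℓ - 1) W →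
      dens A {U | IsFlat ℓ U ∧ U ≤ W} ≤ ξ)
    (h3 : ∀ W₀ : Submodule F (Fin (n + ℓ) → F), Module.finrank F W₀ = n + ℓ - 1 →
      dens A {U | IsFlat ℓ U ∧ U.direction ≤ W₀} ≤ ξ)
    (h4 : ∀ v : Fin (n + ℓ) → F, v ≠ 0 →
      dens A {U | IsFlat ℓ U ∧ v ∈ U.direction} ≤ ξ)
    (h5 : 1 / (q : ℝ) - δ ≤ 1 - expans (adjGras ℓ) A) :
    ∃ x : Fin (n + ℓ) → F,
      1 - (q : ℝ) ^ 2 *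
          (4 * (q : ℝ) ^ (-(ℓ : ℤ)) + 867 * ξ ^ ((1 : ℝ) / 4) + δ / ((q : ℝ) - 1)) ≤
        dens A {U | IsFlat ℓ U ∧ x ∈ U} := by
  classical
  subst hcard
  obtain ⟨j, rfl⟩ : ∃ j, ℓ = j + 1 := ⟨ℓ - 1, by omega⟩
  obtain ⟨ψ, hψ⟩ := exists_isPrimitive F
  obtain ⟨P, hP⟩ := exists_isLineTransversal (F := F) (j + 1 + 1)
  by_contra! hx
  have hq : (2 : ℝ) ≤ Fintype.card F := by exact_mod_cast Fintype.one_lt_card (α := F)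
  have hinv : ∀ g, FixesHead g → ∀ T, flatInd (k := j + 1) A (famComp T g) = flatInd A T :=
    fun g hg T => flatInd_famComp A T hg
  have hsq := flatInd_mul_self (k := j + 1) A
  have hν0 := famMean_flatInd_pos hA hAne
  have hν := famMean_flatInd_le hA hξ0 h1
  have hξ : 0 < ξ := hν0.trans_le hν
  set q : ℝ := (Fintype.card F : ℝ) with hqdef
  set t : ℝ := ξ ^ ((1 : ℝ) / 4) with ht
  have ht4 : t ^ 4 = ξ := by
    rw [ht, ← Real.rpow_natCast, ← Real.rpow_mul hξ0]
    norm_num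
  have ht0 : 0 < t := Real.rpow_pos_of_pos hξ _
  have ht1 : t ≤ 1 := Real.rpow_le_one hξ0 hξ1 (by norm_num)
  set B : ℝ := 1 - q ^ 2 * (4 * q ^ (-((j + 1 : ℕ) : ℤ)) + 867 * t + δ / (q - 1)) with hB
  have hB0 : 0 ≤ B := (dens_nonneg _ _).trans (hx 0).le
  have hqz : 0 ≤ q ^ 2 * (4 * q ^ (-((j + 1 : ℕ) : ℤ))) := by positivity
  have hM : ∀ α ∈ P, ∀ z, famCond (flatInd (k := j + 1) A) α z ≤ B + ξ := by
    intro α hα z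
    refine famCond_flatInd_le (hP.ne_zero α hα) (by linarith) ?_
    by_cases h0 : α 0 = 0
    · rw [h0]
      by_cases hz : z = 0
      · rw [hz, incidentFlats_zero_zero]
        simp only [_root_.dens, Set.inter_empty, Nat.card_of_isEmpty]
        simp
        linarith
      · rw [incidentFlats_zero hz]
        linarith [h4 z hz]
    · rw [incidentFlats_of_ne_zero h0]
      linarith [hx ((α 0)⁻¹ • z)]
  have hann : ∀ b : Fin (n + (j + 1)) → F, b ≠ 0 →
      q ^ (j + 1) * annMean (flatInd (k := j + 1) A) b ≤ ξ :=
    fun b hb => annMean_flatInd_le hξ0 h3 hb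
  have hκ : ∀ α ∈ P, ∀ b : Fin (n + (j + 1)) → F, b ≠ 0 →
      ‖coef ψ (flatInd (k := j + 1) A) (tens α b)‖ ≤ 4 * ξ / q ^ (j + 1) :=
    fun α hα b hb => norm_coef_tens_le hψ (flatInd_nonneg A) hinv hℓ hν (hann b hb)
      (hP.ne_zero α hα)
  have hup := levelOneWeight_sq_le hψ hsq hP.pairIndep hP.ne_zero hκ hM
  rw [← mul_pow, ← ht4] at hup
  have hlow := levelOneWeight_ge hψ hℓ hsq hP fun a ha => correlation_ge (by omega) hA
    (θ := 1 / q - δ) (by linarith) h5 ha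
  refine levelOne_contradiction hq ht0 ht1 hν0 (ht4 ▸ hν) hB0 ?_ (by positivity) ?_
    (lower_bound_of_levelOneWeight hq hlow) hup
  · linarith
  · have := hP.card_le
    rw [ht4, div_mul_eq_mul_div, div_le_iff₀ (by positivity)]
    nlinarith

end
end

section
/- For every point x ∈ F_q^p such that x_i ≠ 0 for all 1 ≤ i ≤ p−1 and x_I + x_p ≠ 0 for every subset I ⊆ {1,…,p−1} (where x_I = Σ_{i∈I} x_i), the evaluation of P at x equals 0. Consequently, the support {x ∈ F_q^p : P(x) ≠ 0} is contained in the union of the hyperplanes {x : x_i = 0} for 1 ≤ i ≤ p−1 and {x : x_I + x_p = 0} for I ⊆ {1,…,p−1}, and hence has cardinality at most (2^{p−1} + p − 1)·q^{p−1}. -/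
noncomputable section

open Finset

/-- A set of functions in which each element is determined by its values away from one
coordinate has at most `|F| ^ (|ι| - 1)` elements. -/
theorem ncard_le_of_determined_off {ι F : Type*} [Fintype ι] [DecidableEq ι] [Fintype F]
    (j : ι) (S : Set (ι → F))
    (h : ∀ x ∈ S, ∀ y ∈ S, (∀ i, i ≠ j → x i = y i) → x j = y j) :
    S.ncard ≤ Fintype.card F ^ (Fintype.card ι - 1) := by
  have hinj : Set.InjOn (fun (x : ι → F) (i : {i // i ≠ j}) => x i) S := by
    intro x hx y hy hxy
    have hoff : ∀ i, i ≠ j → x i = y i := fun i hi => congrFun hxy ⟨i, hi⟩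
    funext i
    by_cases hi : i = j
    · exact hi ▸ h x hx y hy hoff
    · exact hoff i hi
  calc S.ncard ≤ (Set.univ : Set ({i // i ≠ j} → F)).ncard :=
        Set.ncard_le_ncard_of_injOn _ (fun _ _ => Set.mem_univ _) hinj
    _ = Fintype.card F ^ (Fintype.card ι - 1) := by
        simp [Set.ncard_univ, Nat.card_eq_fintype_card, Fintype.card_subtype_compl]

/-- The alternating sum defining `P` vanishes when all the linear forms are nonzero. -/
theorem eval_eq_zero_of_Pdef {F : Type} [Field F] [Fintype F] {p q : ℕ} (hp : 1 < p)
    (hcard : Fintype.card F = q) {P : MvPolynomial (Fin p) F} (hP : Pdef p q (by omega) P)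
    (x : Fin p → F) (hx : ∀ i : Fin p, (i : ℕ) < p - 1 → x i ≠ 0)
    (hI : ∀ I : Finset (Fin (p - 1)),
      (∑ i ∈ I, x (Fin.castLE (Nat.sub_le p 1) i)) +
        x ⟨p - 1, Nat.sub_lt (by omega) one_pos⟩ ≠ 0) :
    MvPolynomial.eval x P = 0 := by
  have h := congrArg (MvPolynomial.eval x) hP
  simp only [map_mul, map_prod, map_sum, map_add, map_pow, MvPolynomial.eval_X,
    MvPolynomial.eval_C] at h
  have hpow (I : Finset (Fin (p - 1))) := FiniteField.pow_card_sub_one_eq_one _ (hI I)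
  simp only [hcard] at hpow
  simp only [hpow, mul_one] at h
  have hne : (Finset.univ : Finset (Fin (p - 1))).Nonempty := ⟨⟨0, by omega⟩, mem_univ _⟩
  have halt := congrArg (Int.cast : ℤ → F) (Finset.sum_powerset_neg_one_pow_card_of_nonempty hne)
  push_cast at halt
  simp only [pow_succ, ← Finset.sum_mul, ← Finset.powerset_univ, halt, zero_mul] at h
  exact (mul_eq_zero.mp h).resolve_left (Finset.prod_ne_zero_iff.mpr fun i _ => hx _ i.isLt)

/-- The support of `P`: `P` vanishes at every point with `x_i ≠ 0` for
`i < p` and `x_I + x_p ≠ 0` for all `I ⊆ [p-1]`; hence the support of `P` is contained in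
the corresponding union of hyperplanes and has size at most `(2^{p-1} + p - 1)·q^{p-1}`. -/
theorem support_of_P
    (p k : ℕ) (hp : p.Prime) (hk : 1 ≤ k)
    (F : Type) [Field F] [Fintype F]
    (q : ℕ) (hq : q = p ^ k) (hcard : Fintype.card F = q)
    (P : MvPolynomial (Fin p) F) (hP : Pdef p q hp.pos P) :
    (∀ x : Fin p → F,
      (∀ i : Fin p, (i : ℕ) < p - 1 → x i ≠ 0) →
      (∀ I : Finset (Fin (p - 1)),
        (∑ i ∈ I, x (Fin.castLE (Nat.sub_le p 1) i)) +
          x ⟨p - 1, Nat.sub_lt hp.pos one_pos⟩ ≠ 0) →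
      MvPolynomial.eval x P = 0) ∧
    {x : Fin p → F | MvPolynomial.eval x P ≠ 0} ⊆
      ((⋃ i : Fin p, ⋃ _ : (i : ℕ) < p - 1, {x : Fin p → F | x i = 0}) ∪
        (⋃ I : Finset (Fin (p - 1)), {x : Fin p → F |
          (∑ i ∈ I, x (Fin.castLE (Nat.sub_le p 1) i)) +
            x ⟨p - 1, Nat.sub_lt hp.pos one_pos⟩ = 0})) ∧
    {x : Fin p → F | MvPolynomial.eval x P ≠ 0}.ncard ≤ (2 ^ (p - 1) + p - 1) * q ^ (p - 1) := by
  have hvan := fun x => eval_eq_zero_of_Pdef hp.one_lt hcard hP x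
  have hsub : {x : Fin p → F | MvPolynomial.eval x P ≠ 0} ⊆
      ((⋃ i : Fin p, ⋃ _ : (i : ℕ) < p - 1, {x : Fin p → F | x i = 0}) ∪
        (⋃ I : Finset (Fin (p - 1)), {x : Fin p → F |
          (∑ i ∈ I, x (Fin.castLE (Nat.sub_le p 1) i)) +
            x ⟨p - 1, Nat.sub_lt hp.pos one_pos⟩ = 0})) := by
    intro x hx
    contrapose! hx
    simp only [Set.mem_union, Set.mem_iUnion, Set.mem_ofPred_eq, not_or, not_exists] at hx
    simpa using hvan x hx.1 hx.2
  refine ⟨hvan, hsub, (Set.ncard_le_ncard hsub (Set.toFinite _)).trans ?_⟩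
  have hcoord : (⋃ i : Fin p, ⋃ _ : (i : ℕ) < p - 1, {x : Fin p → F | x i = 0}) ⊆
      ⋃ i : Fin (p - 1), {x : Fin p → F | x (Fin.castLE (Nat.sub_le p 1) i) = 0} := by
    intro x hx
    simp only [Set.mem_iUnion] at hx ⊢
    obtain ⟨i, hi, hxi⟩ := hx
    exact ⟨⟨i, hi⟩, hxi⟩
  have hbound₁ : (⋃ i : Fin (p - 1),
      {x : Fin p → F | x (Fin.castLE (Nat.sub_le p 1) i) = 0}).ncard ≤
        (p - 1) * q ^ (p - 1) := by
    refine (Set.ncard_iUnion_le_of_fintype _).trans ?_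
    refine (Finset.sum_le_card_nsmul _ _ (q ^ (p - 1)) fun i _ => ?_).trans (by simp)
    have := ncard_le_of_determined_off (Fin.castLE (Nat.sub_le p 1) i)
      {x : Fin p → F | x (Fin.castLE (Nat.sub_le p 1) i) = 0}
      fun x hx y hy _ => Eq.trans hx (Eq.symm hy)
    simpa [hcard] using this
  have hbound₂ : (⋃ I : Finset (Fin (p - 1)), {x : Fin p → F |
      (∑ i ∈ I, x (Fin.castLE (Nat.sub_le p 1) i)) +
        x ⟨p - 1, Nat.sub_lt hp.pos one_pos⟩ = 0}).ncard ≤ 2 ^ (p - 1) * q ^ (p - 1) := by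
    refine (Set.ncard_iUnion_le_of_fintype _).trans ?_
    refine (Finset.sum_le_card_nsmul _ _ (q ^ (p - 1)) fun I _ => ?_).trans (by simp)
    have := ncard_le_of_determined_off (⟨p - 1, Nat.sub_lt hp.pos one_pos⟩ : Fin p)
      {x : Fin p → F | (∑ i ∈ I, x (Fin.castLE (Nat.sub_le p 1) i)) +
        x ⟨p - 1, Nat.sub_lt hp.pos one_pos⟩ = 0} (by
        intro x hx y hy hxy
        have hsum : ∑ i ∈ I, x (Fin.castLE (Nat.sub_le p 1) i) =
            ∑ i ∈ I, y (Fin.castLE (Nat.sub_le p 1) i) :=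
          Finset.sum_congr rfl fun i _ => hxy _ fun h => i.isLt.ne (congrArg Fin.val h)
        simp only [Set.mem_ofPred_eq] at hx hy
        rw [hsum] at hx
        exact add_left_cancel (hx.trans hy.symm))
    simpa [hcard] using this
  calc _ ≤ (p - 1) * q ^ (p - 1) + 2 ^ (p - 1) * q ^ (p - 1) :=
        (Set.ncard_union_le _ _).trans (add_le_add
          ((Set.ncard_le_ncard hcoord (Set.toFinite _)).trans hbound₁) hbound₂)
    _ = (2 ^ (p - 1) + p - 1) * q ^ (p - 1) := by
        rw [← add_mul, Nat.add_sub_assoc hp.one_le, add_comm]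

end
end
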